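/- arXiv:1801.09516 — 4 statements merged into one kernel-verified Lean document; each statement's English description precedes it below -/
import Mathlib

section
/- For all integers n and d with 0 < d < n, N(n,d) ≤ L(n−1,d) + L(n−1,d−1), where N(n,d) is the number of binary necklaces of length n with exactly d ones and L(m,e) is the number of binary Lyndon words of length m with exactly e ones. -/
/-- `w` is a necklace: lexicographically ≤ all of its rotations. -/
def IsNecklace (w : List ℕ) : Prop := ∀ i : ℕ, w ≤ w.rotate i

/-- `w` is a Lyndon word: nonempty and strictly smaller than all nontrivial rotations. -/
def IsLyndon (w : List ℕ) : Prop :=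
  w ≠ [] ∧ ∀ i : ℕ, 0 < i → i < w.length → w < w.rotate i

/-- `w` is a prenecklace over the alphabet `{0,…,k-1}`. -/
def IsPrenecklace (k : ℕ) (w : List ℕ) : Prop :=
  ∃ v : List ℕ, w <+: v ∧ (∀ a ∈ v, a < k) ∧ IsNecklace v

/-- Length of the longest prefix of `w` that is a Lyndon word. -/
noncomputable def lyn (w : List ℕ) : ℕ :=
  sSup {p | p ≤ w.length ∧ IsLyndon (w.take p)}

/-- Number of binary necklaces of length `n` and density `d`. -/
noncomputable def N (n d : ℕ) : ℕ :=
  {w : List ℕ | w.length = n ∧ (∀ a ∈ w, a < 2) ∧ w.count 1 = d ∧ IsNecklace w}.ncard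

/-- Number of binary Lyndon words of length `n` and density `d`. -/
noncomputable def L (n d : ℕ) : ℕ :=
  {w : List ℕ | w.length = n ∧ (∀ a ∈ w, a < 2) ∧ w.count 1 = d ∧ IsLyndon w}.ncard

/-- Number of necklaces over `{0,…,k-1}` with content `c`. -/
noncomputable def Nk (k : ℕ) (c : Fin k → ℕ) : ℕ :=
  {w : List ℕ | (∀ a ∈ w, a < k) ∧ (∀ i : Fin k, w.count i.val = c i) ∧ IsNecklace w}.ncard

/-- Number of Lyndon words over `{0,…,k-1}` with content `c`. -/
noncomputable def Lk (k : ℕ) (c : Fin k → ℕ) : ℕ :=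
  {w : List ℕ | (∀ a ∈ w, a < k) ∧ (∀ i : Fin k, w.count i.val = c i) ∧ IsLyndon w}.ncard

lemma app_lt {g g' : List ℕ} (hl : g.length = g'.length) (h : g < g') (s t : List ℕ) :
    g ++ s < g' ++ t := by
  induction g generalizing g' with
  | nil =>
    cases g' with
    | nil => exact absurd h (lt_irrefl _)
    | cons => simp at hl
  | cons a g ih =>
    cases g' with
    | nil => simp at hl
    | cons b g' =>
      simp only [List.cons_append, List.cons_lt_cons_iff] at h ⊢
      rcases h with h | ⟨h1, h2⟩
      · exact Or.inl h
      · exact Or.inr ⟨h1, ih (by simpa using hl) h2⟩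

lemma le_of_app {g g' s t : List ℕ} (hl : g.length = g'.length) (h : g ++ s ≤ g' ++ t) :
    g ≤ g' := by
  by_contra hc
  exact absurd h (not_le.mpr (app_lt hl.symm (not_le.mp hc) t s))

lemma app_left_lt (a : List ℕ) {s t : List ℕ} : a ++ s < a ++ t ↔ s < t := by
  induction a with
  | nil => rfl
  | cons x a ih => simp [List.cons_lt_cons_iff, ih]

lemma neck_split {a b : List ℕ} (h : IsNecklace (a ++ b)) : a ++ b ≤ b ++ a := by
  have := h a.length
  rwa [List.rotate_append_length_eq] at this

lemma lyn_split {a b : List ℕ} (h : IsLyndon (a ++ b)) (ha : a ≠ []) (hb : b ≠ []) :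
    a ++ b < b ++ a := by
  have := h.2 a.length (List.length_pos_iff.mpr ha)
    (by have := List.length_pos_iff.mpr hb; simp; omega)
  rwa [List.rotate_append_length_eq] at this

lemma lyn_of_split {w : List ℕ} (hw : w ≠ [])
    (h : ∀ a b, w = a ++ b → a ≠ [] → b ≠ [] → a ++ b < b ++ a) : IsLyndon w := by
  refine ⟨hw, fun i hi hil => ?_⟩
  have h1 := h (w.take i) (w.drop i) (by simp)
    (by intro h; have := congrArg List.length h; rw [List.length_take, List.length_nil] at this; omega)
    (by intro h; have := congrArg List.length h; simp at this; omega)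
  rw [List.rotate_eq_drop_append_take hil.le]
  simpa using h1

lemma neck_double {X : List ℕ} (h : IsLyndon X) : IsNecklace (X ++ X) := by
  have key : ∀ i, i ≤ X.length → X ++ X ≤ (X ++ X).rotate i := by
    intro i hi
    rcases Nat.eq_zero_or_pos i with rfl | h0
    · simp
    rcases hi.lt_or_eq with hlt | rfl
    · have h1 := h.2 i h0 hlt
      rw [List.rotate_eq_drop_append_take hi] at h1
      rw [List.rotate_eq_drop_append_take (by simp; omega),
        List.drop_append_of_le_length hi, List.take_append_of_le_length hi]
      have := app_lt (by simp; omega) h1 X (X.drop i ++ X.take i)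
      have e : X.drop i ++ X.take i ++ (X.drop i ++ X.take i) = X.drop i ++ X ++ X.take i := by
        rw [List.append_assoc, ← List.append_assoc (X.take i), List.take_append_drop,
          List.append_assoc]
      rw [e] at this
      exact this.le
    · rw [List.rotate_append_length_eq]
  intro i
  have hm : 0 < X.length := List.length_pos_iff.mpr h.1
  rw [← List.rotate_mod]
  have hlt : i % (X ++ X).length < (X ++ X).length := Nat.mod_lt _ (by simp; omega)
  set j := i % (X ++ X).length
  by_cases hj : j ≤ X.length
  · exact key j hj
  · have : (X ++ X).rotate j = (X ++ X).rotate (j - X.length) := by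
      conv_lhs => rw [show j = X.length + (j - X.length) by omega]
      rw [← List.rotate_rotate, List.rotate_append_length_eq]
    rw [this]
    exact key _ (by simp at hlt; omega)

/-- Prefix `y0` of a necklace gives the Lyndon word `y1`. -/
lemma lemP {y W : List ℕ} (hW : IsNecklace W) (hy : y ≠ []) (hp : y ++ [0] <+: W) :
    IsLyndon (y ++ [1]) := by
  obtain ⟨r, rfl⟩ := hp
  apply lyn_of_split (by simp)
  intro a b' hab ha hb'
  obtain ⟨b, c, rfl⟩ : ∃ b c, b' = b ++ [c] :=
    ⟨b'.dropLast, b'.getLast hb', (List.dropLast_append_getLast hb').symm⟩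
  rw [← List.append_assoc] at hab
  obtain ⟨rfl, hc⟩ := List.append_inj' hab rfl
  obtain rfl : 1 = c := by simpa using hc
  have h1 : a ++ (b ++ [0] ++ r) ≤ (b ++ [0] ++ r) ++ a := neck_split (by simpa using hW)
  have hal : 0 < a.length := List.length_pos_iff.mpr ha
  obtain ⟨g, h, hgh, hg⟩ : ∃ g h, a ++ b = g ++ h ∧ g.length = b.length + 1 :=
    ⟨(a ++ b).take (b.length + 1), (a ++ b).drop (b.length + 1), by simp, by simp; omega⟩
  have h2 : g ++ (h ++ [0] ++ r) ≤ (b ++ [0]) ++ (r ++ a) := by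
    have e : a ++ (b ++ [0] ++ r) = g ++ (h ++ [0] ++ r) := by
      have : a ++ (b ++ [0] ++ r) = (a ++ b) ++ ([0] ++ r) := by simp
      rw [this, hgh]; simp
    rw [← e]; simpa using h1
  have h3 : g ≤ b ++ [0] := le_of_app (by simp [hg]) h2
  have h4 : g < b ++ [1] := lt_of_le_of_lt h3 ((app_left_lt b).mpr (by decide))
  have h5 := app_lt (by simp [hg]) h4 (h ++ [1]) a
  have e : a ++ (b ++ [1]) = g ++ (h ++ [1]) := by
    rw [← List.append_assoc, hgh]; simp
  rw [e]; exact h5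

lemma lyn_app_ones {y : List ℕ} (h : IsLyndon (y)) (h0 : [0] <+: y) (k : ℕ) :
    IsLyndon (y ++ List.replicate k 1) := by
  induction k with
  | zero => simpa using h
  | succ k ih =>
    rw [List.replicate_succ', ← List.append_assoc]
    apply lemP (neck_double ih) ih.1
    rw [List.prefix_append_right_inj]
    exact h0.trans (List.prefix_append _ _)

/-- `X` Lyndon, `b` proper nonempty prefix: `Xb` is not a necklace. -/
lemma not_neck {X b : List ℕ} (hX : IsLyndon X) (hb : b ≠ []) (hp : b <+: X)
    (hl : b.length < X.length) : ¬ IsNecklace (X ++ b) := by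
  obtain ⟨c, rfl⟩ := hp
  intro h
  have hc : c ≠ [] := by rintro rfl; simp at hl
  have h1 := neck_split h
  have h2 := lyn_split hX hb hc
  have h3 := (app_left_lt b).mpr h2
  apply absurd h1 (not_le.mpr _)
  simpa using h3

lemma unbordered {X g : List ℕ} (hX : IsLyndon X) (hg : g ≠ []) (hp : g <+: X) (hs : g <:+ X)
    (hl : g.length < X.length) : False := by
  obtain ⟨c, rfl⟩ := hp
  obtain ⟨e, he⟩ := hs
  have hc : c ≠ [] := by rintro rfl; simp at hl
  have he' : e ≠ [] := by rintro rfl; simp at he; exact hc he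
  have h1 := lyn_split hX hg hc
  rw [← he] at hX
  have h2 := lyn_split hX he' hg
  rw [he] at h2
  have h3 := (app_left_lt g).mp h2
  have hlen : c.length = e.length := by
    have := congrArg List.length he; simp at this; omega
  have h4 := app_lt hlen h3 g g
  rw [he] at h4
  exact lt_asymm h1 h4

/-- Existence of a short border. -/
lemma border {p : List ℕ} (hW : IsNecklace (p ++ [1])) (hp0 : p ≠ []) (hp : ¬ IsLyndon p) :
    ∃ U v, p = U ++ v ∧ v ≠ [] ∧ v <+: U := by
  have h1 : ∃ l, 0 < l ∧ ∃ a b, p = a ++ b ∧ b.length = l ∧ a ≠ [] ∧ b <+: p := by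
    by_contra hc
    apply hp
    apply lyn_of_split hp0
    intro a b hab ha hb
    by_contra hlt
    apply hc
    refine ⟨b.length, List.length_pos_iff.mpr hb, a, b, hab, rfl, ha, ?_⟩
    subst hab
    have hn : a ++ (b ++ [1]) ≤ (b ++ [1]) ++ a := neck_split (by simpa using hW)
    obtain ⟨g, h, hgh, hg⟩ : ∃ g h, a ++ b = g ++ h ∧ g.length = b.length :=
      ⟨(a ++ b).take b.length, (a ++ b).drop b.length, by simp, by simp⟩
    rw [← List.append_assoc, hgh, List.append_assoc, List.append_assoc] at hn
    have h2 := le_of_app hg hn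
    rw [hgh, not_lt] at hlt
    have h3 := le_of_app hg.symm hlt
    rw [hgh, le_antisymm h3 h2]
    exact List.prefix_append _ _
  classical
  obtain ⟨hpos, a, b, hab, hbl, ha, hbp⟩ := Nat.find_spec h1
  have hmin := fun m => @Nat.find_min _ _ h1 m
  set l := Nat.find h1
  have hb : b ≠ [] := by rintro rfl; simp at hbl; omega
  refine ⟨a, b, hab, hb, ?_⟩
  rcases le_or_gt b.length a.length with hle | hgt
  · exact List.prefix_of_prefix_length_le hbp (hab ▸ List.prefix_append _ _) hle
  · exfalso
    have hal := List.length_pos_iff.mpr ha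
    -- a is a prefix of b, b = a ++ e, e is a border
    have hpa : a <+: b :=
      List.prefix_of_prefix_length_le (hab ▸ List.prefix_append _ _) hbp hgt.le
    obtain ⟨e, rfl⟩ := hpa
    have hle : a.length + e.length = l := by simpa using hbl
    simp at hgt
    have hel : e.length ≠ 0 := by simpa using (by rintro rfl; simp at hgt : e ≠ [])
    apply hmin e.length (by omega)
    refine ⟨by omega, a ++ a, e, by simp [hab], rfl, by simp [ha], ?_⟩
    have hbp' := hbp
    rw [hab, List.prefix_append_right_inj] at hbp'
    exact hbp'.trans hbp

lemma zeros_aux {y : List ℕ} (h : y ++ [0] ≤ 0 :: y) : ∀ a ∈ y, a = 0 := by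
  induction y with
  | nil => simp
  | cons a y ih =>
    have h' : ¬ (0 :: a :: y < a :: (y ++ [0])) := not_lt.mpr h
    rw [List.cons_lt_cons_iff] at h'
    push Not at h'
    have ha : a = 0 := by have := h'.1; omega
    subst ha
    have := ih (h'.2 rfl)
    simpa using this

lemma ones_tail {v : List ℕ} (hv : ∀ a ∈ v, a < 2) (h0 : 0 ∈ v) :
    ∃ v' k, v = v' ++ [0] ++ List.replicate k 1 := by
  induction v using List.reverseRecOn with
  | nil => simp at h0
  | append_singleton v c ih =>
    have hc : c < 2 := hv c (by simp)
    interval_cases c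
    · exact ⟨v, 0, by simp⟩
    · obtain ⟨v', k, rfl⟩ := ih (fun a ha => hv a (by simp [ha])) (by simpa using h0)
      exact ⟨v', k + 1, by rw [List.replicate_succ']; simp⟩

/-- The combinatorial relation. -/
def RS (w z : List ℕ) : Prop :=
  ∃ U v' k, 1 ≤ k ∧ w = U ++ (v' ++ [0] ++ List.replicate k 1) ++ [1] ∧
    z = (U ++ List.replicate k 1) ++ v' ++ [1] ∧
    IsLyndon (U ++ List.replicate k 1) ∧ v' ++ [0] ++ List.replicate k 1 <+: U

lemma RS_pre {U v' : List ℕ} {k : ℕ} (hk : 1 ≤ k) (h : v' ++ [0] ++ List.replicate k 1 <+: U) :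
    v' ++ [0, 1] <+: U := by
  refine List.IsPrefix.trans ?_ h
  obtain ⟨j, rfl⟩ : ∃ j, k = j + 1 := ⟨k - 1, by omega⟩
  rw [List.replicate_succ]
  exact ⟨List.replicate j 1, by simp⟩

lemma B_S {x w' : List ℕ} (hw : IsNecklace (x ++ [0, 1])) (h : RS w' (x ++ [1])) : False := by
  obtain ⟨U, v', k, hk, -, hz, hL, hp⟩ := h
  have hx : x = (U ++ List.replicate k 1) ++ v' := (List.append_inj' hz rfl).1
  rw [hx, List.append_assoc] at hw
  have h1 := RS_pre hk hp
  refine not_neck hL (by simp) (h1.trans (List.prefix_append _ _)) ?_ hw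
  have := h1.length_le
  simp at this ⊢; omega

lemma S_X {X₁ X₂ v₁ v₂ : List ℕ} (h₂ : IsLyndon X₂)
    (p₁ : v₁ ++ [0, 1] <+: X₁) (e : X₁ ++ v₁ = X₂ ++ v₂) : ¬ X₁.length < X₂.length := by
  intro hlt
  obtain ⟨g, rfl⟩ : X₁ <+: X₂ :=
    List.prefix_of_prefix_length_le (e ▸ List.prefix_append _ _) (List.prefix_append _ _) hlt.le
  have hg : g ≠ [] := by rintro rfl; simp at hlt
  rw [List.append_assoc] at e
  have e' := List.append_cancel_left e
  have hx : 0 < X₁.length := by have := p₁.length_le; simp at this; omega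
  refine unbordered h₂ hg ?_ (List.suffix_append _ _) (by simp; omega)
  have : g <+: v₁ := e' ▸ List.prefix_append _ _
  exact this.trans ((List.prefix_append _ _).trans (p₁.trans (List.prefix_append _ _)))

lemma S_k {U₁ U₂ v' : List ℕ} {k₁ k₂ : ℕ}
    (hw : IsNecklace (U₁ ++ (v' ++ [0] ++ List.replicate k₁ 1) ++ [1]))
    (hW2 : IsNecklace (U₂ ++ (v' ++ [0] ++ List.replicate k₂ 1) ++ [1]))
    (hz : [0] <+: U₂)
    (hv0 : [0] <+: v' ++ [0] ++ List.replicate k₂ 1)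
    (p₂ : v' ++ [0] ++ List.replicate k₂ 1 <+: U₂)
    (e : U₁ ++ List.replicate k₁ 1 = U₂ ++ List.replicate k₂ 1) : ¬ k₁ < k₂ := by
  intro hlt
  obtain ⟨j, rfl⟩ : ∃ j, k₂ = (j + 1) + k₁ := ⟨k₂ - k₁ - 1, by omega⟩
  rw [List.replicate_add (j+1) k₁, ← List.append_assoc] at e
  have e1 := List.append_cancel_right e
  subst e1
  have hL1 : IsLyndon (U₂ ++ [1]) := by
    apply lemP hW2
    · rintro rfl; simp at hz
    · rw [List.append_assoc, List.prefix_append_right_inj]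
      exact hv0.trans (List.prefix_append _ _)
  have hL : IsLyndon (U₂ ++ List.replicate (j+1) 1) := by
    have := lyn_app_ones hL1 (hz.trans (List.prefix_append _ _)) j
    rw [List.replicate_succ]
    simpa using this
  rw [List.append_assoc] at hw
  have hpre : v' ++ [0] ++ List.replicate k₁ 1 ++ [1] <+: U₂ := by
    refine List.IsPrefix.trans ?_ p₂
    refine ⟨List.replicate j 1, ?_⟩
    rw [show j + 1 + k₁ = k₁ + 1 + j by omega, List.replicate_add, List.replicate_succ']
    simp
  refine not_neck hL (by simp) (hpre.trans (List.prefix_append _ _)) ?_ hw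
  have := hpre.length_le
  simp at this ⊢; omega

lemma S_S {w₁ w₂ z : List ℕ} (hn₁ : IsNecklace w₁) (hn₂ : IsNecklace w₂)
    (h01 : [0] <+: w₁) (h02 : [0] <+: w₂)
    (h₁ : RS w₁ z) (h₂ : RS w₂ z) : w₁ = w₂ := by
  obtain ⟨U₁, v₁, k₁, hk₁, rfl, rfl, hL₁, p₁⟩ := h₁
  obtain ⟨U₂, v₂, k₂, hk₂, rfl, hz, hL₂, p₂⟩ := h₂
  have e := (List.append_inj' hz rfl).1
  have q₁ := (RS_pre hk₁ p₁).trans (List.prefix_append U₁ (List.replicate k₁ 1))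
  have q₂ := (RS_pre hk₂ p₂).trans (List.prefix_append U₂ (List.replicate k₂ 1))
  have l1 := S_X hL₂ q₁ e
  have l2 := S_X hL₁ q₂ e.symm
  obtain ⟨eX, rfl⟩ := List.append_inj e (by omega)
  have aux : ∀ {U V r : List ℕ}, V <+: U → V ≠ [] → [0] <+: U ++ r → [0] <+: V ∧ [0] <+: U := by
    intro U V r hVU hV h
    have hl := List.length_pos_iff.mpr hV
    have := List.prefix_of_prefix_length_le h (hVU.trans (List.prefix_append _ _)) (by simp; omega)
    exact ⟨this, this.trans hVU⟩
  have a₁ := aux p₁ (by simp) (by simpa only [List.append_assoc] using h01)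
  have a₂ := aux p₂ (by simp) (by simpa only [List.append_assoc] using h02)
  have m1 := S_k hn₁ hn₂ a₂.2 a₂.1 p₂ eX
  have m2 := S_k hn₂ hn₁ a₁.2 a₁.1 p₁ eX.symm
  obtain rfl : k₁ = k₂ := by omega
  rw [List.append_cancel_right eX]

lemma starts_zero {w : List ℕ} (hn : IsNecklace w) (h0 : 0 ∈ w) : [0] <+: w := by
  obtain ⟨a, b, rfl⟩ := List.append_of_mem h0
  have h := neck_split hn
  cases a with
  | nil => simp
  | cons c a =>
    have h' : ¬ (0 :: (b ++ (c :: a)) < c :: (a ++ 0 :: b)) := not_lt.mpr h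
    rw [List.cons_lt_cons_iff] at h'
    push Not at h'
    have ha : c = 0 := by have := h'.1; omega
    subst ha
    simp

lemma ends_one {w : List ℕ} (hb : ∀ a ∈ w, a < 2) (hn : IsNecklace w) (h1 : 1 ∈ w) :
    ∃ p, w = p ++ [1] := by
  have hw : w ≠ [] := by rintro rfl; simp at h1
  obtain ⟨p, c, rfl⟩ : ∃ b c, w = b ++ [c] :=
    ⟨w.dropLast, w.getLast hw, (List.dropLast_append_getLast hw).symm⟩
  have hc : c < 2 := hb c (by simp)
  interval_cases c
  · have := zeros_aux (neck_split hn)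
    simp at h1
    exact absurd (this 1 h1) (by simp)
  · exact ⟨p, rfl⟩

def RR (d : ℕ) (w z : List ℕ) : Prop :=
  (z.count 1 = d - 1 ∧ w = z ++ [1]) ∨
  (z.count 1 = d ∧ ((∃ x, w = x ++ [0, 1] ∧ z = x ++ [1]) ∨ RS w z))

lemma exists_RR {n d : ℕ} (hd : 0 < d) (hdn : d < n) {w : List ℕ}
    (hlen : w.length = n) (hb : ∀ a ∈ w, a < 2) (hc : w.count 1 = d) (hn : IsNecklace w)
    (h0 : [0] <+: w) :
    ∃ z, RR d w z ∧ z.length = n - 1 ∧ (∀ a ∈ z, a < 2) ∧ IsLyndon z := by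
  obtain ⟨p, rfl⟩ := ends_one hb hn (List.count_pos_iff.mp (by omega))
  have hbp : ∀ a ∈ p, a < 2 := fun a ha => hb a (by simp [ha])
  simp at hlen hc
  have hp0 : p ≠ [] := by rintro rfl; simp at hlen; omega
  by_cases hp : IsLyndon p
  · exact ⟨p, Or.inl ⟨by omega, rfl⟩, by omega, hbp, hp⟩
  have h0p : [0] <+: p :=
    List.prefix_of_prefix_length_le h0 (List.prefix_append _ _)
      (by have := List.length_pos_iff.mpr hp0; simp; omega)
  obtain ⟨U, v, hUv, hv, hvU⟩ := border hn hp0 hp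
  have h0v : [0] <+: v := by
    refine List.prefix_of_prefix_length_le h0p (hvU.trans (hUv ▸ List.prefix_append _ _)) ?_
    have := List.length_pos_iff.mpr hv; simp; omega
  have h0U := h0v.trans hvU
  obtain ⟨v', k, hk⟩ := ones_tail (v := v) (fun a ha => hbp a (by simp [hUv, ha]))
    (h0v.subset (by simp))
  subst hk hUv
  rcases Nat.eq_zero_or_pos k with rfl | hkpos
  · refine ⟨U ++ v' ++ [1], Or.inr ⟨?_, Or.inl ⟨U ++ v', by simp, rfl⟩⟩, ?_, ?_, ?_⟩
    · simp [List.count_cons] at hc ⊢; omega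
    · simp at hlen ⊢; omega
    · intro a ha; simp at ha; apply hb; simp; tauto
    · refine lemP hn ?_ ⟨[1], by simp⟩
      have : U ≠ [] := by rintro rfl; simp at h0U
      simp [this]
  · have hL : IsLyndon (U ++ List.replicate k 1) := by
      obtain ⟨j, rfl⟩ : ∃ j, k = j + 1 := ⟨k - 1, by omega⟩
      have hL1 : IsLyndon (U ++ [1]) := by
        apply lemP hn
        · rintro rfl; simp at h0U
        · rw [List.append_assoc, List.prefix_append_right_inj]
          exact h0v.trans (List.prefix_append _ _)
      have := lyn_app_ones hL1 (h0U.trans (List.prefix_append _ _)) j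
      rw [List.replicate_succ]
      simpa using this
    refine ⟨(U ++ List.replicate k 1) ++ v' ++ [1], Or.inr ⟨?_, Or.inr
      ⟨U, v', k, hkpos, rfl, rfl, hL, hvU⟩⟩, ?_, ?_, ?_⟩
    · simp [List.count_cons] at hc ⊢; omega
    · simp at hlen ⊢; omega
    · intro a ha; simp at ha; apply hb; simp; tauto
    · refine lemP (neck_double hL) ?_ ?_
      · have := hL.1
        intro h; exact this (List.append_eq_nil_iff.mp h).1
      · rw [List.append_assoc, List.prefix_append_right_inj]
        refine List.IsPrefix.trans ⟨[1], by simp⟩ ((RS_pre hkpos hvU).trans (List.prefix_append _ _))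

lemma RR_inj {d : ℕ} (hd : 0 < d) {w₁ w₂ z : List ℕ} (hn₁ : IsNecklace w₁) (hn₂ : IsNecklace w₂)
    (h01 : [0] <+: w₁) (h02 : [0] <+: w₂) (h₁ : RR d w₁ z) (h₂ : RR d w₂ z) : w₁ = w₂ := by
  rcases h₁ with ⟨c₁, rfl⟩ | ⟨c₁, h₁⟩ <;> rcases h₂ with ⟨c₂, rfl⟩ | ⟨c₂, h₂⟩
  · rfl
  · omega
  · omega
  · rcases h₁ with ⟨x₁, rfl, rfl⟩ | h₁ <;> rcases h₂ with ⟨x₂, rfl, hz⟩ | h₂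
    · rw [(List.append_inj' hz rfl).1]
    · exact (B_S hn₁ h₂).elim
    · subst hz; exact (B_S hn₂ h₁).elim
    · exact S_S hn₁ hn₂ h01 h02 h₁ h₂

lemma fin_words (n : ℕ) : {w : List ℕ | w.length = n ∧ ∀ a ∈ w, a < 2}.Finite := by
  refine ((List.finite_length_eq (Fin 2) n).image (List.map Fin.val)).subset ?_
  rintro w ⟨hl, hb⟩
  refine ⟨w.pmap (fun a h => ⟨a, h⟩) hb, by simpa using hl, ?_⟩
  simp [List.map_pmap]

/-- Pascal-like bound: `N(n,d) ≤ L(n-1,d) + L(n-1,d-1)`. -/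
theorem necklace_pascal_bound (n d : ℕ) (hd : 0 < d) (hdn : d < n) :
    N n d ≤ L (n - 1) d + L (n - 1) (d - 1) := by
  unfold N L
  refine le_trans ?_ (Set.ncard_union_le _ _)
  have hz : ∀ w ∈ {w : List ℕ | w.length = n ∧ (∀ a ∈ w, a < 2) ∧ w.count 1 = d ∧ IsNecklace w},
      [0] <+: w := by
    rintro w ⟨hl, hb, hc, hn⟩
    apply starts_zero hn
    by_contra h0
    have : ∀ a ∈ w, 1 = a := by
      intro a ha
      have h2 := hb a ha
      have : a ≠ 0 := by rintro rfl; exact h0 ha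
      omega
    have := List.count_eq_length.mpr this
    omega
  have hex := fun w (hw : w ∈ {w : List ℕ | w.length = n ∧ (∀ a ∈ w, a < 2) ∧ w.count 1 = d ∧
    IsNecklace w}) => exists_RR hd hdn hw.1 hw.2.1 hw.2.2.1 hw.2.2.2 (hz w hw)
  choose! f hf using hex
  refine Set.ncard_le_ncard_of_injOn f ?_ ?_ ?_
  · intro w hw
    obtain ⟨hR, h1, h2, h3⟩ := hf w hw
    rcases hR with ⟨hc, -⟩ | ⟨hc, -⟩
    · exact Or.inr ⟨h1, h2, hc, h3⟩
    · exact Or.inl ⟨h1, h2, hc, h3⟩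
  · intro w₁ hw₁ w₂ hw₂ he
    have a := (hf w₁ hw₁).1
    have b := (hf w₂ hw₂).1
    rw [← he] at b
    exact RR_inj hd hw₁.2.2.2 hw₂.2.2.2 (hz _ hw₁) (hz _ hw₂) a b
  · refine (fin_words (n - 1)).subset ?_
    rintro w (h | h)
    · exact ⟨h.1, h.2.1⟩
    · exact ⟨h.1, h.2.1⟩
end

section
/- Let k ≥ 2 and n_0, n_1, …, n_{k−1} ≥ 1 be positive integers. Then N_k(n_0,…,n_{k−1}) ≤ Σ_{i=0}^{k−1} L_k(n_0,…,n_{i−1}, n_i − 1, n_{i+1},…, n_{k−1}), where N_k counts necklaces and L_k counts Lyndon words over the alphabet {0,…,k−1} with the given fixed content. -/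
namespace NB

/-- words with content `c` -/
def Wset (k : ℕ) (c : Fin k → ℕ) : Set (List ℕ) :=
  {w | (∀ a ∈ w, a < k) ∧ ∀ i : Fin k, w.count i.val = c i}

lemma length_eq_sum (k : ℕ) (w : List ℕ) (h : ∀ a ∈ w, a < k) :
    w.length = ∑ i : Fin k, w.count i.val := by
  induction w with
  | nil => simp
  | cons x t ih =>
    have hx : x < k := h x (by simp)
    have ht := ih (fun a ha => h a (by simp [ha]))
    simp only [List.length_cons, List.count_cons, Finset.sum_add_distrib, ← ht]
    congr 1
    rw [Finset.sum_eq_single (⟨x, hx⟩ : Fin k)]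
    · simp
    · intro b _ hb
      have : x ≠ b.val := fun e => hb (Fin.ext e.symm)
      simp [this]
    · simp

lemma length_of_mem {k : ℕ} {c : Fin k → ℕ} {w : List ℕ} (h : w ∈ Wset k c) :
    w.length = ∑ i, c i := by
  rw [length_eq_sum k w h.1]
  exact Finset.sum_congr rfl (fun i _ => h.2 i)

lemma sum_update {k : ℕ} (c : Fin k → ℕ) (i : Fin k) (hi : 1 ≤ c i) :
    ∑ j, Function.update c i (c i - 1) j + 1 = ∑ j, c j := by
  rw [Finset.sum_update_of_mem (Finset.mem_univ i),
    ← Finset.add_sum_erase _ c (Finset.mem_univ i), Finset.sdiff_singleton_eq_erase]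
  omega

lemma cons_mem {k : ℕ} {c : Fin k → ℕ} {x : ℕ} {t : List ℕ} :
    (x :: t) ∈ Wset k c ↔ ∃ i : Fin k, i.val = x ∧ 1 ≤ c i ∧
      t ∈ Wset k (Function.update c i (c i - 1)) := by
  constructor
  · rintro ⟨h1, h2⟩
    have hx : x < k := h1 x (by simp)
    refine ⟨⟨x, hx⟩, rfl, ?_, ?_, ?_⟩
    · rw [← h2]; simp
    · intro a ha; exact h1 a (by simp [ha])
    · intro j
      have := h2 j
      by_cases hj : j = ⟨x, hx⟩
      · subst hj
        simp at this ⊢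
        omega
      · rw [Function.update_of_ne hj, ← this, List.count_cons]
        have : x ≠ j.val := fun e => hj (Fin.ext e.symm)
        simp [this]
  · rintro ⟨i, rfl, hi, h1, h2⟩
    refine ⟨?_, ?_⟩
    · intro a ha
      rcases List.mem_cons.1 ha with rfl | ha
      · exact i.2
      · exact h1 a ha
    · intro j
      have := h2 j
      by_cases hj : j = i
      · subst hj
        simp at this ⊢
        omega
      · rw [Function.update_of_ne hj] at this
        rw [List.count_cons, this]
        have : i.val ≠ j.val := fun e => hj (Fin.ext e.symm)
        simp [this]

lemma Wset_finite (k : ℕ) (n : ℕ) : ∀ c : Fin k → ℕ, ∑ i, c i = n → (Wset k c).Finite := by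
  induction n with
  | zero =>
    intro c hc
    apply (Set.finite_singleton ([] : List ℕ)).subset
    intro w hw
    have := length_of_mem hw
    rw [hc] at this
    simpa using this
  | succ n ih =>
    intro c hc
    have : Wset k c ⊆ ⋃ i : {i : Fin k // 1 ≤ c i},
        (fun t => i.1.val :: t) '' Wset k (Function.update c i.1 (c i.1 - 1)) := by
      intro w hw
      cases w with
      | nil => have := length_of_mem hw; simp [hc] at this
      | cons x t =>
        obtain ⟨i, hi, h1, h2⟩ := cons_mem.1 hw
        simp only [Set.mem_iUnion]
        exact ⟨⟨i, h1⟩, t, h2, by simp [hi]⟩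
    refine Set.Finite.subset (Set.finite_iUnion fun i => ?_) this
    apply Set.Finite.image
    apply ih
    have := sum_update c i.1 i.2
    omega

/-- words with content `c`, as a finset -/
noncomputable def W (k : ℕ) (c : Fin k → ℕ) : Finset (List ℕ) :=
  (Wset_finite k _ c rfl).toFinset

lemma mem_W {k : ℕ} {c : Fin k → ℕ} {w : List ℕ} : w ∈ W k c ↔ w ∈ Wset k c := by
  simp [W]

/-- Pascal recursion -/
lemma card_W_rec {k : ℕ} (c : Fin k → ℕ) (hc : 1 ≤ ∑ i, c i) :
    (W k c).card = ∑ i, if 1 ≤ c i then (W k (Function.update c i (c i - 1))).card else 0 := by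
  classical
  rw [← Finset.sum_filter]
  have : W k c = (Finset.univ.filter (fun i : Fin k => 1 ≤ c i)).biUnion
      (fun i => (W k (Function.update c i (c i - 1))).image (fun t => i.val :: t)) := by
    ext w
    simp only [Finset.mem_biUnion, Finset.mem_filter, Finset.mem_univ, true_and,
      Finset.mem_image, mem_W]
    cases w with
    | nil =>
      constructor
      · intro h
        have := length_of_mem h
        rw [List.length_nil] at this
        omega
      · rintro ⟨i, _, t, _, h⟩; simp at h
    | cons x t =>
      rw [cons_mem]
      constructor
      · rintro ⟨i, hi, h1, h2⟩; exact ⟨i, h1, t, h2, by simp [hi]⟩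
      · rintro ⟨i, h1, t', h2, h⟩
        simp at h
        obtain ⟨h, rfl⟩ := h
        exact ⟨i, h, h1, h2⟩
  rw [this, Finset.card_biUnion]
  · apply Finset.sum_congr rfl
    intro i _
    apply Finset.card_image_of_injective
    intro a b h
    simpa using h
  · intro i _ j _ hij
    rw [Function.onFun, Finset.disjoint_left]
    intro w h1 h2
    simp only [Finset.mem_image] at h1 h2
    obtain ⟨t, _, rfl⟩ := h1
    obtain ⟨t', _, h⟩ := h2
    simp at h
    exact hij (Fin.ext h.1.symm)

lemma card_W_spec {k : ℕ} (n : ℕ) : ∀ c : Fin k → ℕ, ∑ i, c i = n →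
    (∏ i, (c i).factorial) * (W k c).card = n.factorial := by
  induction n with
  | zero =>
    intro c hc
    have h0 : ∀ i, c i = 0 := by simpa using hc
    have : W k c = {[]} := by
      ext w
      rw [mem_W, Finset.mem_singleton]
      constructor
      · intro h; have := length_of_mem h; rw [hc] at this; simpa using this
      · rintro rfl; exact ⟨by simp, by simp [h0]⟩
    rw [this]; simp [h0]
  | succ n ih =>
    intro c hc
    rw [card_W_rec c (by omega), Finset.mul_sum, Nat.factorial_succ, ← hc, Finset.sum_mul]
    apply Finset.sum_congr rfl
    intro i _
    split_ifs with hi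
    · have h1 := ih (Function.update c i (c i - 1)) (by have := sum_update c i hi; omega)
      rw [← h1, ← mul_assoc]
      congr 1
      rw [← Finset.mul_prod_erase _ _ (Finset.mem_univ i),
        ← Finset.mul_prod_erase _ (fun j => (Function.update c i (c i - 1) j).factorial)
          (Finset.mem_univ i)]
      rw [← mul_assoc]
      congr 1
      · simp only [Function.update_self]
        exact (Nat.mul_factorial_pred (by omega)).symm
      · apply Finset.prod_congr rfl
        intro j hj
        rw [Function.update_of_ne (Finset.ne_of_mem_erase hj)]
    · have : c i = 0 := by omega
      simp [this]

lemma card_W {k : ℕ} (c : Fin k → ℕ) : (W k c).card = Nat.multinomial Finset.univ c := by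
  have h1 := card_W_spec _ c rfl
  have h2 := Nat.multinomial_spec Finset.univ c
  rw [← h2] at h1
  exact Nat.eq_of_mul_eq_mul_left (Finset.prod_pos fun i _ => Nat.factorial_pos _) h1

/-! ### periodic words -/

lemma comm_power (v : List ℕ) (e : ℕ) : ∀ u : List ℕ, u.length = e * v.length →
    u ++ v = v ++ u → u = (List.replicate e v).flatten := by
  induction e with
  | zero => intro u hu _; simpa using hu
  | succ e ih =>
    intro u hu h
    have hp : v <+: u := by
      apply List.prefix_of_prefix_length_le (l₃ := u ++ v)
      · rw [h]; exact List.prefix_append _ _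
      · exact List.prefix_append _ _
      · rw [hu]; nlinarith
    obtain ⟨t, rfl⟩ := hp
    rw [List.append_assoc] at h
    have h' := List.append_cancel_left h
    rw [List.replicate_succ, List.flatten_cons, ← ih t _ h']
    simp at hu
    nlinarith

lemma rotate_mul (w : List ℕ) (j x : ℕ) (h : w.rotate j = w) : w.rotate (j * x) = w := by
  induction x with
  | zero => simp
  | succ x ih => rw [Nat.mul_succ, ← List.rotate_rotate, ih, h]

lemma rotate_gcd (w : List ℕ) (j : ℕ) (hw : 0 < w.length) (h : w.rotate j = w) :
    w.rotate (Nat.gcd j w.length) = w := by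
  obtain ⟨x, hx⟩ : ∃ x, (j * x) % w.length = Nat.gcd j w.length % w.length := by
    have := Nat.gcd_eq_gcd_ab j w.length
    refine ⟨(Nat.gcdA j w.length % w.length).toNat, ?_⟩
    have hn : (0 : ℤ) < w.length := by exact_mod_cast hw
    zify
    rw [Int.toNat_of_nonneg (Int.emod_nonneg _ hn.ne'), this]
    rw [Int.add_mul_emod_self_left, Int.mul_emod, Int.emod_emod, ← Int.mul_emod]
  rw [← List.rotate_mod, ← hx, List.rotate_mod, rotate_mul w j x h]

lemma periodic {k : ℕ} {c : Fin k → ℕ} {w : List ℕ} (hw : w ∈ Wset k c) {j n : ℕ}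
    (hn : ∑ i, c i = n) (hj : 0 < j) (hjn : j < n) (h : w.rotate j = w) :
    (∀ i, n / Nat.gcd j n ∣ c i) ∧ ∃ v ∈ Wset k (fun i => c i / (n / Nat.gcd j n)),
      w = (List.replicate (n / Nat.gcd j n) v).flatten := by
  have hl := length_of_mem hw
  rw [hn] at hl
  have hg := rotate_gcd w j (by omega) h
  rw [hl] at hg
  set g := Nat.gcd j n with hgd
  have hgn : g ∣ n := Nat.gcd_dvd_right _ _
  have hg0 : 0 < g := Nat.gcd_pos_of_pos_left _ hj
  obtain ⟨d, hd⟩ := hgn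
  have hdd : n / g = d := by rw [hd]; exact Nat.mul_div_cancel_left _ hg0
  rw [hdd]
  have hd0 : 0 < d := by
    rcases Nat.eq_zero_or_pos d with h0 | h0
    · subst h0; omega
    · exact h0
  have hgle : g ≤ w.length := by rw [hl, hd]; nlinarith
  have hw2 : w = (List.replicate d (w.take g)).flatten := by
    rw [List.rotate_eq_drop_append_take hgle] at hg
    have key := comm_power (w.take g) (d - 1) (w.drop g) (by
      rw [List.length_drop, List.length_take, hl, min_eq_left (by omega), hd, Nat.sub_mul]
      ring_nf) (by rw [hg, List.take_append_drop])
    obtain ⟨e, rfl⟩ : ∃ e, d = e + 1 := ⟨d - 1, by omega⟩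
    rw [List.replicate_succ, List.flatten_cons]
    simp only [Nat.add_sub_cancel] at key
    rw [← key, List.take_append_drop]
  have hcount : ∀ i : Fin k, c i = d * (w.take g).count i.val := by
    intro i
    rw [← hw.2 i]
    conv_lhs => rw [hw2]
    rw [List.count_flatten]
    simp
  refine ⟨fun i => ⟨_, hcount i⟩, w.take g, ⟨?_, ?_⟩, hw2⟩
  · intro a ha; exact hw.1 a (List.mem_of_mem_take ha)
  · intro i
    change _ = c i / d
    rw [hcount i, Nat.mul_div_cancel_left _ hd0]

lemma rotate_mem {k : ℕ} {c : Fin k → ℕ} {w : List ℕ} (hw : w ∈ Wset k c) (i : ℕ) :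
    w.rotate i ∈ Wset k c := by
  refine ⟨fun a ha => hw.1 a (List.mem_rotate.1 ha), fun j => ?_⟩
  rw [(List.rotate_perm w i).count_eq]; exact hw.2 j

open Classical in
lemma fix_card {k : ℕ} (c : Fin k → ℕ) {j n : ℕ}
    (hn : ∑ i, c i = n) (hj : 0 < j) (hjn : j < n) :
    ((W k c).filter (fun w => w.rotate j = w)).card ≤
      if ∀ i, n / Nat.gcd j n ∣ c i then
        Nat.multinomial Finset.univ (fun i => c i / (n / Nat.gcd j n)) else 0 := by
  split_ifs with hd
  · rw [← card_W]
    refine le_trans (Finset.card_le_card ?_) (Finset.card_image_le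
      (f := fun v => (List.replicate (n / Nat.gcd j n) v).flatten))
    intro w hw
    rw [Finset.mem_filter, mem_W] at hw
    obtain ⟨_, v, hv, h⟩ := periodic hw.1 hn hj hjn hw.2
    exact Finset.mem_image.2 ⟨v, mem_W.2 hv, h.symm⟩
  · rw [Nat.le_zero, Finset.card_eq_zero, Finset.filter_eq_empty_iff]
    intro w hw h
    exact hd (periodic (mem_W.1 hw) hn hj hjn h).1

open Classical in
/-- nonprimitive words -/
noncomputable def NP (k : ℕ) (c : Fin k → ℕ) : Finset (List ℕ) :=
  (W k c).filter (fun w => ∃ j, 0 < j ∧ j < w.length ∧ w.rotate j = w)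

open Classical in
lemma NP_card {k : ℕ} (c : Fin k → ℕ) {n : ℕ} (hn : ∑ i, c i = n) :
    (NP k c).card ≤ ∑ d ∈ Finset.Ico 2 (n + 1), if ∀ i, d ∣ c i then
        Nat.multinomial Finset.univ (fun i => c i / d) else 0 := by
  rw [← Finset.sum_filter]
  have : NP k c ⊆ ((Finset.Ico 2 (n + 1)).filter (fun d => ∀ i, d ∣ c i)).biUnion
      (fun d => (W k (fun i => c i / d)).image (fun v => (List.replicate d v).flatten)) := by
    intro w hw
    rw [NP, Finset.mem_filter, mem_W] at hw
    obtain ⟨hw, j, hj, hjn, h⟩ := hw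
    rw [length_of_mem hw, hn] at hjn
    obtain ⟨h1, v, hv, h2⟩ := periodic hw hn hj hjn h
    rw [Finset.mem_biUnion]
    refine ⟨n / Nat.gcd j n, ?_, Finset.mem_image.2 ⟨v, mem_W.2 hv, h2.symm⟩⟩
    rw [Finset.mem_filter, Finset.mem_Ico]
    refine ⟨⟨?_, ?_⟩, h1⟩
    · have hg : Nat.gcd j n ≤ j := Nat.gcd_le_left _ hj
      obtain ⟨d, hd⟩ := Nat.gcd_dvd_right j n
      have hg0 : 0 < Nat.gcd j n := Nat.gcd_pos_of_pos_left _ hj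
      have hdd : n / Nat.gcd j n = d := by
        exact Nat.div_eq_of_eq_mul_right hg0 hd
      rw [hdd]
      by_contra hlt
      have : d = 0 ∨ d = 1 := by omega
      rcases this with rfl | rfl <;> omega
    · exact Nat.lt_succ_of_le (Nat.div_le_self _ _)
  refine (Finset.card_le_card this).trans (Finset.card_biUnion_le.trans ?_)
  apply Finset.sum_le_sum
  intro d _
  rw [← card_W]
  exact Finset.card_image_le

lemma lyndon_lower {k : ℕ} (c : Fin k → ℕ) {n : ℕ} (hn : ∑ i, c i = n) (hn0 : 0 < n) :
    (W k c).card ≤ n * Lk k c + (NP k c).card := by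
  classical
  have hL : Lk k c = ((W k c).filter IsLyndon).card := by
    rw [Lk, ← Set.ncard_coe_finset]
    congr 1
    ext w
    simp [mem_W, Wset, and_assoc]
  have hsub : W k c \ NP k c ⊆ ((Finset.range n) ×ˢ ((W k c).filter IsLyndon)).image
      (fun p => p.2.rotate p.1) := by
    intro w hw
    rw [Finset.mem_sdiff] at hw
    obtain ⟨hw, hnp⟩ := hw
    have hprim : ∀ j, 0 < j → j < n → w.rotate j ≠ w := by
      intro j h1 h2 h3
      apply hnp
      rw [NP, Finset.mem_filter]
      exact ⟨hw, j, h1, by rw [length_of_mem (mem_W.1 hw), hn]; exact h2, h3⟩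
    have hw' := mem_W.1 hw
    have hl : w.length = n := by rw [length_of_mem hw', hn]
    obtain ⟨i, hi, hmin⟩ := Finset.exists_min_image (Finset.range n) (fun i => w.rotate i)
      ⟨0, by simpa using hn0⟩
    rw [Finset.mem_range] at hi
    have hmin' : ∀ j, w.rotate i ≤ w.rotate j := by
      intro j
      rw [← List.rotate_mod w j, hl]
      exact hmin _ (Finset.mem_range.2 (Nat.mod_lt _ hn0))
    rw [Finset.mem_image]
    have hback : (w.rotate i).rotate ((n - i) % n) = w := by
      have : (w.rotate i).length = n := by rw [List.length_rotate, hl]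
      rw [← this, List.rotate_mod, this, List.rotate_rotate, Nat.add_sub_cancel' hi.le, ← hl,
        List.rotate_length]
    refine ⟨((n - i) % n, w.rotate i), ?_, hback⟩
    rw [Finset.mem_product, Finset.mem_range, Finset.mem_filter]
    refine ⟨Nat.mod_lt _ hn0, mem_W.2 (rotate_mem hw' i), ?_, ?_⟩
    · intro h
      have := congrArg List.length h
      rw [List.length_rotate, hl] at this
      simp at this; omega
    · intro j hj hjn
      rw [List.length_rotate, hl] at hjn
      apply lt_of_le_of_ne
      · rw [List.rotate_rotate]; exact hmin' _
      · intro h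
        apply hprim j hj hjn
        rw [List.rotate_rotate, add_comm, ← List.rotate_rotate] at h
        exact (List.rotate_injective i h).symm
  have h1 := Finset.card_le_card hsub
  have h2 := h1.trans Finset.card_image_le
  rw [Finset.card_product, Finset.card_range, ← hL] at h2
  have h3 := Finset.le_card_sdiff (NP k c) (W k c)
  omega

open Classical in
lemma necklace_upper {k : ℕ} (c : Fin k → ℕ) {n : ℕ} (hn : ∑ i, c i = n) (hn0 : 0 < n) :
    n * Nk k c ≤ ∑ j ∈ Finset.range n, ((W k c).filter (fun w => w.rotate j = w)).card := by
  have hN : Nk k c = ((W k c).filter IsNecklace).card := by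
    rw [Nk, ← Set.ncard_coe_finset]
    congr 1
    ext w
    simp [mem_W, Wset, and_assoc]
  have hlen : ∀ w ∈ W k c, w.length = n := fun w hw => by
    rw [length_of_mem (mem_W.1 hw), hn]
  have hswap : ∑ j ∈ Finset.range n, ((W k c).filter (fun w => w.rotate j = w)).card
      = ∑ u ∈ W k c, ((Finset.range n).filter (fun j => u.rotate j = u)).card := by
    simp only [Finset.card_filter]
    exact Finset.sum_comm
  rw [hswap, hN]
  have hcard : n * ((W k c).filter IsNecklace).card =
      ((Finset.range n) ×ˢ ((W k c).filter IsNecklace)).card := by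
    rw [Finset.card_product, Finset.card_range]
  rw [hcard, Finset.card_eq_sum_card_fiberwise (f := fun p => p.2.rotate p.1) (t := W k c)]
  · apply Finset.sum_le_sum
    intro u hu
    rcases Finset.eq_empty_or_nonempty (((Finset.range n) ×ˢ ((W k c).filter IsNecklace)).filter
      (fun p => p.2.rotate p.1 = u)) with he | ⟨⟨i0, v⟩, h0⟩
    · rw [he]; simp
    · simp only [Finset.mem_filter, Finset.mem_product, Finset.mem_range] at h0
      obtain ⟨⟨hi0, hv, hvN⟩, hvu⟩ := h0
      have hlv := hlen v hv
      have hlu := hlen u hu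
      have huniq : ∀ i v', i < n → v' ∈ W k c → IsNecklace v' → v'.rotate i = u → v' = v := by
        intro i v' hi hv' hN' h
        have e1 : v' = v.rotate (i0 + (n - i)) := by
          rw [← List.rotate_rotate, hvu, ← h, List.rotate_rotate, Nat.add_sub_cancel' hi.le,
            ← hlen v' hv', List.rotate_length]
        have e2 : v = v'.rotate (i + (n - i0)) := by
          rw [← List.rotate_rotate, h, ← hvu, List.rotate_rotate, Nat.add_sub_cancel' hi0.le,
            ← hlv, List.rotate_length]
        apply le_antisymm
        · conv_rhs => rw [e2]
          exact hN' _
        · conv_rhs => rw [e1]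
          exact hvN _
      apply Finset.card_le_card_of_injOn (fun p => (p.1 + (n - i0)) % n)
      · rintro ⟨i, v'⟩ h
        simp only [Finset.coe_filter, Finset.mem_product, Finset.mem_range, Finset.mem_filter,
          Set.mem_ofPred_eq] at h ⊢
        obtain ⟨⟨hi, hv', hN'⟩, h⟩ := h
        have := huniq i v' hi hv' hN' h
        subst this
        refine ⟨Nat.mod_lt _ hn0, ?_⟩
        conv_lhs => rw [← hlu, List.rotate_mod, hlu, ← hvu, List.rotate_rotate]
        have : i0 + (i + (n - i0)) = n + i := by omega
        rw [this, ← List.rotate_rotate]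
        conv_lhs => rw [← hlv, List.rotate_length, h]
      · rintro ⟨i, v'⟩ h ⟨i', v''⟩ h' e
        simp only [Finset.coe_filter, Finset.mem_product, Finset.mem_range, Finset.mem_filter,
          Set.mem_ofPred_eq] at h h' e
        have e1 := huniq i v' h.1.1 h.1.2.1 h.1.2.2 h.2
        have e2 := huniq i' v'' h'.1.1 h'.1.2.1 h'.1.2.2 h'.2
        have e3 : i ≡ i' [MOD n] := Nat.ModEq.add_right_cancel' _ e
        have e4 : i = i' := by
          have := e3
          rwa [Nat.ModEq, Nat.mod_eq_of_lt h.1.1, Nat.mod_eq_of_lt h'.1.1] at this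
        rw [e1, e2, e4]
  · rintro ⟨i, v⟩ h
    simp only [Finset.coe_product, Finset.coe_filter, Set.mem_prod, Set.mem_ofPred_eq] at h
    exact mem_W.2 (rotate_mem (mem_W.1 h.2.1) i)


/-! ### binomial estimates -/

/-- symmetric binomial coefficient -/
def C2 (x y : ℕ) : ℕ := (x + y).choose x

lemma C2_comm (x y : ℕ) : C2 x y = C2 y x := by
  unfold C2
  rw [add_comm y x]
  exact Nat.choose_symm_add

lemma C2_mono {x y x' y' : ℕ} (hx : x ≤ x') (hy : y ≤ y') : C2 x y ≤ C2 x' y' := by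
  have h1 : C2 x y ≤ C2 x y' := by
    unfold C2
    exact Nat.choose_le_choose _ (by omega)
  have h2 : C2 x y' ≤ C2 x' y' := by
    rw [C2_comm x, C2_comm x']
    unfold C2
    exact Nat.choose_le_choose _ (by omega)
  exact h1.trans h2

lemma C2_mul (x y x' y' : ℕ) : C2 x y * C2 x' y' ≤ C2 (x + x') (y + y') := by
  unfold C2
  have : x + x' + (y + y') = (x + y) + (x' + y') := by ring
  rw [this, Nat.add_choose_eq (x + y) (x' + y')]
  exact Finset.single_le_sum (f := fun ij : ℕ × ℕ => (x + y).choose ij.1 * (x' + y').choose ij.2)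
    (fun _ _ => Nat.zero_le _) (by simp : (x, x') ∈ Finset.HasAntidiagonal.antidiagonal (x + x'))

/-- terms from nonprimitive words of length `n - 1` -/
def S1 (a b d : ℕ) : ℕ :=
  (if d ∣ a - 1 ∧ d ∣ b then C2 ((a - 1) / d) (b / d) else 0) +
  (if d ∣ a ∧ d ∣ b - 1 then C2 (a / d) ((b - 1) / d) else 0)

/-- terms from periodic words of length `n` -/
def T1 (a b d : ℕ) : ℕ := if d ∣ a ∧ d ∣ b then C2 (a / d) (b / d) else 0

/-- left-hand side of the binary inequality -/
def LHS (a b : ℕ) : ℕ :=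
  (a + b) * (∑ d ∈ Finset.Ico 2 (a + b), S1 a b d) +
  (a + b - 1) * (∑ j ∈ Finset.Ico 1 (a + b), T1 a b ((a + b) / Nat.gcd j (a + b)))

lemma LHS_comm (a b : ℕ) : LHS a b = LHS b a := by
  unfold LHS
  rw [add_comm b a]
  congr 2
  · apply Finset.sum_congr rfl
    intro d _
    unfold S1
    rw [add_comm, C2_comm (a / d), C2_comm ((a - 1) / d)]
    simp only [and_comm]
  · apply Finset.sum_congr rfl
    intro d _
    unfold T1
    simp only [and_comm]
    rw [C2_comm]

lemma two_le_div_gcd {j n : ℕ} (hj : 0 < j) (hjn : j < n) : 2 ≤ n / Nat.gcd j n := by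
  have hg : Nat.gcd j n ≤ j := Nat.gcd_le_left _ hj
  have hg0 : 0 < Nat.gcd j n := Nat.gcd_pos_of_pos_left _ hj
  obtain ⟨d, hd⟩ := Nat.gcd_dvd_right j n
  rw [Nat.div_eq_of_eq_mul_right hg0 hd]
  by_contra hlt
  have : d = 0 ∨ d = 1 := by omega
  rcases this with rfl | rfl <;> omega

lemma div_le_half {x y d : ℕ} (hd : 2 ≤ d) (h : x ≤ y) : x / d ≤ y / 2 :=
  (Nat.div_le_div_left hd (by norm_num)).trans (Nat.div_le_div_right h)

lemma card_div (x y n : ℕ) (hx : 0 < x) :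
    ((Finset.Ico 2 n).filter (fun d => d ∣ x ∧ d ∣ y)).card ≤ Nat.gcd x y - 1 := by
  have : (Finset.Ico 2 n).filter (fun d => d ∣ x ∧ d ∣ y) ⊆ Finset.Ico 2 (Nat.gcd x y + 1) := by
    intro d
    simp only [Finset.mem_filter, Finset.mem_Ico]
    rintro ⟨⟨h1, _⟩, h2, h3⟩
    exact ⟨h1, Nat.lt_succ_of_le (Nat.le_of_dvd (Nat.gcd_pos_of_pos_left _ hx) (Nat.dvd_gcd h2 h3))⟩
  refine (Finset.card_le_card this).trans ?_
  rw [Nat.card_Ico]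
  omega

lemma card_rot (a b : ℕ) (ha : 0 < a) :
    ((Finset.Ico 1 (a + b)).filter (fun j => (a + b) / Nat.gcd j (a + b) ∣ a ∧
      (a + b) / Nat.gcd j (a + b) ∣ b)).card ≤ Nat.gcd a b - 1 := by
  have : (Finset.Ico 1 (a + b)).filter (fun j => (a + b) / Nat.gcd j (a + b) ∣ a ∧
      (a + b) / Nat.gcd j (a + b) ∣ b) ⊆
      (Finset.Ico 1 (Nat.gcd a b)).image (fun l => (a + b) / Nat.gcd a b * l) := by
    intro j
    simp only [Finset.mem_filter, Finset.mem_Ico, Finset.mem_image]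
    rintro ⟨⟨h1, h2⟩, h3, h4⟩
    have hdvd := Nat.dvd_gcd h3 h4
    have hg0 : 0 < Nat.gcd a b := Nat.gcd_pos_of_pos_left _ ha
    have hgn : Nat.gcd a b ∣ a + b := Nat.dvd_add (Nat.gcd_dvd_left _ _) (Nat.gcd_dvd_right _ _)
    set g := Nat.gcd a b
    set n := a + b
    obtain ⟨m, hm⟩ := hgn
    have hj0 : 0 < Nat.gcd j n := Nat.gcd_pos_of_pos_left _ (by omega)
    obtain ⟨d, hd⟩ := Nat.gcd_dvd_right j n
    rw [Nat.div_eq_of_eq_mul_right hj0 hd] at hdvd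
    obtain ⟨e, he⟩ := hdvd
    rw [Nat.div_eq_of_eq_mul_right hg0 hm]
    have hd0 : 0 < d := by
      rcases Nat.eq_zero_or_pos d with h | h
      · subst h; omega
      · exact h
    have : Nat.gcd j n = e * m := by
      apply Nat.eq_of_mul_eq_mul_left hd0
      rw [mul_comm d, ← hd, hm, he]; ring
    have hmj : m ∣ j := (Dvd.intro_left e this.symm).trans (Nat.gcd_dvd_left _ _)
    obtain ⟨l, hl⟩ := hmj
    refine ⟨l, ⟨?_, ?_⟩, hl.symm⟩
    · rcases Nat.eq_zero_or_pos l with h | h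
      · subst h; omega
      · exact h
    · rw [hl, hm, mul_comm g] at h2
      exact lt_of_mul_lt_mul_left h2 (Nat.zero_le _)
  refine (Finset.card_le_card this).trans (Finset.card_image_le.trans ?_)
  rw [Nat.card_Ico]

lemma LHS_le (a b : ℕ) (ha : 2 ≤ a) (hb : 2 ≤ b) :
    LHS a b ≤ ((a + b) * ((Nat.gcd (a - 1) b - 1) + (Nat.gcd a (b - 1) - 1)) +
      (a + b - 1) * (Nat.gcd a b - 1)) * C2 (a / 2) (b / 2) := by
  unfold LHS
  have h1 : ∑ d ∈ Finset.Ico 2 (a + b), S1 a b d ≤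
      ((Nat.gcd (a - 1) b - 1) + (Nat.gcd a (b - 1) - 1)) * C2 (a / 2) (b / 2) := by
    unfold S1
    rw [Finset.sum_add_distrib, add_mul, ← Finset.sum_filter, ← Finset.sum_filter]
    apply add_le_add
    · refine (Finset.sum_le_card_nsmul _ _ (C2 (a / 2) (b / 2)) ?_).trans ?_
      · intro d hd
        simp only [Finset.mem_filter, Finset.mem_Ico] at hd
        exact C2_mono (div_le_half hd.1.1 (by omega)) (div_le_half hd.1.1 le_rfl)
      · rw [smul_eq_mul]
        exact Nat.mul_le_mul_right _ (card_div _ _ _ (by omega))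
    · refine (Finset.sum_le_card_nsmul _ _ (C2 (a / 2) (b / 2)) ?_).trans ?_
      · intro d hd
        simp only [Finset.mem_filter, Finset.mem_Ico] at hd
        exact C2_mono (div_le_half hd.1.1 le_rfl) (div_le_half hd.1.1 (by omega))
      · rw [smul_eq_mul]
        exact Nat.mul_le_mul_right _ (card_div _ _ _ (by omega))
  have h2 : ∑ j ∈ Finset.Ico 1 (a + b), T1 a b ((a + b) / Nat.gcd j (a + b)) ≤
      (Nat.gcd a b - 1) * C2 (a / 2) (b / 2) := by
    unfold T1
    rw [← Finset.sum_filter]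
    refine (Finset.sum_le_card_nsmul _ _ (C2 (a / 2) (b / 2)) ?_).trans ?_
    · intro j hj
      simp only [Finset.mem_filter, Finset.mem_Ico] at hj
      have := two_le_div_gcd (j := j) (n := a + b) (by omega) hj.1.2
      exact C2_mono (div_le_half this le_rfl) (div_le_half this le_rfl)
    · rw [smul_eq_mul]
      exact Nat.mul_le_mul_right _ (card_rot _ _ (by omega))
  refine (add_le_add (Nat.mul_le_mul_left _ h1) (Nat.mul_le_mul_left _ h2)).trans (le_of_eq ?_)
  ring

lemma weight (a b : ℕ) (ha : 2 ≤ a) (hb : 2 ≤ b) :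
    (Nat.gcd (a - 1) b - 1) + (Nat.gcd a (b - 1) - 1) + (Nat.gcd a b - 1) ≤ 2 * b - 3 := by
  have h1 : Nat.gcd a (b - 1) ≤ b - 1 := Nat.gcd_le_right _ (by omega)
  have hco : Nat.Coprime (Nat.gcd (a - 1) b) (Nat.gcd a b) := by
    apply Nat.Coprime.coprime_dvd_left (Nat.gcd_dvd_left _ _)
    apply Nat.Coprime.coprime_dvd_right (Nat.gcd_dvd_left _ _)
    have : a = (a - 1) + 1 := by omega
    rw [this]
    simp
  have h2 : Nat.gcd (a - 1) b * Nat.gcd a b ≤ b :=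
    Nat.le_of_dvd (by omega) (hco.mul_dvd_of_dvd_of_dvd (Nat.gcd_dvd_right _ _)
      (Nat.gcd_dvd_right _ _))
  have h3 : 0 < Nat.gcd (a - 1) b := Nat.gcd_pos_of_pos_left _ (by omega)
  have h4 : 0 < Nat.gcd a b := Nat.gcd_pos_of_pos_left _ (by omega)
  have h5 : 0 < Nat.gcd a (b - 1) := Nat.gcd_pos_of_pos_left _ (by omega)
  obtain ⟨x, hx⟩ : ∃ x, Nat.gcd (a - 1) b = x + 1 := ⟨_, (Nat.succ_pred_eq_of_pos h3).symm⟩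
  obtain ⟨y, hy⟩ : ∃ y, Nat.gcd a b = y + 1 := ⟨_, (Nat.succ_pred_eq_of_pos h4).symm⟩
  rw [hx, hy] at h2
  have : x + y + 1 ≤ b := by nlinarith
  omega

lemma C2_succ (A B : ℕ) : C2 A (B + 1) * (B + 1) = (A + (B + 1)) * C2 A B := by
  rw [C2_comm A, C2_comm A]
  unfold C2
  have := Nat.add_one_mul_choose_eq (B + A) B
  rw [show B + 1 + A = B + A + 1 by ring, ← this]
  ring

lemma big_aux (A B : ℕ) (h : (B ≤ A ∧ 6 ≤ B) ∨ (2 ≤ B ∧ B ≤ 5 ∧ 19 ≤ A)) :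
    2 * B * (4 * B - 3) ≤ C2 A (B - 1) := by
  rcases h with ⟨h1, h2⟩ | ⟨h1, h2, h3⟩
  · refine le_trans ?_ (C2_mono h1 (show 5 ≤ B - 1 by omega))
    obtain ⟨t, rfl⟩ : ∃ t, B = t + 6 := ⟨B - 6, by omega⟩
    have h5 : C2 (t + 6) 5 * 120 = (t + 11) * (t + 10) * (t + 9) * (t + 8) * (t + 7) := by
      rw [C2_comm]
      unfold C2
      have := Nat.descFactorial_eq_factorial_mul_choose (5 + (t + 6)) 5
      rw [show (120 : ℕ) = Nat.factorial 5 by rfl, mul_comm, ← this]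
      simp only [Nat.descFactorial_succ, Nat.descFactorial_zero]
      rw [show 5 + (t + 6) - 4 = t + 7 by omega, show 5 + (t + 6) - 3 = t + 8 by omega,
        show 5 + (t + 6) - 2 = t + 9 by omega, show 5 + (t + 6) - 1 = t + 10 by omega,
        show 5 + (t + 6) - 0 = t + 11 by omega]
      ring
    rw [show 4 * (t + 6) - 3 = 4 * t + 21 by omega]
    have : 2 * (t + 6) * (4 * t + 21) * 120 ≤ C2 (t + 6) 5 * 120 := by
      rw [h5]
      ring_nf
      have h1 : 0 ≤ t ^ 5 := Nat.zero_le _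
      have h2 : 0 ≤ t ^ 4 := Nat.zero_le _
      have h3 : 0 ≤ t ^ 3 := Nat.zero_le _
      have h4 : 0 ≤ t ^ 2 := Nat.zero_le _
      linarith
    omega
  · refine le_trans ?_ (C2_mono h3 le_rfl)
    interval_cases B <;> decide

lemma big (a b : ℕ) (h : (b ≤ a ∧ 11 ≤ b) ∨ (3 ≤ b ∧ b ≤ 10 ∧ 39 ≤ a)) :
    LHS a b ≤ C2 a b := by
  have ha : 2 ≤ a := by omega
  have hb : 2 ≤ b := by omega
  refine (LHS_le a b ha hb).trans ?_
  have hw := weight a b ha hb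
  have h1 := C2_mul (a / 2) (b / 2) (a - a / 2) (b - b / 2)
  rw [show a / 2 + (a - a / 2) = a by omega, show b / 2 + (b - b / 2) = b by omega] at h1
  refine le_trans ?_ h1
  rw [mul_comm]
  apply Nat.mul_le_mul_left
  set A := a - a / 2 with hA
  set B := b - b / 2 with hB
  have h2 := big_aux A B (by omega)
  obtain ⟨B', hB'⟩ : ∃ B', B = B' + 1 := ⟨B - 1, by omega⟩
  have h3 := C2_succ A B'
  rw [← hB'] at h3
  rw [show B - 1 = B' by omega] at h2
  have h4 : 2 * (A + B) * (4 * B - 3) ≤ C2 A B := by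
    have hB0 : 0 < B := by omega
    apply Nat.le_of_mul_le_mul_right _ hB0
    rw [h3]
    calc 2 * (A + B) * (4 * B - 3) * B = (A + B) * (2 * B * (4 * B - 3)) := by ring
      _ ≤ _ := Nat.mul_le_mul_left _ h2
  refine le_trans ?_ h4
  set u := (Nat.gcd (a - 1) b - 1) + (Nat.gcd a (b - 1) - 1)
  set v := Nat.gcd a b - 1
  calc (a + b) * u + (a + b - 1) * v ≤ (a + b) * u + (a + b) * v :=
        Nat.add_le_add_left (Nat.mul_le_mul_right _ (by omega)) _
    _ = (a + b) * (u + v) := by ring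
    _ ≤ 2 * (A + B) * (4 * B - 3) := Nat.mul_le_mul (by omega) (by omega)

lemma two_case (a : ℕ) (ha : 2 ≤ a) : LHS a 2 ≤ C2 a 2 := by
  refine (LHS_le a 2 ha le_rfl).trans ?_
  have hC : ∀ x, C2 x 1 = x + 1 := by intro x; rw [C2_comm]; unfold C2; simp [add_comm]
  have h2 : C2 a 2 * 2 = (a + 2) * (a + 1) := by
    rw [C2_succ a 1, hC]
  rw [show 2 / 2 = 1 from rfl, hC, show 2 - 1 = 1 from rfl, Nat.gcd_one_right]
  rcases Nat.even_or_odd' a with ⟨t, rfl | rfl⟩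
  · have e1 : Nat.gcd (2 * t - 1) 2 = 1 := by
      apply Nat.Coprime.symm
      rw [Nat.coprime_two_left]
      exact ⟨t - 1, by omega⟩
    have e2 : Nat.gcd (2 * t) 2 = 2 := by simp
    rw [e1, e2, show 2 * t / 2 = t by omega, show 2 * t + 2 - 1 = 2 * t + 1 by omega]
    simp
    nlinarith
  · have e1 : Nat.gcd (2 * t + 1 - 1) 2 = 2 := by simp
    have e2 : Nat.gcd (2 * t + 1) 2 = 1 := by simp
    rw [e1, e2, show (2 * t + 1) / 2 = t by omega]
    simp
    nlinarith

/-- fast binomial for evaluation -/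
def C2f (x y : ℕ) : ℕ := (x + y).descFactorial x / x.factorial

lemma C2_eq (x y : ℕ) : C2 x y = C2f x y := Nat.choose_eq_descFactorial_div_factorial _ _

/-- evaluable version of the left-hand side -/
def LHSf (a b : ℕ) : ℕ :=
  (a + b) * (∑ d ∈ Finset.Ico 2 (a + b),
    ((if d ∣ a - 1 ∧ d ∣ b then C2f ((a - 1) / d) (b / d) else 0) +
    (if d ∣ a ∧ d ∣ b - 1 then C2f (a / d) ((b - 1) / d) else 0))) +
  (a + b - 1) * (∑ j ∈ Finset.Ico 1 (a + b),
    (if (a + b) / Nat.gcd j (a + b) ∣ a ∧ (a + b) / Nat.gcd j (a + b) ∣ b then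
      C2f (a / ((a + b) / Nat.gcd j (a + b))) (b / ((a + b) / Nat.gcd j (a + b))) else 0))

lemma small_check : ∀ b ∈ Finset.Ico 3 7, ∀ a ∈ Finset.Ico b 13, LHSf a b ≤ C2f a b := by
  decide +kernel

lemma mid_check : ∀ b ∈ Finset.Ico 3 11, ∀ a ∈ Finset.Ico b 39, 7 ≤ b ∨ 13 ≤ a →
    ((a + b) * ((Nat.gcd (a - 1) b - 1) + (Nat.gcd a (b - 1) - 1)) +
      (a + b - 1) * (Nat.gcd a b - 1)) * C2f (a / 2) (b / 2) ≤ C2f a b := by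
  decide +kernel

lemma binary_of_le (a b : ℕ) (hb : 2 ≤ b) (hab : b ≤ a) : LHS a b ≤ C2 a b := by
  rcases Nat.eq_or_lt_of_le hb with h | h
  · subst h; exact two_case a hab
  · by_cases hbig : (b ≤ a ∧ 11 ≤ b) ∨ (3 ≤ b ∧ b ≤ 10 ∧ 39 ≤ a)
    · exact big a b hbig
    · by_cases hmid : 7 ≤ b ∨ 13 ≤ a
      · have := mid_check b (Finset.mem_Ico.2 (by omega)) a (Finset.mem_Ico.2 (by omega)) hmid
        rw [← C2_eq, ← C2_eq] at this
        exact (LHS_le a b (by omega) hb).trans this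
      · have := small_check b (Finset.mem_Ico.2 (by omega)) a (Finset.mem_Ico.2 (by omega))
        rw [C2_eq]
        unfold LHS S1 T1
        simp only [C2_eq]
        exact this

lemma binary (a b : ℕ) (ha : 2 ≤ a) (hb : 2 ≤ b) : LHS a b ≤ C2 a b := by
  rcases le_total b a with h | h
  · exact binary_of_le a b hb h
  · rw [LHS_comm, C2_comm]; exact binary_of_le b a ha h


/-! ### reduction to the binary case -/

lemma mult_split {k : ℕ} (f : Fin k → ℕ) (i0 : Fin k) :
    Nat.multinomial Finset.univ f =
      C2 (f i0) (∑ i ∈ Finset.univ.erase i0, f i) *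
        Nat.multinomial (Finset.univ.erase i0) f := by
  conv_lhs => rw [← Finset.insert_erase (Finset.mem_univ i0)]
  rw [Nat.multinomial_insert (Finset.notMem_erase i0 _)]
  rfl

lemma mult_mono {k : ℕ} (s : Finset (Fin k)) (f g : Fin k → ℕ) (h : ∀ i, f i ≤ g i) :
    Nat.multinomial s f ≤ Nat.multinomial s g := by
  induction s using Finset.induction_on with
  | empty => simp
  | insert i s hi ih =>
    rw [Nat.multinomial_insert hi, Nat.multinomial_insert hi]
    exact Nat.mul_le_mul (C2_mono (h i) (Finset.sum_le_sum fun j _ => h j)) ih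

open Classical in
/-- number of `d`-th powers with given content -/
noncomputable def F {k : ℕ} (d : ℕ) (c : Fin k → ℕ) : ℕ :=
  if ∀ i, d ∣ c i then Nat.multinomial Finset.univ (fun i => c i / d) else 0

lemma F_le {k : ℕ} (d : ℕ) (c' c : Fin k → ℕ) (h : ∀ i, c' i ≤ c i) (i0 : Fin k) :
    F d c' ≤ T1 (c' i0) (∑ i ∈ Finset.univ.erase i0, c' i) d *
      Nat.multinomial (Finset.univ.erase i0) c := by
  unfold F
  split_ifs with hd
  · have h2 : d ∣ ∑ i ∈ Finset.univ.erase i0, c' i := Finset.dvd_sum fun i _ => hd i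
    unfold T1
    rw [if_pos ⟨hd i0, h2⟩, mult_split _ i0]
    apply Nat.mul_le_mul
    · apply C2_mono le_rfl
      rw [Nat.sum_div (fun i _ => hd i)]
    · exact mult_mono _ _ _ fun i => (Nat.div_le_self _ _).trans (h i)
  · exact Nat.zero_le _

lemma F_zero {k : ℕ} (d : ℕ) (hd : 2 ≤ d) (c : Fin k → ℕ) (i : Fin k) (hi : c i = 1) :
    F d c = 0 := by
  unfold F
  rw [if_neg]
  intro h
  have := h i
  rw [hi] at this
  have := Nat.le_of_dvd one_pos this
  omega

lemma upd_le {k : ℕ} (c : Fin k → ℕ) (i j : Fin k) :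
    Function.update c i (c i - 1) j ≤ c j := by
  by_cases h : j = i
  · subst h; simp
  · simp [h]

lemma sum_F_le {k : ℕ} (c : Fin k → ℕ) (hc : ∀ i, 1 ≤ c i) (d : ℕ) (hd : 2 ≤ d) (i0 : Fin k) :
    ∑ i, F d (Function.update c i (c i - 1)) ≤
      S1 (c i0) (∑ i ∈ Finset.univ.erase i0, c i) d *
        Nat.multinomial (Finset.univ.erase i0) c := by
  rw [← Finset.add_sum_erase _ _ (Finset.mem_univ i0)]
  unfold S1
  rw [add_mul]
  apply add_le_add
  · have := F_le d (Function.update c i0 (c i0 - 1)) c (upd_le c i0) i0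
    rw [Function.update_self, Finset.sum_update_of_notMem (Finset.notMem_erase _ _)] at this
    exact this
  · by_cases hex : ∃ i1, i1 ≠ i0 ∧ ∀ j, d ∣ Function.update c i1 (c i1 - 1) j
    · obtain ⟨i1, h1, h2⟩ := hex
      rw [Finset.sum_eq_single_of_mem i1 (Finset.mem_erase.2 ⟨h1, Finset.mem_univ _⟩)]
      · have := F_le d (Function.update c i1 (c i1 - 1)) c (upd_le c i1) i0
        have hm : i1 ∈ Finset.univ.erase i0 := Finset.mem_erase.2 ⟨h1, Finset.mem_univ _⟩
        rw [Function.update_of_ne h1.symm, Finset.sum_update_of_mem hm,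
          Finset.sdiff_singleton_eq_erase] at this
        have e : c i1 - 1 + ∑ i ∈ (Finset.univ.erase i0).erase i1, c i =
            (∑ i ∈ Finset.univ.erase i0, c i) - 1 := by
          rw [← Finset.add_sum_erase _ c hm]
          have := hc i1
          omega
        rw [e] at this
        exact this
      · intro i _ hi
        unfold F
        rw [if_neg]
        intro h
        have ha := h i1
        have hb := h2 i1
        rw [Function.update_of_ne hi.symm] at ha
        rw [Function.update_self] at hb
        have h3 := (Nat.dvd_sub_iff_right (Nat.sub_le (c i1) 1) ha).2 hb
        have h4 := hc i1
        rw [show c i1 - (c i1 - 1) = 1 by omega] at h3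
        have := Nat.le_of_dvd one_pos h3
        omega
    · rw [Finset.sum_eq_zero]
      · exact Nat.zero_le _
      · intro i hi
        unfold F
        rw [if_neg]
        intro h
        exact hex ⟨i, (Finset.mem_erase.1 hi).1, h⟩

open Classical in
lemma star {k : ℕ} (hk : 2 ≤ k) (c : Fin k → ℕ) (hc : ∀ i, 1 ≤ c i) {n : ℕ}
    (hn : ∑ i, c i = n) :
    n * ∑ i, (NP k (Function.update c i (c i - 1))).card +
      (n - 1) * ∑ j ∈ Finset.Ico 1 n, ((W k c).filter (fun w => w.rotate j = w)).card ≤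
      Nat.multinomial Finset.univ c := by
  have hNP : ∀ i, (NP k (Function.update c i (c i - 1))).card ≤
      ∑ d ∈ Finset.Ico 2 n, F d (Function.update c i (c i - 1)) := by
    intro i
    have h := NP_card (Function.update c i (c i - 1)) rfl
    rw [sum_update c i (hc i), hn] at h
    exact h
  have hFix : ∀ j ∈ Finset.Ico 1 n, ((W k c).filter (fun w => w.rotate j = w)).card ≤
      F (n / Nat.gcd j n) c := by
    intro j hj
    rw [Finset.mem_Ico] at hj
    exact fix_card c hn (by omega) hj.2
  by_cases hA : ∃ i0, 2 ≤ c i0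
  · obtain ⟨i0, h0⟩ := hA
    have hab : c i0 + ∑ i ∈ Finset.univ.erase i0, c i = n := by
      rw [Finset.add_sum_erase _ c (Finset.mem_univ i0), hn]
    by_cases hB : 2 ≤ ∑ i ∈ Finset.univ.erase i0, c i
    · have hbin := binary _ _ h0 hB
      rw [mult_split c i0]
      refine le_trans ?_ (Nat.mul_le_mul_right _ hbin)
      unfold LHS
      rw [hab]
      set M := Nat.multinomial (Finset.univ.erase i0) c
      have h1 : ∑ i, (NP k (Function.update c i (c i - 1))).card ≤
          (∑ d ∈ Finset.Ico 2 n, S1 (c i0) (∑ i ∈ Finset.univ.erase i0, c i) d) * M := by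
        refine (Finset.sum_le_sum fun i _ => hNP i).trans ?_
        rw [Finset.sum_comm, Finset.sum_mul]
        apply Finset.sum_le_sum
        intro d hd
        exact sum_F_le c hc d (Finset.mem_Ico.1 hd).1 i0
      have h2 : ∑ j ∈ Finset.Ico 1 n, ((W k c).filter (fun w => w.rotate j = w)).card ≤
          (∑ j ∈ Finset.Ico 1 n,
            T1 (c i0) (∑ i ∈ Finset.univ.erase i0, c i) (n / Nat.gcd j n)) * M := by
        rw [Finset.sum_mul]
        apply Finset.sum_le_sum
        intro j hj
        exact (hFix j hj).trans (F_le _ c c (fun _ => le_rfl) i0)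
      refine (add_le_add (Nat.mul_le_mul_left _ h1) (Nat.mul_le_mul_left _ h2)).trans
        (le_of_eq ?_)
      ring
    · -- exactly one other letter, occurring once
      have hne : ∃ i1, i1 ≠ i0 := by
        have : Nontrivial (Fin k) := Fin.nontrivial_iff_two_le.2 hk
        exact exists_ne i0
      obtain ⟨i1, h1⟩ := hne
      have hm : i1 ∈ Finset.univ.erase i0 := Finset.mem_erase.2 ⟨h1, Finset.mem_univ _⟩
      have hs := Finset.add_sum_erase _ c hm
      have hc1 := hc i1
      have hc1' : c i1 = 1 := by omega
      have huniq : ∀ i, i ≠ i0 → i = i1 := by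
        intro i hi
        by_contra hi1
        have h3 : i ∈ (Finset.univ.erase i0).erase i1 :=
          Finset.mem_erase.2 ⟨hi1, Finset.mem_erase.2 ⟨hi, Finset.mem_univ _⟩⟩
        have h4 := Finset.single_le_sum (f := c) (fun _ _ => Nat.zero_le _) h3
        have := hc i
        omega
      have hb1 : ∑ i ∈ Finset.univ.erase i0, c i = 1 := by omega
      have her : Finset.univ.erase i0 = {i1} := by
        ext i
        simp only [Finset.mem_erase, Finset.mem_univ, and_true, Finset.mem_singleton]
        exact ⟨huniq i, fun h => h ▸ h1⟩
      have hfix0 : ∑ j ∈ Finset.Ico 1 n, ((W k c).filter (fun w => w.rotate j = w)).card = 0 := by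
        apply Finset.sum_eq_zero
        intro j hj
        have h5 := hFix j hj
        rw [Finset.mem_Ico] at hj
        rw [F_zero _ (two_le_div_gcd (by omega) hj.2) c i1 hc1'] at h5
        omega
      have hNP0 : (NP k (Function.update c i0 (c i0 - 1))).card = 0 := by
        have h5 := hNP i0
        rw [Finset.sum_eq_zero] at h5
        · omega
        · intro d hd
          exact F_zero d (Finset.mem_Ico.1 hd).1 _ i1 (by rw [Function.update_of_ne h1, hc1'])
      have hNP1 : (NP k (Function.update c i1 (c i1 - 1))).card ≤ 1 := by
        have h5 : (NP k (Function.update c i1 (c i1 - 1))).card ≤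
            (W k (Function.update c i1 (c i1 - 1))).card :=
          Finset.card_le_card (Finset.filter_subset _ _)
        rw [card_W, mult_split _ i0, her] at h5
        simpa [hc1', C2] using h5
      rw [hfix0, ← Finset.add_sum_erase _ _ (Finset.mem_univ i0), her, Finset.sum_singleton, hNP0,
        mult_split c i0, her, Finset.sum_singleton, hc1', Nat.multinomial_singleton, C2_comm]
      rw [hc1'] at hNP1
      have e : C2 1 (c i0) = n := by
        unfold C2
        rw [Nat.choose_one_right]
        omega
      rw [e]
      nlinarith
  · have h1 : ∀ i, c i = 1 := by
      intro i
      have h3 := hc i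
      by_contra h4
      exact hA ⟨i, by omega⟩
    have hfix0 : ∑ j ∈ Finset.Ico 1 n, ((W k c).filter (fun w => w.rotate j = w)).card = 0 := by
      apply Finset.sum_eq_zero
      intro j hj
      have h5 := hFix j hj
      rw [Finset.mem_Ico] at hj
      rw [F_zero _ (two_le_div_gcd (by omega) hj.2) c ⟨0, by omega⟩ (h1 _)] at h5
      omega
    have hNP0 : ∑ i, (NP k (Function.update c i (c i - 1))).card = 0 := by
      apply Finset.sum_eq_zero
      intro i _
      have : Nontrivial (Fin k) := Fin.nontrivial_iff_two_le.2 hk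
      obtain ⟨i1, hi1⟩ := exists_ne i
      have h5 := hNP i
      rw [Finset.sum_eq_zero] at h5
      · omega
      · intro d hd
        exact F_zero d (Finset.mem_Ico.1 hd).1 _ i1 (by rw [Function.update_of_ne hi1, h1])
    rw [hfix0, hNP0]
    simp

lemma final {k : ℕ} (hk : 2 ≤ k) (c : Fin k → ℕ) (hc : ∀ i, 1 ≤ c i) :
    Nk k c ≤ ∑ i : Fin k, Lk k (Function.update c i (c i - 1)) := by
  classical
  obtain ⟨n, hn⟩ : ∃ n, ∑ i, c i = n := ⟨_, rfl⟩
  have hn2 : 2 ≤ n := by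
    have h : ∑ i : Fin k, 1 ≤ ∑ i, c i := Finset.sum_le_sum fun i _ => hc i
    simp at h
    omega
  have hst := star hk c hc hn
  have hup := necklace_upper c hn (by omega)
  rw [Finset.range_eq_Ico, Finset.sum_eq_sum_Ico_succ_bot (by omega)] at hup
  have h0 : ((W k c).filter (fun w => w.rotate 0 = w)).card = (W k c).card := by simp
  rw [h0] at hup
  have hrec := card_W_rec c (by omega)
  simp only [hc, if_true] at hrec
  have hlow : ∑ i, (W k (Function.update c i (c i - 1))).card ≤
      (n - 1) * ∑ i, Lk k (Function.update c i (c i - 1)) +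
        ∑ i, (NP k (Function.update c i (c i - 1))).card := by
    rw [Finset.mul_sum, ← Finset.sum_add_distrib]
    apply Finset.sum_le_sum
    intro i _
    have h := sum_update c i (hc i)
    exact lyndon_lower _ (by omega) (by omega)
  rw [← hrec] at hlow
  rw [← card_W] at hst
  simp only [zero_add] at hup
  set m := (W k c).card
  set X := ∑ i, (NP k (Function.update c i (c i - 1))).card
  set Y := ∑ j ∈ Finset.Ico 1 n, ((W k c).filter (fun w => w.rotate j = w)).card
  set P := ∑ i, Lk k (Function.update c i (c i - 1))
  obtain ⟨t, rfl⟩ : ∃ t, n = t + 2 := ⟨n - 2, by omega⟩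
  rw [show t + 2 - 1 = t + 1 by omega] at hst hlow
  have hpos : 0 < (t + 2) * (t + 1) := by positivity
  apply Nat.le_of_mul_le_mul_left _ hpos
  have e1 := Nat.mul_le_mul_left (t + 1) hup
  have e2 := Nat.mul_le_mul_left (t + 2) hlow
  nlinarith

end NB

/-- Pascal-like bound for necklaces with fixed content. -/
theorem necklace_content_bound (k : ℕ) (hk : 2 ≤ k) (c : Fin k → ℕ) (hc : ∀ i, 1 ≤ c i) :
    Nk k c ≤ ∑ i : Fin k, Lk k (Function.update c i (c i - 1)) := by
  exact NB.final hk c hc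
end

section
/- Let k > 2 and n_0, n_1, …, n_{k−1} ≥ 1 be positive integers. Then the inequality is strict: N_k(n_0,…,n_{k−1}) < Σ_{i=0}^{k−1} L_k(n_0,…,n_{i−1}, n_i − 1, n_{i+1},…, n_{k−1}). -/
/-- A fixed word with content `c`. -/
def baseWord (k : ℕ) (c : Fin k → ℕ) : List ℕ :=
  (List.finRange k).flatMap fun i => List.replicate (c i) i.val

/-- All words with content `c`. -/
def Wd (k : ℕ) (c : Fin k → ℕ) : Finset (List ℕ) := (baseWord k c).permutations.toFinset

lemma count_baseWord (k : ℕ) (c : Fin k → ℕ) (i : Fin k) : (baseWord k c).count i.val = c i := by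
  unfold baseWord
  rw [List.count_flatMap]
  have : (List.map (List.count i.val ∘ fun i => List.replicate (c i) i.val) (List.finRange k))
      = List.map (fun j => if j = i then c i else 0) (List.finRange k) := by
    apply List.map_congr_left
    intro j _
    simp only [Function.comp, List.count_replicate, beq_iff_eq]
    by_cases h : j = i
    · simp [h]
    · have : (j : ℕ) ≠ i := fun h' => h (Fin.ext h')
      simp [h, this]
  rw [this, ← Fin.sum_univ_def]
  simp

lemma lt_baseWord (k : ℕ) (c : Fin k → ℕ) : ∀ a ∈ baseWord k c, a < k := by
  intro a ha
  unfold baseWord at ha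
  simp only [List.mem_flatMap, List.mem_replicate] at ha
  obtain ⟨i, _, _, rfl⟩ := ha
  exact i.isLt

lemma mem_Wd {k : ℕ} {c : Fin k → ℕ} {w : List ℕ} :
    w ∈ Wd k c ↔ (∀ a ∈ w, a < k) ∧ (∀ i : Fin k, w.count i.val = c i) := by
  unfold Wd
  rw [List.mem_toFinset, List.mem_permutations]
  constructor
  · intro h
    exact ⟨fun a ha => lt_baseWord k c a (h.mem_iff.1 ha),
      fun i => by rw [h.count_eq, count_baseWord]⟩
  · rintro ⟨h1, h2⟩
    rw [List.perm_iff_count]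
    intro a
    by_cases ha : a < k
    · have := h2 ⟨a, ha⟩
      have h3 := count_baseWord k c ⟨a, ha⟩
      simp only at this h3
      rw [this, h3]
    · rw [List.count_eq_zero_of_not_mem (fun h => ha (h1 a h)),
        List.count_eq_zero_of_not_mem (fun h => ha (lt_baseWord k c a h))]

lemma baseWord_mem (k : ℕ) (c : Fin k → ℕ) : baseWord k c ∈ Wd k c :=
  mem_Wd.2 ⟨lt_baseWord k c, count_baseWord k c⟩

lemma Wd_pos (k : ℕ) (c : Fin k → ℕ) : 0 < (Wd k c).card :=
  Finset.card_pos.2 ⟨_, baseWord_mem k c⟩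

lemma Wd_length {k : ℕ} {c : Fin k → ℕ} {w : List ℕ} (h : w ∈ Wd k c) :
    w.length = ∑ i, c i := by
  unfold Wd at h
  rw [List.mem_toFinset, List.mem_permutations] at h
  rw [h.length_eq]
  simp [baseWord, List.length_flatMap, Fin.sum_univ_def]

lemma Wd_rotate {k : ℕ} {c : Fin k → ℕ} {w : List ℕ} (h : w ∈ Wd k c) (i : ℕ) :
    w.rotate i ∈ Wd k c := by
  unfold Wd at h ⊢
  rw [List.mem_toFinset, List.mem_permutations] at h ⊢
  exact (w.rotate_perm i).trans h

lemma Wd_append {k : ℕ} {c d : Fin k → ℕ} {w v : List ℕ} (h : w ∈ Wd k c) (h' : v ∈ Wd k d) :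
    w ++ v ∈ Wd k (fun i => c i + d i) := by
  rw [mem_Wd] at *
  refine ⟨fun a ha => ?_, fun i => ?_⟩
  · rcases List.mem_append.1 ha with h1 | h1
    · exact h.1 a h1
    · exact h'.1 a h1
  · rw [List.count_append, h.2, h'.2]

lemma Wd_mul_le {k : ℕ} (x y : Fin k → ℕ) :
    (Wd k x).card * (Wd k y).card ≤ (Wd k (fun i => x i + y i)).card := by
  rw [← Finset.card_product]
  apply Finset.card_le_card_of_injOn (fun p => p.1 ++ p.2)
  · rintro ⟨u, v⟩ h
    simp only [Finset.coe_product, Set.mem_prod, Finset.mem_coe] at h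
    exact Wd_append h.1 h.2
  · rintro ⟨u, v⟩ h ⟨u', v'⟩ h' he
    simp only [Finset.coe_product, Set.mem_prod, Finset.mem_coe] at h h' he
    have := List.append_inj he (by rw [Wd_length h.1, Wd_length h'.1])
    simp [this]

/-- deleting the last letter -/
lemma Wd_le_sum {k : ℕ} (c : Fin k → ℕ) (hc : ∀ i, 1 ≤ c i) (hk : 0 < k) :
    (Wd k c).card ≤ ∑ i : Fin k, (Wd k (Function.update c i (c i - 1))).card := by
  have : Wd k c ⊆ Finset.univ.biUnion (fun i : Fin k =>
      (Wd k (Function.update c i (c i - 1))).image (fun w => i.val :: w)) := by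
    intro w hw
    simp only [Finset.mem_biUnion, Finset.mem_univ, true_and, Finset.mem_image]
    rw [mem_Wd] at hw
    match w, hw with
    | [], hw =>
      have h1 := hw.2 ⟨0, hk⟩
      have h2 := hc ⟨0, hk⟩
      simp at h1
      omega
    | a :: w, hw =>
      refine ⟨⟨a, hw.1 a (by simp)⟩, w, ?_, rfl⟩
      rw [mem_Wd]
      refine ⟨fun b hb => hw.1 b (by simp [hb]), fun i => ?_⟩
      have h1 := hw.2 i
      rw [List.count_cons] at h1
      by_cases h : i = ⟨a, hw.1 a (by simp)⟩
      · subst h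
        simp at h1 ⊢
        omega
      · have h' : a ≠ i.val := fun h' => h (Fin.ext h'.symm)
        rw [Function.update_of_ne h]
        simpa [h'] using h1
  refine (Finset.card_le_card this).trans (Finset.card_biUnion_le.trans ?_)
  exact Finset.sum_le_sum fun i _ => Finset.card_image_le

lemma Wd_sum_le {k : ℕ} (c : Fin k → ℕ) :
    ∑ i ∈ Finset.univ.filter (fun i => 0 < c i), (Wd k (Function.update c i (c i - 1))).card
      ≤ (Wd k c).card := by
  have hE : ∀ i : Fin k, (Wd k (Function.update c i (c i - 1))).card =
      ((Wd k (Function.update c i (c i - 1))).image (fun w => i.val :: w)).card := by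
    intro i
    rw [Finset.card_image_of_injective]
    intro a b h
    simpa using h
  rw [Finset.sum_congr rfl (fun i _ => hE i), ← Finset.card_biUnion]
  · apply Finset.card_le_card
    intro w hw
    simp only [Finset.mem_biUnion, Finset.mem_filter, Finset.mem_univ, true_and,
      Finset.mem_image] at hw
    obtain ⟨i, hi, v, hv, rfl⟩ := hw
    rw [mem_Wd] at hv ⊢
    refine ⟨?_, fun j => ?_⟩
    · intro a ha
      rcases List.mem_cons.1 ha with rfl | h
      · exact i.isLt
      · exact hv.1 a h
    · rw [List.count_cons, hv.2]
      by_cases h : j = i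
      · subst h
        simp
        omega
      · have h' : (i : ℕ) ≠ j := fun h' => h (Fin.ext h'.symm)
        simp [h, h']
  · intro i _ j _ hij
    rw [Function.onFun, Finset.disjoint_left]
    intro w h1 h2
    simp only [Finset.mem_image] at h1 h2
    obtain ⟨a, _, rfl⟩ := h1
    obtain ⟨b, _, hb⟩ := h2
    apply hij
    simp only [List.cons.injEq] at hb
    exact Fin.ext hb.1.symm

lemma Wd_factorial (k : ℕ) : ∀ (n : ℕ) (c : Fin k → ℕ), ∑ i, c i = n →
    n.factorial ≤ (Wd k c).card * ∏ i, (c i).factorial := by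
  intro n
  induction n with
  | zero =>
    intro c _
    exact Nat.mul_pos (Wd_pos k c) (Finset.prod_pos fun i _ => Nat.factorial_pos _)
  | succ n ih =>
    intro c hc
    refine le_trans ?_ (Nat.mul_le_mul_right _ (Wd_sum_le c))
    rw [Finset.sum_mul]
    have key : ∀ i ∈ Finset.univ.filter (fun i => 0 < c i), c i * n.factorial ≤
        (Wd k (Function.update c i (c i - 1))).card * ∏ i, (c i).factorial := by
      intro i hi
      simp only [Finset.mem_filter, Finset.mem_univ, true_and] at hi
      have hs : ∑ j, Function.update c i (c i - 1) j = n := by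
        rw [Finset.sum_update_of_mem (Finset.mem_univ i)]
        rw [← Finset.add_sum_erase _ _ (Finset.mem_univ i), Finset.erase_eq] at hc
        omega
      have h1 := ih _ hs
      have h2 : ∏ j, (c j).factorial =
          c i * ∏ j, (Function.update c i (c i - 1) j).factorial := by
        rw [← Finset.mul_prod_erase _ _ (Finset.mem_univ i),
          ← Finset.mul_prod_erase (a := i) (f := fun j => (Function.update c i (c i - 1) j).factorial)
            _ (Finset.mem_univ i)]
        rw [← mul_assoc]
        congr 1
        · simp [Nat.mul_factorial_pred hi.ne']
        · apply Finset.prod_congr rfl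
          intro j hj
          rw [Function.update_of_ne (Finset.ne_of_mem_erase hj)]
      rw [h2]
      calc c i * n.factorial ≤ c i * _ := Nat.mul_le_mul_left _ h1
        _ = _ := by ring
    refine le_trans ?_ (Finset.sum_le_sum key)
    rw [← Finset.sum_mul, Nat.factorial_succ]
    apply Nat.mul_le_mul_right
    rw [← hc, Finset.sum_filter]
    apply Finset.sum_le_sum
    intro i _
    split_ifs <;> omega

/-- Words of content `c` fixed by rotation by `l`. -/
def Fx (k : ℕ) (c : Fin k → ℕ) (l : ℕ) : Finset (List ℕ) :=
  (Wd k c).filter (fun w => w.rotate l = w)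

lemma comm_flatten (u : List ℕ) : ∀ (e : ℕ) (z : List ℕ), z.length = e * u.length →
    u ++ z = z ++ u → z = (List.replicate e u).flatten := by
  intro e
  induction e with
  | zero =>
    intro z hz _
    have : z = [] := List.length_eq_zero_iff.1 (by simpa using hz)
    simp [this]
  | succ e ih =>
    intro z hz h
    have hp : u <+: z := by
      have h1 : u <+: z ++ u := ⟨z, h⟩
      have h2 : z <+: z ++ u := List.prefix_append _ _
      apply List.prefix_of_prefix_length_le h1 h2
      rw [hz]
      nlinarith
    obtain ⟨z', rfl⟩ := hp
    rw [List.replicate_succ, List.flatten_cons]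
    congr 1
    apply ih
    · rw [List.length_append] at hz
      linarith
    · rw [List.append_assoc] at h
      exact List.append_cancel_left h

lemma fixed_eq {w : List ℕ} {l d : ℕ} (hl : w.length = d * l) (hd : 0 < d)
    (h : w.rotate l = w) : w = (List.replicate d (w.take l)).flatten := by
  have hle : l ≤ w.length := by rw [hl]; nlinarith
  rw [List.rotate_eq_drop_append_take hle] at h
  obtain ⟨e, rfl⟩ : ∃ e, d = e + 1 := ⟨d - 1, by omega⟩
  have ht : (w.take l).length = l := by simp [hle]
  have := comm_flatten (w.take l) e (w.drop l)
    (by rw [ht, List.length_drop, hl]; rw [add_mul]; omega)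
    (by rw [h, List.take_append_drop])
  rw [List.replicate_succ, List.flatten_cons, ← this, List.take_append_drop]

lemma fixed_count {w : List ℕ} {l d : ℕ} (hl : w.length = d * l) (hd : 0 < d)
    (h : w.rotate l = w) (a : ℕ) : w.count a = d * (w.take l).count a := by
  conv_lhs => rw [fixed_eq hl hd h]
  rw [List.count_flatten]
  simp

lemma Fx_dvd {k : ℕ} {c : Fin k → ℕ} {l d : ℕ} (hl : ∑ i, c i = d * l) (hd : 0 < d)
    {w : List ℕ} (hw : w ∈ Fx k c l) (i : Fin k) : d ∣ c i := by
  unfold Fx at hw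
  rw [Finset.mem_filter] at hw
  rw [← (mem_Wd.1 hw.1).2 i, fixed_count ((Wd_length hw.1).trans hl) hd hw.2]
  exact dvd_mul_right _ _

lemma Fx_card {k : ℕ} {c x : Fin k → ℕ} {l d : ℕ} (hl : ∑ i, c i = d * l) (hd : 2 ≤ d)
    (hx : ∀ i, c i / 2 ≤ x i) : (Fx k c l).card ≤ (Wd k x).card := by
  apply Finset.card_le_card_of_injOn
    (fun w => w.take l ++ baseWord k (fun i => x i - c i / d))
  · intro w hw
    have hw' : w ∈ Fx k c l := hw
    have hw2 := hw'
    unfold Fx at hw2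
    rw [Finset.mem_filter] at hw2
    have hlen := (Wd_length hw2.1).trans hl
    have h1 : w.take l ∈ Wd k (fun i => c i / d) := by
      rw [mem_Wd]
      refine ⟨fun a ha => (mem_Wd.1 hw2.1).1 a (List.mem_of_mem_take ha), fun i => ?_⟩
      rw [← (mem_Wd.1 hw2.1).2 i, fixed_count hlen (by omega) hw2.2,
        Nat.mul_div_cancel_left _ (by omega)]
    have h2 := Wd_append h1 (baseWord_mem k (fun i => x i - c i / d))
    have h3 : (fun i => c i / d + (x i - c i / d)) = x := by
      funext i
      have : c i / d ≤ c i / 2 := Nat.div_le_div_left hd (by norm_num)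
      have := hx i
      omega
    rw [h3] at h2
    exact h2
  · intro w hw w' hw' he
    have hw2 : w ∈ Fx k c l := hw
    have hw2' : w' ∈ Fx k c l := hw'
    unfold Fx at hw2 hw2'
    rw [Finset.mem_filter] at hw2 hw2'
    have h := List.append_cancel_right he
    rw [fixed_eq ((Wd_length hw2.1).trans hl) (by omega) hw2.2,
      fixed_eq ((Wd_length hw2'.1).trans hl) (by omega) hw2'.2, h]

lemma rotate_iter (w : List ℕ) (i : ℕ) : (fun l : List ℕ => l.rotate 1)^[i] w = w.rotate i := by
  induction i with
  | zero => simp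
  | succ i ih => rw [Function.iterate_succ_apply', ih, List.rotate_rotate]

lemma rotate_gcd {w : List ℕ} {i : ℕ} (h : w.rotate i = w) :
    w.rotate (Nat.gcd i w.length) = w := by
  have h1 : Function.IsPeriodicPt (fun l : List ℕ => l.rotate 1) i w := by
    rw [Function.IsPeriodicPt, Function.IsFixedPt, rotate_iter, h]
  have h2 : Function.IsPeriodicPt (fun l : List ℕ => l.rotate 1) w.length w := by
    rw [Function.IsPeriodicPt, Function.IsFixedPt, rotate_iter, List.rotate_length]
  have := h1.gcd h2
  rwa [Function.IsPeriodicPt, Function.IsFixedPt, rotate_iter] at this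

/-- non-primitive words -/
def NP (k : ℕ) (c : Fin k → ℕ) : Finset (List ℕ) :=
  (Wd k c).filter (fun w => ∃ i ∈ Finset.range w.length, 0 < i ∧ w.rotate i = w)

/-- nontrivial common divisors -/
def Dv (k : ℕ) (c : Fin k → ℕ) : Finset ℕ :=
  (∑ i, c i).divisors.filter (fun d => 2 ≤ d ∧ ∀ i, d ∣ c i)

lemma gcd_facts {i n : ℕ} (h0 : 0 < i) (h1 : i < n) :
    n = (n / Nat.gcd i n) * Nat.gcd i n ∧ 2 ≤ n / Nat.gcd i n := by
  have hg : Nat.gcd i n ∣ n := Nat.gcd_dvd_right _ _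
  have hle : Nat.gcd i n ≤ i := Nat.gcd_le_left _ h0
  have he := (Nat.div_mul_cancel hg).symm
  refine ⟨he, ?_⟩
  by_contra hcon
  have : n / Nat.gcd i n ≤ 1 := by omega
  nlinarith

lemma NP_card {k : ℕ} {c x : Fin k → ℕ} (hx : ∀ i, c i / 2 ≤ x i) :
    (NP k c).card ≤ (Dv k c).card * (Wd k x).card := by
  have hsub : NP k c ⊆ (Dv k c).biUnion (fun d => Fx k c ((∑ i, c i) / d)) := by
    intro w hw
    unfold NP at hw
    rw [Finset.mem_filter] at hw
    obtain ⟨hw, i, hi, h0, hr⟩ := hw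
    rw [Finset.mem_range] at hi
    have hlen := Wd_length hw
    have hg := rotate_gcd hr
    rw [hlen] at hi hg
    obtain ⟨h1, h2⟩ := gcd_facts h0 hi
    set n := ∑ i, c i with hn
    have hF : w ∈ Fx k c (Nat.gcd i n) := by
      unfold Fx
      rw [Finset.mem_filter]
      exact ⟨hw, hg⟩
    rw [Finset.mem_biUnion]
    refine ⟨n / Nat.gcd i n, ?_, ?_⟩
    · unfold Dv
      rw [Finset.mem_filter, Nat.mem_divisors]
      refine ⟨⟨Nat.div_dvd_of_dvd (Nat.gcd_dvd_right _ _), ?_⟩, h2, fun j => ?_⟩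
      · rw [← hn]; omega
      · exact Fx_dvd (hn.symm.trans h1) (by omega) hF j
    · rw [Nat.div_div_self (Nat.gcd_dvd_right _ _) (by omega)]
      exact hF
  refine (Finset.card_le_card hsub).trans ?_
  apply Finset.card_biUnion_le_card_mul
  intro d hd
  unfold Dv at hd
  rw [Finset.mem_filter, Nat.mem_divisors] at hd
  exact Fx_card (Nat.mul_div_cancel' hd.1.1).symm hd.2.1 hx

/-- Lyndon words of content `c`. -/
noncomputable def Ly (k : ℕ) (c : Fin k → ℕ) : Finset (List ℕ) :=
  open Classical in (Wd k c).filter IsLyndon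

/-- Necklaces of content `c`. -/
noncomputable def Nck (k : ℕ) (c : Fin k → ℕ) : Finset (List ℕ) :=
  open Classical in (Wd k c).filter IsNecklace

lemma Lk_eq (k : ℕ) (c : Fin k → ℕ) : Lk k c = (Ly k c).card := by
  rw [Lk, ← Set.ncard_coe_finset]
  congr 1
  ext w
  simp [Ly, mem_Wd, and_assoc]

lemma Nk_eq (k : ℕ) (c : Fin k → ℕ) : Nk k c = (Nck k c).card := by
  rw [Nk, ← Set.ncard_coe_finset]
  congr 1
  ext w
  simp [Nck, mem_Wd, and_assoc]

lemma prim_bound {k : ℕ} (c : Fin k → ℕ) (hn : 0 < ∑ i, c i) :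
    (Wd k c).card ≤ (∑ i, c i) * (Ly k c).card + (NP k c).card := by
  have hsub : Wd k c ⊆ ((Finset.range (∑ i, c i)) ×ˢ (Ly k c)).image (fun p => p.2.rotate p.1)
      ∪ NP k c := by
    intro w hw
    rw [Finset.mem_union]
    by_cases hnp : w ∈ NP k c
    · exact Or.inr hnp
    left
    have hlen := Wd_length hw
    have hprim : ∀ i, 0 < i → i < w.length → w.rotate i ≠ w := by
      intro i h0 h1 h2
      apply hnp
      unfold NP
      rw [Finset.mem_filter]
      exact ⟨hw, i, Finset.mem_range.2 h1, h0, h2⟩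
    obtain ⟨r, hr, hmin⟩ := Finset.exists_min_image (Finset.range w.length) (fun i => w.rotate i)
      ⟨0, Finset.mem_range.2 (by omega)⟩
    rw [Finset.mem_range] at hr
    have hmin' : ∀ i, w.rotate r ≤ w.rotate i := by
      intro i
      rw [← List.rotate_mod w i]
      exact hmin _ (Finset.mem_range.2 (Nat.mod_lt _ (by omega)))
    rw [Finset.mem_image]
    have hback : (w.rotate r).rotate ((w.length - r) % w.length) = w := by
      have h1 := List.rotate_mod (w.rotate r) (w.length - r)
      rw [List.length_rotate] at h1
      rw [h1, List.rotate_rotate, Nat.add_sub_cancel' hr.le, List.rotate_length]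
    refine ⟨((w.length - r) % w.length, w.rotate r), ?_, hback⟩
    rw [Finset.mem_product]
    refine ⟨?_, ?_⟩
    · rw [Finset.mem_range, ← hlen]
      exact Nat.mod_lt _ (by omega)
    · simp only [Ly, Finset.mem_filter]
      refine ⟨Wd_rotate hw r, ?_, ?_⟩
      · intro h
        have := congrArg List.length h
        simp at this
        rw [this] at hr
        simp at hr
      · intro i h0 h1
        rw [List.length_rotate] at h1
        have hle : w.rotate r ≤ (w.rotate r).rotate i := by
          rw [List.rotate_rotate]
          exact hmin' _
        refine lt_of_le_of_ne hle ?_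
        intro he
        apply hprim i h0 h1
        rw [List.rotate_rotate, add_comm, ← List.rotate_rotate] at he
        exact (List.rotate_eq_rotate.1 he).symm
  refine (Finset.card_le_card hsub).trans ((Finset.card_union_le _ _).trans ?_)
  gcongr
  refine Finset.card_image_le.trans ?_
  rw [Finset.card_product, Finset.card_range]

lemma neck_bound {k : ℕ} (c : Fin k → ℕ) :
    (∑ i, c i) * (Nck k c).card ≤ ∑ i ∈ Finset.range (∑ i, c i), (Fx k c i).card := by
  set n := ∑ i, c i with hn
  have h1 : n * (Nck k c).card = ((Finset.range n) ×ˢ (Nck k c)).card := by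
    rw [Finset.card_product, Finset.card_range]
  have hNe : ∀ v ∈ Nck k c, v ∈ Wd k c ∧ IsNecklace v := by
    intro v hv
    simpa only [Nck, Finset.mem_filter] using hv
  rw [h1, Finset.card_eq_sum_card_fiberwise (f := fun p => p.2.rotate p.1) (t := Wd k c)]
  · have h2 : ∑ i ∈ Finset.range n, (Fx k c i).card =
        ∑ w ∈ Wd k c, ((Finset.range n).filter (fun i => w.rotate i = w)).card := by
      unfold Fx
      simp only [Finset.card_filter]
      rw [Finset.sum_comm]
    rw [h2]
    apply Finset.sum_le_sum
    intro w hw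
    have hlen : w.length = n := Wd_length hw
    rcases Finset.eq_empty_or_nonempty
      (((Finset.range n) ×ˢ (Nck k c)).filter (fun p => p.2.rotate p.1 = w)) with he | ⟨p0, hp0⟩
    · rw [he]; simp
    obtain ⟨r0, v0⟩ := p0
    simp only [Finset.mem_filter, Finset.mem_product, Finset.mem_range] at hp0
    obtain ⟨⟨hr0, hv0⟩, hw0⟩ := hp0
    have huniq : ∀ v r, v ∈ Nck k c → v.rotate r = w → v = v0 := by
      intro v r hv hr
      have hrot : v.IsRotated v0 := by
        have a : v.IsRotated w := ⟨r, hr⟩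
        have b : v0.IsRotated w := ⟨r0, hw0⟩
        exact a.trans b.symm
      obtain ⟨s', hs'⟩ := hrot.symm
      obtain ⟨s, hs⟩ := hrot
      have e1 := (hNe v hv).2 s
      have e2 := (hNe v0 hv0).2 s'
      rw [hs] at e1
      rw [hs'] at e2
      exact le_antisymm e1 e2
    apply Finset.card_le_card_of_injOn (fun p => (p.1 + (n - r0)) % n)
    · rintro ⟨r, v⟩ hp
      simp only [Finset.coe_filter, Finset.mem_product, Finset.mem_range, Set.mem_ofPred_eq] at hp ⊢
      obtain ⟨⟨hr, hv⟩, hrw⟩ := hp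
      refine ⟨Nat.mod_lt _ (by omega), ?_⟩
      have hvv := huniq v r hv hrw
      subst hvv
      have h3 := List.rotate_mod w (r + (n - r0))
      rw [hlen] at h3
      rw [h3]
      have h5 : v.length = n := Wd_length (hNe v hv).1
      conv_lhs => rw [← hw0]
      rw [List.rotate_rotate, show r0 + (r + (n - r0)) = n + r by omega, ← List.rotate_rotate,
        ← h5, List.rotate_length, hrw]
    · rintro ⟨r, v⟩ hp ⟨r', v'⟩ hp' he
      simp only [Finset.coe_filter, Finset.mem_product, Finset.mem_range, Set.mem_ofPred_eq] at hp hp' he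
      have a := huniq v r hp.1.2 hp.2
      have b := huniq v' r' hp'.1.2 hp'.2
      have e : r ≡ r' [MOD n] := Nat.ModEq.add_right_cancel' _ he
      rw [Nat.ModEq, Nat.mod_eq_of_lt hp.1.1, Nat.mod_eq_of_lt hp'.1.1] at e
      rw [a, b, e]
  · rintro ⟨r, v⟩ hp
    simp only [Finset.coe_product, Set.mem_prod, Finset.mem_coe] at hp
    exact Wd_rotate (hNe v hp.2).1 r

lemma centralBinom_lower (b : ℕ) (hb : 1 ≤ b) : 4 * b - 2 ≤ Nat.centralBinom b := by
  induction b, hb using Nat.le_induction with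
  | base => decide
  | succ b hb ih =>
    have h := Nat.succ_mul_centralBinom_succ b
    rcases Nat.lt_or_ge b 2 with h2 | h2
    · have : b = 1 := by omega
      subst this
      decide
    · have h3 : 2 * Nat.centralBinom b ≤ Nat.centralBinom (b + 1) := by
        have h4 : (b + 1) * (2 * Nat.centralBinom b) ≤ (b + 1) * Nat.centralBinom (b + 1) := by
          rw [h]
          nlinarith [Nat.zero_le (Nat.centralBinom b)]
        exact Nat.le_of_mul_le_mul_left h4 (by omega)
      omega

lemma fact_mul_le (p q : ℕ) (hp : 1 ≤ p) (hq : 1 ≤ q) :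
    p.factorial * q.factorial ≤ (p + q - 1).factorial := by
  induction q, hq using Nat.le_induction with
  | base => simp
  | succ q hq ih =>
    rw [Nat.factorial_succ, show p + (q + 1) - 1 = (p + q - 1) + 1 by omega, Nat.factorial_succ]
    calc p.factorial * ((q + 1) * q.factorial) = (q + 1) * (p.factorial * q.factorial) := by ring
      _ ≤ (p + q - 1 + 1) * (p + q - 1).factorial := Nat.mul_le_mul (by omega) ih

/-- lower bound for the number of words -/
lemma Wd_lower {k : ℕ} (y : Fin k → ℕ) (i0 i1 i2 : Fin k) (h01 : i0 ≠ i1) (h02 : i0 ≠ i2)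
    (h12 : i1 ≠ i2) (hp : 1 ≤ y i0) (hb : 1 ≤ y i1) (hle : y i1 ≤ y i2) :
    (∑ i, y i) * (4 * y i1 - 2) ≤ (Wd k y).card := by
  set N := ∑ i, y i with hN
  set b := y i1 with hbdef
  let R : Finset (Fin k) := (Finset.univ.erase i1).erase i0
  have hs : N = b + (y i0 + ∑ i ∈ R, y i) := by
    rw [hN, ← Finset.add_sum_erase _ _ (Finset.mem_univ i1),
      ← Finset.add_sum_erase (a := i0) _ _ (by simp [h01])]
  have hpr : ∏ i, (y i).factorial =
      b.factorial * ((y i0).factorial * ∏ i ∈ R, (y i).factorial) := by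
    rw [← Finset.mul_prod_erase _ _ (Finset.mem_univ i1),
      ← Finset.mul_prod_erase (a := i0) _ _ (by simp [h01])]
  have hi2 : i2 ∈ R := by simp [R, h02.symm, h12.symm]
  have hR : b ≤ ∑ i ∈ R, y i :=
    hle.trans (Finset.single_le_sum (f := y) (fun _ _ => Nat.zero_le _) hi2)
  have h1 : ∏ i ∈ R, (y i).factorial ≤ (∑ i ∈ R, y i).factorial :=
    Nat.le_of_dvd (Nat.factorial_pos _) (Nat.prod_factorial_dvd_factorial_sum R y)
  have h2 := fact_mul_le (y i0) (∑ i ∈ R, y i) hp (by omega)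
  set S := ∑ i ∈ R, y i with hS
  have h3 : ∏ i, (y i).factorial ≤ b.factorial * (N - 1 - b).factorial := by
    rw [hpr]
    apply Nat.mul_le_mul_left
    have : N - 1 - b = y i0 + S - 1 := by omega
    rw [this]
    exact (Nat.mul_le_mul_left _ h1).trans h2
  have h4 := Wd_factorial k N y hN.symm
  have h5 : N.factorial ≤ (Wd k y).card * (b.factorial * (N - 1 - b).factorial) :=
    h4.trans (Nat.mul_le_mul_left _ h3)
  have h6 := Nat.choose_mul_factorial_mul_factorial (n := N - 1) (k := b) (by omega)
  have h7 : N.factorial = N * (N - 1).factorial := (Nat.mul_factorial_pred (by omega)).symm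
  have h8 : N * (N - 1).choose b ≤ (Wd k y).card := by
    rw [h7, ← h6, mul_assoc, ← mul_assoc] at h5
    exact Nat.le_of_mul_le_mul_right h5
      (Nat.mul_pos (Nat.factorial_pos _) (Nat.factorial_pos _))
  refine le_trans (Nat.mul_le_mul_left _ ?_) h8
  refine (centralBinom_lower b hb).trans ?_
  rw [Nat.centralBinom_eq_two_mul_choose]
  exact Nat.choose_le_choose _ (by omega)

lemma exists_three {k : ℕ} (hk : 2 < k) (c : Fin k → ℕ) : ∃ i0 i1 i2 : Fin k,
    i0 ≠ i1 ∧ i0 ≠ i2 ∧ i1 ≠ i2 ∧ c i0 ≤ c i1 ∧ c i1 ≤ c i2 := by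
  obtain ⟨i0, _, h0⟩ := Finset.exists_min_image (Finset.univ : Finset (Fin k)) c
    ⟨⟨0, by omega⟩, Finset.mem_univ _⟩
  have hc1 : (Finset.univ.erase i0).card = k - 1 := by
    rw [Finset.card_erase_of_mem (Finset.mem_univ _), Finset.card_univ, Fintype.card_fin]
  obtain ⟨i1, hi1, h1⟩ := Finset.exists_min_image (Finset.univ.erase i0) c
    (Finset.card_pos.1 (by omega))
  have hc2 : ((Finset.univ.erase i0).erase i1).card = k - 1 - 1 := by
    rw [Finset.card_erase_of_mem hi1, hc1]
  obtain ⟨i2, hi2⟩ := Finset.card_pos.1 (show 0 < ((Finset.univ.erase i0).erase i1).card by omega)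
  simp only [Finset.mem_erase, Finset.mem_univ, and_true] at hi1 hi2
  exact ⟨i0, i1, i2, Ne.symm hi1, Ne.symm hi2.2, Ne.symm hi2.1, h0 _ (Finset.mem_univ _),
    h1 i2 (by simp [hi2.2])⟩

lemma sum_update_pred {k : ℕ} (c : Fin k → ℕ) (hc : ∀ i, 1 ≤ c i) (i : Fin k) :
    ∑ j, Function.update c i (c i - 1) j = ∑ j, c j - 1 := by
  rw [Finset.sum_update_of_mem (Finset.mem_univ i)]
  rw [← Finset.add_sum_erase _ _ (Finset.mem_univ i), Finset.erase_eq]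
  have := hc i
  omega

/-- The divisors coming from deleting a letter. -/
lemma Dv_bound {k : ℕ} (c : Fin k → ℕ) (hc : ∀ i, 1 ≤ c i) (i0 i1 : Fin k)
    (h01 : i0 ≠ i1) (hle : c i0 ≤ c i1) :
    ∑ i : Fin k, (Dv k (Function.update c i (c i - 1))).card ≤ c i1 / Finset.univ.gcd c - 1 := by
  set g := Finset.univ.gcd c with hg
  have hgd : ∀ i, g ∣ c i := fun i => Finset.gcd_dvd (Finset.mem_univ i)
  have hgpos : 0 < g := Nat.pos_of_dvd_of_pos (hgd i0) (hc i0)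
  have hmem : ∀ i d, d ∈ Dv k (Function.update c i (c i - 1)) →
      2 ≤ d ∧ d ∣ c i - 1 ∧ ∀ j, j ≠ i → d ∣ c j := by
    intro i d hd
    unfold Dv at hd
    rw [Finset.mem_filter] at hd
    refine ⟨hd.2.1, ?_, ?_⟩
    · simpa using hd.2.2 i
    · intro j hj
      have := hd.2.2 j
      rwa [Function.update_of_ne hj] at this
  rw [← Finset.card_biUnion]
  · have hsub : Finset.univ.biUnion (fun i => Dv k (Function.update c i (c i - 1))) ⊆
        Finset.Icc 2 (c i1 / g) := by
      intro d hd
      rw [Finset.mem_biUnion] at hd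
      obtain ⟨i, _, hd⟩ := hd
      obtain ⟨h2, h3, h4⟩ := hmem i d hd
      rw [Finset.mem_Icc]
      refine ⟨h2, ?_⟩
      have hcop : Nat.Coprime d g := by
        apply Nat.Coprime.symm
        have a : Nat.gcd g d ∣ c i := (Nat.gcd_dvd_left _ _).trans (hgd i)
        have b : Nat.gcd g d ∣ c i - 1 := (Nat.gcd_dvd_right _ _).trans h3
        have e := (Nat.dvd_sub a b)
        have : c i - (c i - 1) = 1 := by have := hc i; omega
        rw [this] at e
        exact Nat.dvd_one.1 e
      rw [Nat.le_div_iff_mul_le hgpos]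
      by_cases hi : i1 = i
      · have : d * g ∣ c i0 := hcop.mul_dvd_of_dvd_of_dvd (h4 i0 (hi ▸ h01)) (hgd i0)
        exact (Nat.le_of_dvd (hc i0) this).trans hle
      · have : d * g ∣ c i1 := hcop.mul_dvd_of_dvd_of_dvd (h4 i1 hi) (hgd i1)
        exact Nat.le_of_dvd (hc i1) this
    refine (Finset.card_le_card hsub).trans ?_
    rw [Nat.card_Icc]
    omega
  · intro i _ j _ hij
    rw [Function.onFun, Finset.disjoint_left]
    intro d h1 h2
    obtain ⟨a2, a3, a4⟩ := hmem i d h1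
    obtain ⟨b2, b3, b4⟩ := hmem j d h2
    have e := Nat.dvd_sub (b4 i hij) a3
    have : c i - (c i - 1) = 1 := by have := hc i; omega
    rw [this, Nat.dvd_one] at e
    omega

lemma Fx_sum {k : ℕ} (c : Fin k → ℕ) (hc : ∀ i, 1 ≤ c i) (i0 : Fin k) (x : Fin k → ℕ)
    (hx : ∀ i, c i / 2 ≤ x i) :
    ∑ i ∈ Finset.range (∑ i, c i), (Fx k c i).card ≤
      (Wd k c).card + (Finset.univ.gcd c - 1) * (Wd k x).card := by
  set g := Finset.univ.gcd c with hg
  set n := ∑ i, c i with hn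
  have hgd : ∀ i, g ∣ c i := fun i => Finset.gcd_dvd (Finset.mem_univ i)
  have hgpos : 0 < g := Nat.pos_of_dvd_of_pos (hgd i0) (hc i0)
  have hgn : g ∣ n := Finset.dvd_sum fun i _ => hgd i
  have hnpos : 0 < n := lt_of_lt_of_le (hc i0)
    (Finset.single_le_sum (f := c) (fun _ _ => Nat.zero_le _) (Finset.mem_univ i0))
  obtain ⟨h, hh⟩ := hgn
  have hhpos : 0 < h := by
    rcases Nat.eq_zero_or_pos h with h0 | h0
    · rw [h0] at hh; omega
    · exact h0
  rw [← Finset.add_sum_erase _ _ (Finset.mem_range.2 hnpos)]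
  have hF0 : (Fx k c 0).card ≤ (Wd k c).card := Finset.card_filter_le _ _
  refine Nat.add_le_add hF0 ?_
  let I : Finset ℕ := ((Finset.range n).erase 0).filter (fun i => h ∣ i)
  have hI : I.card ≤ g - 1 := by
    have : I ⊆ (Finset.Ico 1 g).image (fun t => h * t) := by
      intro i hi
      simp only [I, Finset.mem_filter, Finset.mem_erase, Finset.mem_range] at hi
      obtain ⟨⟨h0, h1⟩, t, rfl⟩ := hi
      rw [Finset.mem_image]
      refine ⟨t, ?_, rfl⟩
      rw [Finset.mem_Ico]
      constructor
      · rcases Nat.eq_zero_or_pos t with ht | ht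
        · simp [ht] at h0
        · exact ht
      · rw [hh, mul_comm g h] at h1
        exact Nat.lt_of_mul_lt_mul_left h1
    refine (Finset.card_le_card this).trans (Finset.card_image_le.trans ?_)
    simp
  have hsum : ∑ i ∈ (Finset.range n).erase 0, (Fx k c i).card = ∑ i ∈ I, (Fx k c i).card := by
    symm
    apply Finset.sum_subset (Finset.filter_subset _ _)
    intro i hi hni
    by_contra hne
    obtain ⟨w, hw⟩ := Finset.card_pos.1 (Nat.pos_of_ne_zero hne)
    apply hni
    rw [Finset.mem_filter]
    refine ⟨hi, ?_⟩
    simp only [Finset.mem_erase, Finset.mem_range] at hi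
    obtain ⟨h1, h2⟩ := gcd_facts (Nat.pos_of_ne_zero hi.1) hi.2
    have hw' : w ∈ Fx k c (Nat.gcd i n) := by
      unfold Fx at hw ⊢
      rw [Finset.mem_filter] at hw ⊢
      have hg := rotate_gcd hw.2
      rw [Wd_length hw.1] at hg
      exact ⟨hw.1, hg⟩
    have hdg : n / Nat.gcd i n ∣ g :=
      Finset.dvd_gcd fun j _ => Fx_dvd (hn.symm.trans h1) (by omega) hw' j
    obtain ⟨s, hs⟩ := hdg
    have : Nat.gcd i n = s * h := by
      have h3 : (n / Nat.gcd i n) * Nat.gcd i n = (n / Nat.gcd i n) * (s * h) := by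
        rw [← h1, ← mul_assoc, ← hs, ← hh]
      exact Nat.eq_of_mul_eq_mul_left (by omega) h3
    exact (Dvd.intro_left s this.symm).trans (Nat.gcd_dvd_left _ _)
  rw [hsum]
  refine (Finset.sum_le_card_nsmul I _ (Wd k x).card ?_).trans ?_
  · intro i hi
    simp only [I, Finset.mem_filter, Finset.mem_erase, Finset.mem_range] at hi
    obtain ⟨h1, h2⟩ := gcd_facts (Nat.pos_of_ne_zero hi.1.1) hi.1.2
    refine le_trans (Finset.card_le_card ?_) (Fx_card (hn.symm.trans h1) h2 hx)
    intro w hw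
    unfold Fx at hw ⊢
    rw [Finset.mem_filter] at hw ⊢
    have hg := rotate_gcd hw.2
    rw [Wd_length hw.1] at hg
    exact ⟨hw.1, hg⟩
  · rw [smul_eq_mul]
    exact Nat.mul_le_mul_right _ hI
/-- For `k > 2` the Pascal-like bound for fixed content is strict. -/
theorem necklace_content_bound_strict (k : ℕ) (hk : 2 < k) (c : Fin k → ℕ) (hc : ∀ i, 1 ≤ c i) :
    Nk k c < ∑ i : Fin k, Lk k (Function.update c i (c i - 1)) := by
  obtain ⟨i0, i1, i2, h01, h02, h12, hle1, hle2⟩ := exists_three hk c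
  have hsum3 : 3 ≤ ∑ i, c i := by
    have : ∑ i : Fin k, 1 ≤ ∑ i, c i := Finset.sum_le_sum fun i _ => hc i
    simp at this
    omega
  set g := Finset.univ.gcd c with hg
  have hgd : ∀ i, g ∣ c i := fun i => Finset.gcd_dvd (Finset.mem_univ i)
  have hgpos : 0 < g := Nat.pos_of_dvd_of_pos (hgd i0) (hc i0)
  let x : Fin k → ℕ := fun i => c i / 2
  let y : Fin k → ℕ := fun i => c i - c i / 2
  have hxy : (fun i => x i + y i) = c := by
    funext i
    simp only [x, y]
    omega
  have e4 := Wd_mul_le x y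
  rw [hxy] at e4
  have e1 := (neck_bound c).trans (Fx_sum c hc i0 x (fun i => le_refl _))
  rw [← hg, ← Nk_eq] at e1
  have e2 : (Wd k c).card ≤ (∑ i, c i - 1) * ∑ i : Fin k, Lk k (Function.update c i (c i - 1)) +
      (∑ i : Fin k, (Dv k (Function.update c i (c i - 1))).card) * (Wd k x).card := by
    refine (Wd_le_sum c hc (by omega)).trans ?_
    rw [Finset.mul_sum, Finset.sum_mul, ← Finset.sum_add_distrib]
    apply Finset.sum_le_sum
    intro i _
    have hs := sum_update_pred c hc i
    have h1 := prim_bound (Function.update c i (c i - 1)) (by rw [hs]; omega)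
    rw [hs, ← Lk_eq] at h1
    refine h1.trans (Nat.add_le_add_left (NP_card ?_) _)
    intro j
    apply Nat.div_le_div_right
    by_cases hj : j = i
    · subst hj; simp
    · rw [Function.update_of_ne hj]
  have e3 := Dv_bound c hc i0 i1 h01 hle1
  rw [← hg] at e3
  have e5 := Wd_lower y i0 i1 i2 h01 h02 h12
    (by simp only [y]; have := hc i0; omega) (by simp only [y]; have := hc i1; omega)
    (by simp only [y]; omega)
  have e6 : ∑ i, c i ≤ 2 * ∑ i, y i := by
    rw [Finset.mul_sum]
    apply Finset.sum_le_sum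
    intro i _
    simp only [y]
    omega
  have e7 : g = 1 → ∑ i, c i < 2 * ∑ i, y i := by
    intro hg1
    rw [Finset.mul_sum]
    apply Finset.sum_lt_sum
    · intro i _
      simp only [y]
      omega
    · by_contra hcon
      push Not at hcon
      have : 2 ∣ g := by
        apply Finset.dvd_gcd
        intro i hi
        have := hcon i hi
        simp only [y] at this
        omega
      omega
  have eQ := Wd_pos k x
  have eM := Wd_pos k c
  have hb1 : 4 * y i1 - 2 ≥ 2 * (c i1 - 1) := by simp only [y]; omega
  obtain ⟨t, ht⟩ := hgd i1
  rw [ht, Nat.mul_div_cancel_left _ hgpos] at e3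
  have htpos : 0 < t := by
    rcases Nat.eq_zero_or_pos t with h0 | h0
    · have := hc i1
      rw [ht, h0] at this
      simp at this
    · exact h0
  have hcb := hc i1
  generalize (∑ i : Fin k, (Dv k (Function.update c i (c i - 1))).card) = KP at *
  generalize (∑ i : Fin k, Lk k (Function.update c i (c i - 1))) = A at *
  generalize (Wd k x).card = Q at *
  generalize (Wd k y).card = Y at *
  generalize (Wd k c).card = M at *
  generalize (∑ i, c i) = n at *
  generalize (∑ i, y i) = s at *
  generalize Nk k c = P at *
  generalize 4 * y i1 - 2 = z at *
  generalize c i1 = b at *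
  clear hxy hgd hc hg
  clear_value g
  obtain ⟨g, rfl⟩ : ∃ g', g = g' + 1 := ⟨g - 1, by omega⟩
  obtain ⟨t, rfl⟩ : ∃ t', t = t' + 1 := ⟨t - 1, by omega⟩
  obtain ⟨n, rfl⟩ : ∃ n', n = n' + 1 := ⟨n - 1, by omega⟩
  obtain ⟨b, rfl⟩ : ∃ b', b = b' + 1 := ⟨b - 1, by omega⟩
  simp only [Nat.add_sub_cancel] at *
  have hK : KP + g ≤ b := by nlinarith
  have hz : 2 * (KP + g) ≤ z := by omega
  have hY : s * (2 * (KP + g)) ≤ Y := (Nat.mul_le_mul_left _ hz).trans e5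
  by_contra hcon
  have hcon : A ≤ P := by omega
  have f1 : n * ((n + 1) * A) ≤ n * (M + g * Q) :=
    Nat.mul_le_mul_left _ ((Nat.mul_le_mul_left _ hcon).trans e1)
  have f2 : (n + 1) * M ≤ (n + 1) * (n * A + KP * Q) := Nat.mul_le_mul_left _ e2
  have f3 : M ≤ (n + 1) * (KP * Q) + n * (g * Q) := by nlinarith
  have f4 : Q * (s * (2 * (KP + g))) ≤ M := (Nat.mul_le_mul_left _ hY).trans e4
  rcases Nat.eq_zero_or_pos g with h0 | h0
  · subst h0
    have f5 := e7 (by omega)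
    rcases Nat.eq_zero_or_pos KP with h1 | h1
    · subst h1
      simp at f3
      omega
    · have f6 : 0 < Q * KP := Nat.mul_pos eQ h1
      nlinarith
  · have f6 : 0 < Q * g := Nat.mul_pos eQ h0
    have f7 : (Q * (KP + g)) * (n + 1) ≤ (Q * (KP + g)) * (2 * s) := Nat.mul_le_mul_left _ e6
    nlinarith
end

section
/- Let k ≥ 2 and n_0,…,n_{k−1} ≥ 1. The number of unstable necklaces with content (n_0,…,n_{k−1}) is at most L_k(n_0 − 1, n_1,…, n_{k−1}), i.e., there is an injection from the set of unstable necklaces with this content into the set of Lyndon words with content (n_0 − 1, n_1, …, n_{k−1}). -/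
namespace UNB

open Finset

def DD (n b : ℕ) : ℕ := ∑ d ∈ b.divisors.erase 1, if d ∣ n then Nat.totient d * (n / d).choose (b / d) else 0
def TT (n b : ℕ) : ℕ := ∑ d ∈ b.primeFactors, if d ∣ n then (n / d).choose (b / d) else 0

theorem six_choose (n : ℕ) : 6 * (n+3).choose 3 = (n+3)*(n+2)*(n+1) := by
  have h := Nat.descFactorial_eq_factorial_mul_choose (n+3) 3
  simp [Nat.descFactorial, Nat.factorial] at h
  rw [← h]; ring

theorem tf_choose (n : ℕ) : 24 * (n+4).choose 4 = (n+4)*(n+3)*(n+2)*(n+1) := by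
  have h := Nat.descFactorial_eq_factorial_mul_choose (n+4) 4
  simp [Nat.descFactorial, Nat.factorial] at h
  rw [← h]; ring

theorem two_choose (n : ℕ) : 2 * (n+2).choose 2 = (n+2)*(n+1) := by
  have h := Nat.descFactorial_eq_factorial_mul_choose (n+2) 2
  simp [Nat.descFactorial, Nat.factorial] at h
  rw [← h]; ring

theorem DD2 (n : ℕ) : DD n 2 = if 2 ∣ n then n / 2 else 0 := by
  have : (Nat.divisors 2).erase 1 = {2} := by decide
  simp [DD, this]
theorem DD3 (n : ℕ) : DD n 3 = if 3 ∣ n then 2 * (n / 3) else 0 := by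
  have : (Nat.divisors 3).erase 1 = {3} := by decide
  have h : Nat.totient 3 = 2 := by decide
  simp [DD, this, h]
theorem DD4 (n : ℕ) : DD n 4 = (if 2 ∣ n then (n/2).choose 2 else 0) + if 4 ∣ n then 2 * (n / 4) else 0 := by
  have : (Nat.divisors 4).erase 1 = {2, 4} := by decide
  have h : Nat.totient 4 = 2 := by decide
  simp [DD, this, h]
theorem TT1 (n : ℕ) : TT n 1 = 0 := by simp [TT]
theorem TT2 (n : ℕ) : TT n 2 = if 2 ∣ n then n / 2 else 0 := by
  have : Nat.primeFactors 2 = {2} := Nat.prime_two.primeFactors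
  simp [TT, this]
theorem TT3 (n : ℕ) : TT n 3 = if 3 ∣ n then n / 3 else 0 := by
  have : Nat.primeFactors 3 = {3} := Nat.prime_three.primeFactors
  simp [TT, this]
theorem TT4 (n : ℕ) : TT n 4 = if 2 ∣ n then (n / 2).choose 2 else 0 := by
  have : Nat.primeFactors 4 = {2} := Nat.primeFactors_prime_pow (k := 2) (by norm_num) Nat.prime_two
  simp [TT, this]

theorem num2 (n : ℕ) (h : 4 ≤ n) :
    (n-1) * DD n 2 + n * (TT (n-1) 2 + TT (n-1) 1) ≤ n.choose 2 := by
  obtain ⟨m, rfl⟩ : ∃ m, n = m + 2 := ⟨n-2, by omega⟩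
  rw [DD2, TT2, TT1]
  have := two_choose m
  rcases Nat.even_or_odd' m with ⟨q, rfl | rfl⟩
  · rw [if_pos (by omega), if_neg (by omega)]
    have : (2*q+2)/2 = q+1 := by omega
    rw [this]
    have : 2*q+2-1 = 2*q+1 := by omega
    rw [this]
    nlinarith
  · rw [if_neg (by omega), if_pos (by omega)]
    have : (2*q+1+2-1)/2 = q+1 := by omega
    rw [this]
    nlinarith

theorem num3 (n : ℕ) (h : 6 ≤ n) :
    (n-1) * DD n 3 + n * (TT (n-1) 3 + TT (n-1) 2) ≤ n.choose 3 := by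
  obtain ⟨m, rfl⟩ : ∃ m, n = m + 3 := ⟨n-3, by omega⟩
  rw [DD3, TT3, TT2]
  have h6 := six_choose m
  have e1 : m + 3 - 1 = m + 2 := by omega
  rw [e1]
  by_cases hm : 6 ≤ m
  · have h1 : (if 3 ∣ m+3 then 2 * ((m+3)/3) else 0) ≤ 2 * ((m+3)/3) := by split_ifs <;> omega
    have h2 : (if 3 ∣ m+3 then 2 * ((m+3)/3) else 0) * 3 + 3 * (if 3 ∣ m+2 then (m+2)/3 else 0) ≤ 2 * (m+3) := by
      split_ifs <;> omega
    have h3 : 2 * (if 2 ∣ m+2 then (m+2)/2 else 0) ≤ m+2 := by split_ifs <;> omega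
    generalize (if 2 ∣ m+2 then (m+2)/2 else 0) = z at *
    by_cases h3 : 3 ∣ m + 3
    · rw [if_neg (show ¬ 3 ∣ m+2 by omega), if_pos h3]
      obtain ⟨q, hq⟩ := h3
      have : (m+3)/3 = q := by omega
      rw [this]
      have k1 : 6 * ((m+2) * (2*q)) = 4 * (m+2) * (m+3) := by rw [hq]; ring
      have k2 : 6 * ((m+3) * (0+z)) ≤ 3 * (m+3) * (m+2) := by nlinarith
      have k3 : 7 * ((m+3) * (m+2)) ≤ (m+1) * ((m+3)*(m+2)) := Nat.mul_le_mul_right _ (by omega)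
      nlinarith
    · rw [if_neg h3]
      have : 3 * (if 3 ∣ m+2 then (m+2)/3 else 0) ≤ m + 2 := by split_ifs <;> omega
      generalize (if 3 ∣ m+2 then (m+2)/3 else 0) = y at *
      have k1 : 6 * ((m+3) * y) ≤ 2 * ((m+3) * (m+2)) := by nlinarith
      have k2 : 6 * ((m+3) * z) ≤ 3 * ((m+3) * (m+2)) := by nlinarith
      have k3 : 7 * ((m+3) * (m+2)) ≤ (m+1) * ((m+3)*(m+2)) := Nat.mul_le_mul_right _ (by omega)
      nlinarith
  · have : 3 ≤ m := by omega
    interval_cases m <;> simp [Nat.choose] 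

theorem num4 (n : ℕ) (h : 8 ≤ n) :
    (n-1) * DD n 4 + n * (TT (n-1) 4 + TT (n-1) 3) ≤ n.choose 4 := by
  obtain ⟨m, rfl⟩ : ∃ m, n = m + 4 := ⟨n-4, by omega⟩
  rw [DD4, TT4, TT3]
  have h6 := tf_choose m
  have e1 : m + 4 - 1 = m + 3 := by omega
  rw [e1]
  by_cases hm : 5 ≤ m
  · have h3 : 3 * (if 3 ∣ m+3 then (m+3)/3 else 0) ≤ m+3 := by split_ifs <;> omega
    generalize (if 3 ∣ m+3 then (m+3)/3 else 0) = z at *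
    have h4 : 2 * (if 4 ∣ m+4 then 2 * ((m+4)/4) else 0) ≤ m+4 := by split_ifs <;> omega
    generalize (if 4 ∣ m+4 then 2 * ((m+4)/4) else 0) = y at *
    rcases Nat.even_or_odd' m with ⟨q, rfl | rfl⟩
    · rw [if_pos (by omega), if_neg (by omega)]
      have e : (2*q+4)/2 = q+2 := by omega
      rw [e]
      have := two_choose q
      have hq : 3 ≤ q := by omega
      generalize (q+2).choose 2 = x at *
      generalize (2*q+4).choose 4 = w at *
      have k1 : 24 * ((2*q+3)*x) = 12 * (2*q+3) * ((q+2)*(q+1)) := by rw [← this]; ring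
      have k2 : 24 * ((2*q+3)*y) ≤ 12 * (2*q+3) * (2*q+4) := by nlinarith
      have k3 : 24 * ((2*q+4)*z) ≤ 8 * (2*q+4) * (2*q+3) := by nlinarith
      have k4 : 12 * (2*q+3) * ((q+2)*(q+1)) + 12 * (2*q+3) * (2*q+4) + 8 * (2*q+4) * (2*q+3) ≤ 24 * w := by
        rw [h6]
        obtain ⟨r, rfl⟩ : ∃ r, q = r + 3 := ⟨q-3, by omega⟩
        ring_nf
        nlinarith [sq_nonneg r, Nat.zero_le (r^3), Nat.zero_le (r^4)]
      nlinarith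
    · rw [if_neg (by omega), if_pos (by omega)]
      have e : (2*q+1+3)/2 = q+2 := by omega
      rw [e]
      have := two_choose q
      have hq : 2 ≤ q := by omega
      generalize (q+2).choose 2 = x at *
      generalize (2*q+1+4).choose 4 = w at *
      have k1 : 24 * ((2*q+1+4)*x) = 12 * (2*q+5) * ((q+2)*(q+1)) := by rw [← this]; ring
      have k2 : 24 * ((2*q+4)*y) ≤ 12 * (2*q+4) * (2*q+5) := by nlinarith
      have k3 : 24 * ((2*q+5)*z) ≤ 8 * (2*q+5) * (2*q+4) := by nlinarith
      have k4 : 12 * (2*q+5) * ((q+2)*(q+1)) + 12 * (2*q+4) * (2*q+5) + 8 * (2*q+5) * (2*q+4) ≤ 24 * w := by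
        rw [h6]
        obtain ⟨r, rfl⟩ : ∃ r, q = r + 2 := ⟨q-2, by omega⟩
        ring_nf
        nlinarith [sq_nonneg r, Nat.zero_le (r^3), Nat.zero_le (r^4)]
      nlinarith
  · have : m = 4 := by omega
    subst this
    simp [Nat.choose]

theorem choose_mono_row (n r s : ℕ) (h : r ≤ s) (hs : s ≤ n / 2) : n.choose r ≤ n.choose s := by
  induction s, h using Nat.le_induction with
  | base => exact le_rfl
  | succ s hrs ih =>
    exact (ih (by omega)).trans (Nat.choose_le_succ_of_lt_half_left (by omega))

theorem choose_mono_row' (n r s : ℕ) (h : r ≤ s) (hs : r + s ≤ n) : n.choose r ≤ n.choose s := by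
  by_cases h2 : s ≤ n / 2
  · exact choose_mono_row n r s h h2
  · rw [← Nat.choose_symm (by omega : s ≤ n)]
    exact choose_mono_row n r (n - s) (by omega) (by omega)

theorem choose_mono_half (m n b b' d : ℕ) (hd : 2 ≤ d) (hm : m ≤ n) (hbb : b ≤ b') (hb : 2 * b' ≤ n) :
    (m / d).choose (b / d) ≤ (n / 2).choose (b' / 2) := by
  have h1 : b / d ≤ b' / 2 := (Nat.div_le_div_left hd (by norm_num)).trans (Nat.div_le_div_right hbb)
  have h2 : m / d ≤ n / 2 := (Nat.div_le_div_left hd (by norm_num)).trans (Nat.div_le_div_right hm)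
  calc (m / d).choose (b / d) ≤ (n / 2).choose (b / d) := Nat.choose_le_choose _ h2
    _ ≤ (n / 2).choose (b' / 2) := choose_mono_row _ _ _ h1 (by omega)

theorem DD_le (m n b b' : ℕ) (hb1 : 1 ≤ b) (hm : m ≤ n) (hbb : b ≤ b') (hb : 2 * b' ≤ n) :
    DD m b ≤ (b-1) * (n / 2).choose (b' / 2) := by
  have h : ∑ d ∈ b.divisors.erase 1, Nat.totient d = b - 1 := by
    have := Nat.sum_totient b
    rw [← Finset.add_sum_erase _ _ (Nat.one_mem_divisors.mpr (by omega : b ≠ 0))] at this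
    simp at this
    omega
  rw [← h, Finset.sum_mul]
  apply Finset.sum_le_sum
  intro d hd
  have : 2 ≤ d := by
    simp at hd
    have := Nat.pos_of_dvd_of_pos hd.2.1 (by omega)
    omega
  split_ifs
  · exact Nat.mul_le_mul_left _ (choose_mono_half m n b b' d this hm hbb hb)
  · simp

theorem TT_le (m n b b' : ℕ) (hm : m ≤ n) (hbb : b ≤ b') (hb : 2 * b' ≤ n) :
    TT m b ≤ (b-1) * (n / 2).choose (b' / 2) := by
  rcases Nat.eq_zero_or_pos b with rfl | hb0
  · simp [TT]
  refine le_trans ?_ (DD_le m n b b' hb0 hm hbb hb)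
  unfold TT DD
  calc _ ≤ ∑ d ∈ b.primeFactors, if d ∣ m then Nat.totient d * (m / d).choose (b / d) else 0 := by
        apply Finset.sum_le_sum
        intro d hd
        split_ifs
        · apply Nat.le_mul_of_pos_left
          exact Nat.totient_pos.mpr (Nat.prime_of_mem_primeFactors hd).pos
        · simp
    _ ≤ _ := by
        apply Finset.sum_le_sum_of_subset
        intro d hd
        simp at hd ⊢
        exact ⟨hd.1.ne_one, hd.2⟩

theorem large_aux (n b : ℕ) (hn : 33 ≤ n) (hb5 : 5 ≤ b) (hb : 2 * b ≤ n) :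
    3 * n * b ≤ ((n+1)/2).choose ((b+1)/2) := by
  obtain ⟨m, hm⟩ : ∃ m, m = (n+1)/2 := ⟨_, rfl⟩
  rw [← hm]
  have hnm : n ≤ 2 * m := by omega
  by_cases h7 : b < 7
  · have : (b+1)/2 = 3 := by omega
    rw [this]
    obtain ⟨x, rfl⟩ : ∃ x, m = x + 3 := ⟨m-3, by omega⟩
    have h6 := six_choose x
    have k1 : 3 * n * b ≤ 3 * (2 * (x+3)) * 6 := by gcongr; omega
    have hx : 14 ≤ x := by omega
    have k2 : 216 * (x+3) ≤ (x+3) * (x+2)*(x+1) := by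
      obtain ⟨y, rfl⟩ : ∃ y, x = y + 14 := ⟨x-14, by omega⟩
      nlinarith [Nat.zero_le (y^3), Nat.zero_le (y^2)]
    nlinarith
  · refine le_trans ?_ (choose_mono_row' m 4 ((b+1)/2) (by omega) (by omega))
    obtain ⟨x, rfl⟩ : ∃ x, m = x + 4 := ⟨m-4, by omega⟩
    have h6 := tf_choose x
    have k1 : 3 * n * b ≤ 3 * (2 * (x+4)) * (x+4) := by gcongr; omega
    have hx : 13 ≤ x := by omega
    have k2 : 144 * ((x+4)*(x+4)) ≤ (x+4)*(x+3) * (x+2)*(x+1) := by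
      obtain ⟨y, rfl⟩ : ∃ y, x = y + 13 := ⟨x-13, by omega⟩
      have : 144 * (y+13+4) ≤ (y+13+3)*(y+13+2)*(y+13+1) := by
        nlinarith [Nat.zero_le (y^3), Nat.zero_le (y^2)]
      calc _ = (y+13+4) * (144 * (y+13+4)) := by ring
        _ ≤ (y+13+4) * ((y+13+3)*(y+13+2)*(y+13+1)) := Nat.mul_le_mul_left _ this
        _ = _ := by ring
    nlinarith

theorem num_large (n b : ℕ) (hn : 33 ≤ n) (hb5 : 5 ≤ b) (hb : 2 * b ≤ n) :
    (n-1) * DD n b + n * (TT (n-1) b + TT (n-1) (b-1)) ≤ n.choose b := by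
  have h1 := DD_le n n b b (by omega) le_rfl le_rfl hb
  have h2 := TT_le (n-1) n b b (by omega) le_rfl hb
  have h3 := TT_le (n-1) n (b-1) b (by omega) (by omega) hb
  have hv : (n/2).choose (b/2) * ((n+1)/2).choose ((b+1)/2) ≤ n.choose b := by
    have e : n = n/2 + (n+1)/2 := by omega
    conv_rhs => rw [e, Nat.add_choose_eq]
    exact Finset.single_le_sum (f := fun ij : ℕ × ℕ => (n/2).choose ij.1 * ((n+1)/2).choose ij.2)
      (fun _ _ => Nat.zero_le _) (a := (b/2, (b+1)/2)) (by simp; omega)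
  have h4 := large_aux n b hn hb5 hb
  set K := (n/2).choose (b/2)
  calc _ ≤ n * (b * K) + n * (b * K + b * K) := by
        gcongr
        · omega
        · exact h1.trans (Nat.mul_le_mul_right _ (by omega))
        · exact h2.trans (Nat.mul_le_mul_right _ (by omega))
        · exact h3.trans (Nat.mul_le_mul_right _ (by omega))
    _ = K * (3 * n * b) := by ring
    _ ≤ _ := (Nat.mul_le_mul_left _ h4).trans hv

/-- fast binomial -/
def fc (n k : ℕ) : ℕ := n.descFactorial k / k.factorial

theorem fc_eq (n k : ℕ) : n.choose k = fc n k := Nat.choose_eq_descFactorial_div_factorial n k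

def DD' (n b : ℕ) : ℕ := ((List.range (b+1)).map fun d => if 2 ≤ d ∧ b % d = 0 ∧ n % d = 0 then d.totient * fc (n/d) (b/d) else 0).sum
def TT' (n b : ℕ) : ℕ := ((List.range (b+1)).map fun d => if 2 ≤ d ∧ b % d = 0 ∧ n % d = 0 then fc (n/d) (b/d) else 0).sum

theorem DD'_eq (n b : ℕ) (hb : 1 ≤ b) : DD n b ≤ DD' n b := by
  unfold DD DD'
  rw [← List.sum_toFinset _ List.nodup_range]
  calc _ ≤ ∑ x ∈ b.divisors.erase 1, if 2 ≤ x ∧ b % x = 0 ∧ n % x = 0 then x.totient * fc (n/x) (b/x) else 0 := by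
        apply Finset.sum_le_sum
        intro d hd
        simp at hd
        have : 2 ≤ d := by
          have := Nat.pos_of_dvd_of_pos hd.2.1 (by omega)
          omega
        split_ifs with h1 h2 h2
        · rw [fc_eq]
        · exact absurd ⟨this, Nat.mod_eq_zero_of_dvd hd.2.1, Nat.mod_eq_zero_of_dvd h1⟩ h2
        · simp
        · simp
    _ ≤ _ := by
        apply Finset.sum_le_sum_of_subset
        intro d hd
        simp at hd ⊢
        have := Nat.le_of_dvd (by omega) hd.2.1
        omega

theorem TT'_eq (n b : ℕ) (hb : 1 ≤ b) : TT n b ≤ TT' n b := by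
  unfold TT TT'
  rw [← List.sum_toFinset _ List.nodup_range]
  calc _ ≤ ∑ x ∈ b.primeFactors, if 2 ≤ x ∧ b % x = 0 ∧ n % x = 0 then fc (n/x) (b/x) else 0 := by
        apply Finset.sum_le_sum
        intro d hd
        simp at hd
        have : 2 ≤ d := hd.1.two_le
        split_ifs with h1 h2 h2
        · rw [fc_eq]
        · exact absurd ⟨this, Nat.mod_eq_zero_of_dvd hd.2.1, Nat.mod_eq_zero_of_dvd h1⟩ h2
        · simp
        · simp
    _ ≤ _ := by
        apply Finset.sum_le_sum_of_subset
        intro d hd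
        simp at hd ⊢
        have := Nat.le_of_dvd (by omega) hd.2.1
        omega

theorem num_small_aux : ∀ n < 33, ∀ b < 17, 5 ≤ b → 2 * b ≤ n →
    (n-1) * DD' n b + n * (TT' (n-1) b + TT' (n-1) (b-1)) ≤ fc n b := by
  decide +kernel

theorem num_all (n b : ℕ) (hb2 : 2 ≤ b) (hb : 2 * b ≤ n) :
    (n-1) * DD n b + n * (TT (n-1) b + TT (n-1) (b-1)) ≤ n.choose b := by
  by_cases h5 : 5 ≤ b
  · by_cases hn : 33 ≤ n
    · exact num_large n b hn h5 hb
    · have := num_small_aux n (by omega) b (by omega) h5 hb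
      rw [fc_eq]
      refine le_trans ?_ this
      gcongr
      · exact DD'_eq _ _ (by omega)
      · exact TT'_eq _ _ (by omega)
      · exact TT'_eq _ _ (by omega)
  · interval_cases b
    · exact num2 n (by omega)
    · exact num3 n (by omega)
    · exact num4 n (by omega)

/-- the finite set of rearrangements of `w0` -/
def PW (w0 : List ℕ) : Finset (List ℕ) := w0.permutations.toFinset
theorem mem_PW {w w0 : List ℕ} : w ∈ PW w0 ↔ w.Perm w0 := by simp [PW]

def Prim (u : List ℕ) : Prop := ∀ i, 0 < i → i < u.length → u.rotate i ≠ u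

/-- number of nontrivial rotations fixing `w` -/
def JJ (w : List ℕ) : ℕ := ((Finset.Ico 1 w.length).filter fun i => w.rotate i = w).card

def BB (a b : ℕ) : Finset (List ℕ) := PW (List.replicate a 0 ++ List.replicate b 1)

theorem mem_BB {a b : ℕ} {w : List ℕ} :
    w ∈ BB a b ↔ (∀ x ∈ w, x < 2) ∧ w.count 0 = a ∧ w.count 1 = b := by
  rw [BB, mem_PW]
  constructor
  · intro h
    refine ⟨fun x hx => ?_, ?_, ?_⟩
    · have := h.subset hx
      simp at this
      omega
    · rw [h.count_eq]; simp [List.count_replicate]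
    · rw [h.count_eq]; simp [List.count_replicate]
  · rintro ⟨h, h0, h1⟩
    rw [List.perm_iff_count]
    intro x
    by_cases hx0 : x = 0
    · subst hx0; rw [h0]; simp [List.count_replicate]
    by_cases hx1 : x = 1
    · subst hx1; rw [h1]; simp [List.count_replicate]
    have : x ∉ w := fun hx => by have := h x hx; omega
    rw [List.count_eq_zero_of_not_mem this]
    symm
    apply List.count_eq_zero_of_not_mem
    simp
    omega

theorem length_BB {a b : ℕ} {w : List ℕ} (h : w ∈ BB a b) : w.length = a + b := by
  rw [BB, mem_PW] at h
  rw [h.length_eq]; simp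

theorem cons_zero_mem_BB {a b : ℕ} {u : List ℕ} : 0 :: u ∈ BB a b ↔ 1 ≤ a ∧ u ∈ BB (a-1) b := by
  simp [mem_BB]
  constructor
  · rintro ⟨h, h1, h2⟩; exact ⟨by omega, h, by omega, h2⟩
  · rintro ⟨h, h1, h2, h3⟩; exact ⟨h1, by omega, h3⟩

theorem cons_one_mem_BB {a b : ℕ} {u : List ℕ} : 1 :: u ∈ BB a b ↔ 1 ≤ b ∧ u ∈ BB a (b-1) := by
  simp [mem_BB]
  constructor
  · rintro ⟨h, h1, h2⟩; exact ⟨by omega, h, h1, by omega⟩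
  · rintro ⟨h, h1, h2, h3⟩; exact ⟨h1, h2, by omega⟩

theorem BB_succ_succ (a b : ℕ) : BB (a+1) (b+1) =
    (BB a (b+1)).image (List.cons 0) ∪ (BB (a+1) b).image (List.cons 1) := by
  ext w
  simp only [Finset.mem_union, Finset.mem_image]
  constructor
  · intro h
    rcases w with _ | ⟨x, u⟩
    · simp [mem_BB] at h
    · have : x < 2 := (mem_BB.mp h).1 x (by simp)
      interval_cases x
      · exact Or.inl ⟨u, by simpa using (cons_zero_mem_BB.mp h).2, rfl⟩
      · exact Or.inr ⟨u, by simpa using (cons_one_mem_BB.mp h).2, rfl⟩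
  · rintro (⟨u, hu, rfl⟩ | ⟨u, hu, rfl⟩)
    · exact cons_zero_mem_BB.mpr ⟨by omega, by simpa using hu⟩
    · exact cons_one_mem_BB.mpr ⟨by omega, by simpa using hu⟩

theorem card_BB_left (a : ℕ) : (BB a 0).card = 1 := by
  rw [Finset.card_eq_one]
  refine ⟨List.replicate a 0, ?_⟩
  ext w
  simp [BB, mem_PW]

theorem card_BB_right (b : ℕ) : (BB 0 b).card = 1 := by
  rw [Finset.card_eq_one]
  refine ⟨List.replicate b 1, ?_⟩
  ext w
  simp [BB, mem_PW]

theorem card_BB (a b : ℕ) : (BB a b).card = (a+b).choose b := by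
  induction a generalizing b with
  | zero => simp [card_BB_right]
  | succ a iha =>
    induction b with
    | zero => simp [card_BB_left]
    | succ b ihb =>
      rw [BB_succ_succ, Finset.card_union_of_disjoint, Finset.card_image_of_injective _ List.cons_injective,
        Finset.card_image_of_injective _ List.cons_injective, ihb, iha]
      · have : a + 1 + (b+1) = (a + (b + 1)) + 1 := by ring
        rw [this, Nat.choose_succ_succ, add_comm]
        congr 2; ring
      · rw [Finset.disjoint_left]
        intro w h1 h2
        simp at h1 h2
        obtain ⟨u, _, rfl⟩ := h1
        simp at h2

theorem rotate_mul_fix {w : List ℕ} {i : ℕ} (h : w.rotate i = w) (k : ℕ) : w.rotate (k * i) = w := by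
  induction k with
  | zero => simp
  | succ k ih => rw [Nat.succ_mul, ← List.rotate_rotate, ih, h]

theorem rotate_gcd_fix {w : List ℕ} {i : ℕ} (h : w.rotate i = w) : w.rotate (Nat.gcd w.length i) = w := by
  rcases Nat.eq_zero_or_pos w.length with h0 | h0
  · rw [List.length_eq_zero_iff] at h0; subst h0; simp
  obtain ⟨k, hk⟩ : ∃ k, k * i % w.length = Nat.gcd w.length i % w.length := by
    have := Nat.gcd_eq_gcd_ab w.length i
    refine ⟨(Nat.gcdB w.length i % w.length).toNat, ?_⟩
    have hl : (w.length : ℤ) ≠ 0 := by exact_mod_cast h0.ne'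
    zify
    rw [Int.toNat_of_nonneg (Int.emod_nonneg _ hl), this]
    rw [Int.mul_emod, Int.emod_emod_of_dvd _ dvd_rfl, ← Int.mul_emod]
    rw [mul_comm, Int.add_emod]; simp
  rw [← List.rotate_mod, ← hk, List.rotate_mod]
  exact rotate_mul_fix h k

theorem comm_flatten (v : List ℕ) (k : ℕ) : ∀ r : List ℕ, v ++ r = r ++ v → r.length = k * v.length →
    r = (List.replicate k v).flatten := by
  induction k with
  | zero => intro r _ h; simpa using h
  | succ k ih =>
    intro r h hl
    have h1 : v <+: r := by
      have a1 : v <+: r ++ v := ⟨r, h⟩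
      have a2 : r <+: r ++ v := ⟨v, rfl⟩
      exact List.prefix_of_prefix_length_le a1 a2 (by rw [hl]; nlinarith)
    obtain ⟨r', rfl⟩ := h1
    rw [List.append_assoc, List.append_right_inj] at h
    rw [List.replicate_succ, List.flatten_cons, ← ih r' h]
    simp at hl
    nlinarith

theorem fix_flatten {w : List ℕ} {e d : ℕ} (h : w.rotate e = w) (hd : 1 ≤ d) (hl : w.length = d * e) :
    w = (List.replicate d (w.take e)).flatten := by
  obtain ⟨k, rfl⟩ : ∃ k, d = k + 1 := ⟨d-1, by omega⟩
  have he : e ≤ w.length := by rw [hl]; nlinarith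
  rw [List.rotate_eq_drop_append_take he] at h
  have h2 := comm_flatten (w.take e) k (w.drop e) (by rw [h, List.take_append_drop]) (by
    rw [List.length_drop, List.length_take, min_eq_left he, hl, Nat.succ_mul]; omega)
  rw [List.replicate_succ, List.flatten_cons, ← h2, List.take_append_drop]

theorem fixcard (a b d e t : ℕ) (hd : 1 ≤ d) (hl : a + b = d * e) (ht : t = a ∨ t = b) :
    ((BB a b).filter fun w => w.rotate e = w).card ≤
      if d ∣ t then ((a+b)/d).choose (t/d) else 0 := by
  have key : ∀ w ∈ (BB a b).filter (fun w => w.rotate e = w), 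
      w = (List.replicate d (w.take e)).flatten ∧ a = d * (w.take e).count 0 ∧ b = d * (w.take e).count 1 := by
    intro w hw
    rw [Finset.mem_filter] at hw
    have h1 := fix_flatten hw.2 hd (by rw [length_BB hw.1, hl])
    have h2 := mem_BB.mp hw.1
    refine ⟨h1, ?_, ?_⟩
    · rw [← h2.2.1]; conv_lhs => rw [h1]
      simp [List.count_flatten]
    · rw [← h2.2.2]; conv_lhs => rw [h1]
      simp [List.count_flatten]
  rcases Finset.eq_empty_or_nonempty ((BB a b).filter (fun w => w.rotate e = w)) with h0 | ⟨w0, hw0⟩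
  · rw [h0]; simp
  have hw0' := key w0 hw0
  have hda : d ∣ a := ⟨_, hw0'.2.1⟩
  have hdb : d ∣ b := ⟨_, hw0'.2.2⟩
  have hdt : d ∣ t := by rcases ht with rfl | rfl <;> assumption
  rw [if_pos hdt]
  have hle : ((BB a b).filter fun w => w.rotate e = w).card ≤ (BB (a/d) (b/d)).card := by
    apply Finset.card_le_card_of_injOn (fun w => w.take e)
    · intro w hw
      have hk := key w hw
      rw [Finset.mem_coe, Finset.mem_filter] at hw
      have h2 := mem_BB.mp hw.1
      simp only [Finset.mem_coe, mem_BB]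
      refine ⟨fun x hx => h2.1 x (List.mem_of_mem_take hx), ?_, ?_⟩
      · symm; apply Nat.div_eq_of_eq_mul_right (by omega) hk.2.1
      · symm; apply Nat.div_eq_of_eq_mul_right (by omega) hk.2.2
    · intro w hw w' hw' h
      rw [(key w hw).1, (key w' hw').1]
      simp only at h
      rw [h]
  refine hle.trans ?_
  rw [card_BB, ← Nat.add_div_of_dvd_right hda]
  rcases ht with rfl | rfl
  · have := Nat.add_div_of_dvd_right (c := d) (b := b) hda
    rw [this]
    rw [← Nat.choose_symm_add]
  · exact le_rfl

theorem sumJ (a b t : ℕ) (ht : t = a ∨ t = b) (ht1 : 1 ≤ t) :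
    ∑ w ∈ BB a b, JJ w ≤ DD (a+b) t := by
  set n := a + b with hn
  have hn0 : 0 < n := by omega
  have h1 : ∑ w ∈ BB a b, JJ w = ∑ i ∈ Finset.Ico 1 n, ((BB a b).filter fun w => w.rotate i = w).card := by
    simp only [Finset.card_filter]
    rw [Finset.sum_comm]
    apply Finset.sum_congr rfl
    intro w hw
    rw [JJ, length_BB hw, Finset.card_filter]
  rw [h1]
  calc _ ≤ ∑ i ∈ Finset.Ico 1 n, (fun d => if d ∣ t then (n/d).choose (t/d) else 0) (n / Nat.gcd n i) := by
        apply Finset.sum_le_sum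
        intro i hi
        have hg : Nat.gcd n i ∣ n := Nat.gcd_dvd_left n i
        refine le_trans (Finset.card_le_card ?_) (fixcard a b (n / Nat.gcd n i) (Nat.gcd n i) t 
          (Nat.div_pos (Nat.le_of_dvd hn0 hg) (Nat.gcd_pos_of_pos_left _ hn0)) (Nat.div_mul_cancel hg).symm ht)
        intro w hw
        simp only [Finset.mem_filter] at hw ⊢
        refine ⟨hw.1, ?_⟩
        have := rotate_gcd_fix hw.2
        rwa [length_BB hw.1] at this
    _ = ∑ d ∈ n.divisors.erase 1, ∑ i ∈ (Finset.Ico 1 n).filter (fun i => n / Nat.gcd n i = d), 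
          (fun d => if d ∣ t then (n/d).choose (t/d) else 0) (n / Nat.gcd n i) := by
        rw [Finset.sum_fiberwise_of_maps_to]
        intro i hi
        have hg : Nat.gcd n i ∣ n := Nat.gcd_dvd_left n i
        simp only [Finset.mem_Ico] at hi
        simp only [Finset.mem_erase, Nat.mem_divisors]
        refine ⟨?_, Nat.div_dvd_of_dvd hg, hn0.ne'⟩
        intro h
        have h2 := Nat.div_mul_cancel hg
        rw [h, one_mul] at h2
        have := Nat.le_of_dvd (by omega) (Nat.gcd_dvd_right n i)
        omega
    _ ≤ ∑ d ∈ n.divisors.erase 1, d.totient * (if d ∣ t then (n/d).choose (t/d) else 0) := by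
        apply Finset.sum_le_sum
        intro d hd
        rw [Finset.sum_congr rfl (g := fun _ => if d ∣ t then (n/d).choose (t/d) else 0)]
        · rw [Finset.sum_const, smul_eq_mul]
          apply Nat.mul_le_mul_right
          simp only [Finset.mem_erase, Nat.mem_divisors] at hd
          have h3 := Nat.totient_div_of_dvd (n := n) (d := n / d) (Nat.div_dvd_of_dvd hd.2.1)
          rw [Nat.div_div_self hd.2.1 hn0.ne'] at h3
          rw [h3]
          apply Finset.card_le_card
          intro i hi
          simp only [Finset.mem_filter, Finset.mem_Ico, Finset.mem_range] at hi ⊢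
          refine ⟨hi.1.2, ?_⟩
          rw [← hi.2, Nat.div_div_self (Nat.gcd_dvd_left n i) hn0.ne']
        · intro i hi
          simp only [Finset.mem_filter] at hi
          simp only [hi.2]
    _ ≤ _ := by
        unfold DD
        simp only [mul_ite, mul_zero]
        rw [← Finset.sum_filter, ← Finset.sum_filter]
        apply Finset.sum_le_sum_of_subset
        intro d hd
        simp only [Finset.mem_filter, Finset.mem_erase, Nat.mem_divisors] at hd ⊢
        exact ⟨⟨hd.1.1, hd.2, by omega⟩, hd.1.2.1⟩

open Classical in
theorem nonprim_card (a b t : ℕ) (ht : t = a ∨ t = b) (ht1 : 1 ≤ t) :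
    ((BB a b).filter fun w => ¬ Prim w).card ≤ TT (a+b) t := by
  set n := a + b with hn
  have hn0 : 0 < n := by omega
  have hsub : ((BB a b).filter fun w => ¬ Prim w) ⊆ 
      n.primeFactors.biUnion (fun p => (BB a b).filter fun w => w.rotate (n/p) = w) := by
    intro w hw
    simp only [Finset.mem_filter, Finset.mem_biUnion] at hw ⊢
    obtain ⟨hw, hp⟩ := hw
    have hl := length_BB hw
    unfold Prim at hp
    push Not at hp
    obtain ⟨i, hi0, hin, hi⟩ := hp
    have h1 := rotate_gcd_fix hi
    rw [hl, ← hn] at h1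
    have hg : Nat.gcd n i ∣ n := Nat.gcd_dvd_left n i
    have h2 := Nat.div_mul_cancel hg
    have hne : n / Nat.gcd n i ≠ 1 := by
      intro h
      rw [h, one_mul] at h2
      have := Nat.le_of_dvd (by omega) (Nat.gcd_dvd_right n i)
      omega
    obtain ⟨p, hp, hpd⟩ := Nat.exists_prime_and_dvd hne
    refine ⟨p, ?_, hw, ?_⟩
    · simp only [Nat.mem_primeFactors]
      exact ⟨hp, hpd.trans (Nat.div_dvd_of_dvd hg), hn0.ne'⟩
    · obtain ⟨q, hq⟩ := hpd
      have : n / p = q * Nat.gcd n i := by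
        apply Nat.div_eq_of_eq_mul_right hp.pos
        rw [← mul_assoc, ← hq, h2]
      rw [this]
      exact rotate_mul_fix h1 q
  refine (Finset.card_le_card hsub).trans (Finset.card_biUnion_le.trans ?_)
  calc _ ≤ ∑ p ∈ n.primeFactors, if p ∣ t then (n/p).choose (t/p) else 0 := by
        apply Finset.sum_le_sum
        intro p hp
        rw [Nat.mem_primeFactors] at hp
        exact fixcard a b p (n/p) t hp.1.pos (Nat.mul_div_cancel' hp.2.1).symm ht
    _ ≤ _ := by
        unfold TT
        rw [← Finset.sum_filter, ← Finset.sum_filter]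
        apply Finset.sum_le_sum_of_subset
        intro d hd
        simp only [Finset.mem_filter, Nat.mem_primeFactors] at hd ⊢
        exact ⟨⟨hd.1.1, hd.2, by omega⟩, hd.1.2.1⟩

open Classical in
theorem tail_card (a b : ℕ) (ha : 1 ≤ a) (hb : 1 ≤ b) :
    ((BB a b).filter fun w => ¬ Prim w.tail).card ≤ ((BB (a-1) b).filter fun w => ¬ Prim w).card + 
      ((BB a (b-1)).filter fun w => ¬ Prim w).card := by
  obtain ⟨a, rfl⟩ : ∃ k, a = k + 1 := ⟨a-1, by omega⟩
  obtain ⟨b, rfl⟩ : ∃ k, b = k + 1 := ⟨b-1, by omega⟩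
  rw [BB_succ_succ, Finset.filter_union]
  refine (Finset.card_union_le _ _).trans ?_
  simp only [Finset.filter_image, List.tail_cons]
  exact Nat.add_le_add Finset.card_image_le Finset.card_image_le

open Classical in
theorem binary (a b : ℕ) (ha : 1 ≤ a) (hb : 1 ≤ b) :
    ∑ s ∈ BB a b, ((a+b-1) * JJ s + (a+b) * (if Prim s.tail then 0 else 1)) ≤ (BB a b).card := by
  have h1 : ∑ s ∈ BB a b, ((a+b-1) * JJ s + (a+b) * (if Prim s.tail then 0 else 1)) ≤
      (a+b-1) * ∑ s ∈ BB a b, JJ s + (a+b) * (((BB (a-1) b).filter fun w => ¬ Prim w).card + 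
      ((BB a (b-1)).filter fun w => ¬ Prim w).card) := by
    rw [Finset.sum_add_distrib, ← Finset.mul_sum, ← Finset.mul_sum]
    gcongr
    refine le_trans (le_of_eq ?_) (tail_card a b ha hb)
    rw [Finset.card_filter]
    apply Finset.sum_congr rfl
    intro s _
    by_cases h : Prim s.tail <;> simp [h]
  refine h1.trans ?_
  rcases le_total b a with hab | hab
  · have e1 := sumJ a b b (Or.inr rfl) hb
    have e2 := nonprim_card (a-1) b b (Or.inr rfl) hb
    rw [show a - 1 + b = a + b - 1 by omega] at e2
    rw [card_BB]
    rcases Nat.lt_or_ge b 2 with hb2 | hb2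
    · obtain rfl : b = 1 := by omega
      have e3 : ((BB a (1-1)).filter fun w => ¬ Prim w).card ≤ 1 := 
        (Finset.card_filter_le _ _).trans (by simp [card_BB_left])
      rw [TT1] at e2
      have e4 : DD (a+1) 1 = 0 := by simp [DD]
      rw [e4] at e1
      have e5 : ∑ w ∈ BB a 1, JJ w = 0 := by omega
      rw [e5]
      simp only [Nat.choose_one_right]
      nlinarith
    · have e3 := nonprim_card a (b-1) (b-1) (Or.inr rfl) (by omega)
      rw [show a + (b-1) = a + b - 1 by omega] at e3
      refine le_trans ?_ (num_all (a+b) b hb2 (by omega))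
      gcongr
  · have e1 := sumJ a b a (Or.inl rfl) ha
    have e2 := nonprim_card a (b-1) a (Or.inl rfl) ha
    rw [show a + (b-1) = a + b - 1 by omega] at e2
    rw [card_BB, ← Nat.choose_symm_add]
    rcases Nat.lt_or_ge a 2 with hb2 | hb2
    · obtain rfl : a = 1 := by omega
      have e3 : ((BB (1-1) b).filter fun w => ¬ Prim w).card ≤ 1 := 
        (Finset.card_filter_le _ _).trans (by simp [card_BB_right])
      rw [TT1] at e2
      have e4 : DD (1+b) 1 = 0 := by simp [DD]
      rw [e4] at e1
      have e5 : ∑ w ∈ BB 1 b, JJ w = 0 := by omega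
      rw [e5]
      simp only [Nat.choose_one_right]
      nlinarith
    · have e3 := nonprim_card (a-1) b (a-1) (Or.inl rfl) (by omega)
      rw [show a - 1 + b = a + b - 1 by omega] at e3
      refine le_trans ?_ (num_all (a+b) a hb2 (by omega))
      rw [add_comm (Finset.card _)]
      gcongr

def cf (x : ℕ) : ℕ := if x = 0 then 0 else 1

def fib (w0 s : List ℕ) : Finset (List ℕ) := (PW w0).filter fun w => w.map cf = s

theorem reindex {s s' : List ℕ} (h : s.Perm s') : ∃ φ : List ℕ → List ℕ, 
    (∀ w, w.map cf = s → (φ w).map cf = s' ∧ (φ w).Perm w) ∧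
    (∀ w w', w.map cf = s → w'.map cf = s → φ w = φ w' → w = w') := by
  induction h with
  | nil => exact ⟨id, fun w h => ⟨h, List.Perm.refl _⟩, fun w w' _ _ h => h⟩
  | cons x h ih =>
    obtain ⟨φ, h1, h2⟩ := ih
    refine ⟨fun w => match w with | [] => [] | y :: t => y :: φ t, ?_, ?_⟩
    · intro w hw
      rcases w with _ | ⟨y, t⟩
      · simp at hw
      · simp at hw
        simp only [List.map_cons, hw.1, (h1 t hw.2).1, true_and]
        exact (h1 t hw.2).2.cons _
    · intro w w' hw hw' h
      rcases w with _ | ⟨y, t⟩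
      · simp at hw
      rcases w' with _ | ⟨y', t'⟩
      · simp at hw'
      simp at hw hw' h
      rw [h.1, h2 t t' hw.2 hw'.2 h.2]
  | swap x y l =>
    refine ⟨fun w => match w with | a :: b :: t => b :: a :: t | _ => [], ?_, ?_⟩
    · intro w hw
      rcases w with _ | ⟨a, _ | ⟨b, t⟩⟩
      · simp at hw
      · simp at hw
      · simp at hw
        simp only [List.map_cons, hw, true_and]
        exact List.Perm.swap _ _ _
    · intro w w' hw hw' h
      rcases w with _ | ⟨a, _ | ⟨b, t⟩⟩
      · simp at hw
      · simp at hw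
      rcases w' with _ | ⟨a', _ | ⟨b', t'⟩⟩
      · simp at hw'
      · simp at hw'
      simp at h ⊢
      tauto
  | trans _ _ ih1 ih2 =>
    obtain ⟨φ, h1, h2⟩ := ih1
    obtain ⟨ψ, h3, h4⟩ := ih2
    refine ⟨ψ ∘ φ, fun w hw => ⟨(h3 _ (h1 w hw).1).1, (h3 _ (h1 w hw).1).2.trans (h1 w hw).2⟩, ?_⟩
    intro w w' hw hw' h
    exact h2 w w' hw hw' (h4 _ _ (h1 w hw).1 (h1 w' hw').1 h)

theorem fib_card_le {w0 s s' : List ℕ} (h : s.Perm s') : (fib w0 s).card ≤ (fib w0 s').card := by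
  obtain ⟨φ, h1, h2⟩ := reindex h
  apply Finset.card_le_card_of_injOn φ
  · intro w hw
    simp only [fib, Finset.mem_coe, Finset.mem_filter, mem_PW] at hw ⊢
    exact ⟨(h1 w hw.2).2.trans hw.1, (h1 w hw.2).1⟩
  · intro w hw w' hw' h
    simp only [fib, Finset.mem_coe, Finset.mem_filter, mem_PW] at hw hw'
    exact h2 w w' hw.2 hw'.2 h

theorem JJ_map (w : List ℕ) : JJ w ≤ JJ (w.map cf) := by
  unfold JJ
  apply Finset.card_le_card
  intro i hi
  simp only [Finset.mem_filter, List.length_map] at hi ⊢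
  exact ⟨hi.1, by rw [← List.map_rotate, hi.2]⟩

theorem Prim_map (w : List ℕ) (h : Prim (w.map cf).tail) : Prim w.tail := by
  intro i h0 h1 h2
  rw [← List.map_tail] at h
  exact h i h0 (by simpa using h1) (by rw [← List.map_rotate, h2])

theorem map_cf_perm (w0 : List ℕ) : w0.map cf ∈ BB (w0.count 0) (w0.length - w0.count 0) := by
  induction w0 with
  | nil => simp [mem_BB]
  | cons x t ih =>
    have hle : t.count 0 ≤ t.length := List.count_le_length
    by_cases hx : x = 0
    · subst hx
      rw [List.map_cons, show cf 0 = 0 from rfl, cons_zero_mem_BB]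
      simpa using ih
    · rw [List.map_cons, show cf x = 1 by simp [cf, hx], cons_one_mem_BB]
      rw [List.count_cons_of_ne hx]
      simp
      refine ⟨by omega, ?_⟩
      rwa [show t.length + 1 - t.count 0 - 1 = t.length - t.count 0 by omega]

open Classical in
theorem words_ineq (w0 : List ℕ) (n : ℕ) (hn : w0.length = n) (h0 : 1 ≤ w0.count 0) (h1 : w0.count 0 < n) :
    (n-1) * ∑ w ∈ PW w0, JJ w + n * ((PW w0).filter fun w => ¬ Prim w.tail).card ≤ (PW w0).card := by
  set a := w0.count 0 with ha
  obtain ⟨b, hb⟩ : ∃ b, b = n - a := ⟨_, rfl⟩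
  have hab : a + b = n := by omega
  have hbin := binary a b h0 (by omega)
  rw [hab] at hbin
  let g : List ℕ → ℕ := fun s => (n-1) * JJ s + n * (if Prim s.tail then 0 else 1)
  have hs0 := map_cf_perm w0
  rw [hn, ← ha, ← hb] at hs0
  have hBB : BB a b = PW (w0.map cf) := by
    ext s
    rw [BB, mem_PW, mem_PW]
    rw [BB, mem_PW] at hs0
    exact ⟨fun h => h.trans hs0.symm, fun h => h.trans hs0⟩
  have hmaps : ∀ w ∈ PW w0, w.map cf ∈ BB a b := by
    intro w hw
    rw [hBB, mem_PW]
    exact (mem_PW.mp hw).map cf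
  set K := (fib w0 (w0.map cf)).card with hK
  have hfib : ∀ s ∈ BB a b, (fib w0 s).card = K := by
    intro s hs
    rw [hBB, mem_PW] at hs
    exact le_antisymm (fib_card_le hs) (fib_card_le hs.symm)
  have hcard : (PW w0).card = (BB a b).card * K := by
    rw [Finset.card_eq_sum_card_fiberwise hmaps]
    rw [Finset.sum_congr rfl (g := fun _ => K)]
    · simp
    · intro s hs; exact hfib s hs
  have hsum : ∑ w ∈ PW w0, g (w.map cf) = (∑ s ∈ BB a b, g s) * K := by
    rw [← Finset.sum_fiberwise_of_maps_to hmaps, Finset.sum_mul]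
    apply Finset.sum_congr rfl
    intro s hs
    rw [Finset.sum_congr rfl (g := fun _ => g s)]
    · rw [Finset.sum_const, smul_eq_mul, mul_comm]
      congr 1
      exact hfib s hs
    · intro w hw
      rw [(Finset.mem_filter.mp hw).2]
  calc _ = ∑ w ∈ PW w0, g w := by
        rw [Finset.sum_add_distrib, ← Finset.mul_sum, ← Finset.mul_sum, Finset.card_filter]
        congr 2
        apply Finset.sum_congr rfl
        intro s _
        by_cases h : Prim s.tail <;> simp [h]
    _ ≤ ∑ w ∈ PW w0, g (w.map cf) := by
        apply Finset.sum_le_sum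
        intro w _
        simp only [g]
        gcongr
        · exact JJ_map w
        · by_cases h : Prim (w.map cf).tail
          · simp [h, Prim_map w h]
          · simp only [h, if_false]; split_ifs <;> simp
    _ ≤ _ := by
        rw [hsum, hcard]
        exact Nat.mul_le_mul_right _ hbin

/-! necklaces -/

open Classical in
theorem necklace_count (w0 : List ℕ) (n : ℕ) (hn : w0.length = n) (hn1 : 1 ≤ n) :
    n * ((PW w0).filter IsNecklace).card ≤ (PW w0).card + ∑ w ∈ PW w0, JJ w := by
  have hlen : ∀ w ∈ PW w0, w.length = n := fun w hw => by rw [(mem_PW.mp hw).length_eq, hn]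
  have hmaps : ∀ x ∈ ((PW w0).filter IsNecklace) ×ˢ Finset.range n, x.1.rotate x.2 ∈ PW w0 := by
    intro x hx
    simp only [Finset.mem_product, Finset.mem_filter, mem_PW] at hx ⊢
    exact (List.rotate_perm _ _).trans hx.1.1
  have h1 : n * ((PW w0).filter IsNecklace).card = 
      (((PW w0).filter IsNecklace) ×ˢ Finset.range n).card := by
    rw [Finset.card_product, Finset.card_range, mul_comm]
  rw [h1, Finset.card_eq_sum_card_fiberwise hmaps, Finset.card_eq_sum_ones, ← Finset.sum_add_distrib]
  apply Finset.sum_le_sum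
  intro w hw
  have hJ : 1 + JJ w = ((Finset.range n).filter fun i => w.rotate i = w).card := by
    have : (Finset.range n).filter (fun i => w.rotate i = w) = 
        insert 0 ((Finset.Ico 1 n).filter fun i => w.rotate i = w) := by
      ext i
      simp only [Finset.mem_filter, Finset.mem_range, Finset.mem_insert, Finset.mem_Ico]
      constructor
      · rintro ⟨a, b⟩
        by_cases h : i = 0
        · exact Or.inl h
        · exact Or.inr ⟨⟨by omega, a⟩, b⟩
      · rintro (rfl | ⟨a, b⟩)
        · exact ⟨by omega, by simp⟩
        · exact ⟨a.2, b⟩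
    rw [this, Finset.card_insert_of_notMem (by simp), JJ, hlen w hw, add_comm]
  rw [hJ]
  set F := (((PW w0).filter IsNecklace) ×ˢ Finset.range n).filter (fun x => x.1.rotate x.2 = w)
  rcases Finset.eq_empty_or_nonempty F with h0 | ⟨⟨v, i0⟩, hv⟩
  · rw [h0]; simp
  simp only [F, Finset.mem_filter, Finset.mem_product, Finset.mem_range] at hv
  have hvu : ∀ x ∈ F, x.1 = v ∧ x.2 < n ∧ x.1.rotate x.2 = w := by
    intro x hx
    simp only [F, Finset.mem_filter, Finset.mem_product, Finset.mem_range] at hx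
    refine ⟨?_, hx.1.2, hx.2⟩
    have back : ∀ (y : List ℕ) (i : ℕ), y ∈ PW w0 → i < n → y.rotate i = w → y = w.rotate (n - i) := by
      intro y i hy hi h
      rw [← h, List.rotate_rotate, show i + (n-i) = y.length by rw [hlen y hy]; omega, List.rotate_length]
    have b1 := back x.1 x.2 hx.1.1.1 hx.1.2 hx.2
    have b2 := back v i0 hv.1.1.1 hv.1.2 hv.2
    apply le_antisymm
    · have := hx.1.1.2 (x.2 + (n - i0))
      rwa [← List.rotate_rotate, hx.2, ← b2] at this
    · have := hv.1.1.2 (i0 + (n - x.2))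
      rwa [← List.rotate_rotate, hv.2, ← b1] at this
  apply Finset.card_le_card_of_injOn (fun x => (x.2 + (n - i0)) % n)
  · intro x hx
    obtain ⟨e1, e2, e3⟩ := hvu x hx
    simp only [Finset.mem_coe, Finset.mem_filter, Finset.mem_range]
    refine ⟨Nat.mod_lt _ (by omega), ?_⟩
    have hl := hlen w hw
    conv_lhs => rw [← hl, List.rotate_mod, hl]
    rw [← hv.2, List.rotate_rotate, show i0 + (x.2 + (n - i0)) = v.length + x.2 by
      rw [hlen v hv.1.1.1]; omega, ← List.rotate_rotate, List.rotate_length, hv.2, ← e1, e3]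
  · intro x hx y hy hxy
    obtain ⟨e1, e2, e3⟩ := hvu x hx
    obtain ⟨f1, f2, f3⟩ := hvu y hy
    simp only at hxy
    have h3 : x.2 ≡ y.2 [MOD n] := Nat.ModEq.add_right_cancel' (n - i0) hxy
    have h4 := Nat.ModEq.eq_of_lt_of_lt h3 e2 f2
    exact Prod.ext (e1.trans f1.symm) h4

open Classical in
theorem lyndon_count (w0 : List ℕ) (m : ℕ) (hm : w0.length = m) (hm1 : 1 ≤ m) :
    ((PW w0).filter Prim).card ≤ m * ((PW w0).filter IsLyndon).card := by
  have hlen : ∀ w ∈ PW w0, w.length = m := fun w hw => by rw [(mem_PW.mp hw).length_eq, hm]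
  have hsub : (PW w0).filter Prim ⊆ 
      (Finset.range m ×ˢ ((PW w0).filter IsLyndon)).image (fun x => x.2.rotate x.1) := by
    intro u hu
    rw [Finset.mem_filter] at hu
    obtain ⟨hu, hp⟩ := hu
    have hl := hlen u hu
    obtain ⟨t, ht, hmin⟩ := Finset.exists_min_image (Finset.range m) (fun i => u.rotate i) ⟨0, by simp; omega⟩
    rw [Finset.mem_range] at ht
    rw [Finset.mem_image]
    refine ⟨((m - t) % m, u.rotate t), ?_, ?_⟩
    · rw [Finset.mem_product, Finset.mem_range, Finset.mem_filter, mem_PW]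
      refine ⟨Nat.mod_lt _ (by omega), (List.rotate_perm _ _).trans (mem_PW.mp hu), ?_, ?_⟩
      · intro h
        have := congrArg List.length h
        simp at this
        rw [this] at hl
        simp at hl
        omega
      · intro i hi0 hil
        rw [List.length_rotate, hl] at hil
        rw [List.rotate_rotate]
        apply lt_of_le_of_ne
        · have := hmin ((t+i) % m) (Finset.mem_range.mpr (Nat.mod_lt _ (by omega)))
          rwa [← hl, List.rotate_mod] at this
        · intro h
          apply hp i hi0 (by omega)
          rw [add_comm, ← List.rotate_rotate] at h
          exact (List.rotate_injective t h).symm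
    · have e : (u.rotate t).length = m := by simp [hl]
      simp only
      conv_lhs => rw [← e, List.rotate_mod, e]
      rw [List.rotate_rotate, show t + (m - t) = u.length by omega, List.rotate_length]
  refine (Finset.card_le_card hsub).trans (Finset.card_image_le.trans ?_)
  rw [Finset.card_product, Finset.card_range]

theorem lt_append_iff : ∀ (r q t p : List ℕ), r.length = q.length →
    (r ++ t < q ++ p ↔ r < q ∨ (r = q ∧ t < p)) := by
  intro r
  induction r with
  | nil =>
    intro q t p h
    have : q = [] := by
      rw [← List.length_eq_zero_iff]; simpa using h.symm
    subst this
    simp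
  | cons x r ih =>
    intro q t p h
    rcases q with _ | ⟨y, q⟩
    · simp at h
    · simp only [List.length_cons, Nat.add_right_cancel_iff] at h
      simp only [List.cons_append, List.cons_lt_cons_iff, ih q t p h, List.cons.injEq]
      tauto

theorem lyndon_head {x : List ℕ} (h : IsLyndon x) (h0 : 0 ∈ x) : ∃ t, x = 0 :: t := by
  obtain ⟨p, q, rfl⟩ := List.append_of_mem h0
  rcases p with _ | ⟨y, p⟩
  · exact ⟨q, rfl⟩
  · have h1 := h.2 (y :: p).length (by simp) (by simp)
    rw [List.rotate_append_length_eq] at h1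
    simp only [List.cons_append, List.cons_lt_cons_iff] at h1
    have : y = 0 := by omega
    subst this
    exact ⟨_, rfl⟩

theorem lyndon_snoc {x : List ℕ} (h : IsLyndon x) (h0 : 0 ∈ x) {b : ℕ} (hb : 1 ≤ b) :
    IsNecklace (x ++ [b]) := by
  intro i
  rw [← List.rotate_mod]
  have hi : i % (x ++ [b]).length < (x ++ [b]).length := Nat.mod_lt _ (by simp)
  generalize i % (x ++ [b]).length = j at hi
  rcases Nat.eq_zero_or_pos j with rfl | hj
  · simp
  simp at hi
  apply le_of_lt
  rcases Nat.lt_or_ge j x.length with hjx | hjx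
  · obtain ⟨p, hp⟩ : ∃ p, p = x.take j := ⟨_, rfl⟩
    obtain ⟨q, hq⟩ : ∃ q, q = x.drop j := ⟨_, rfl⟩
    have hx : x = p ++ q := by rw [hp, hq, List.take_append_drop]
    have hpl : p.length = j := by rw [hp, List.length_take]; omega
    have hql : q.length = x.length - j := by rw [hq, List.length_drop]
    have e1 : (x ++ [b]).rotate j = q ++ ([b] ++ p) := by
      rw [hx, ← hpl, List.append_assoc, List.rotate_append_length_eq, List.append_assoc]
    have e2 : x.rotate j = q ++ p := by
      rw [hx, ← hpl, List.rotate_append_length_eq]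
    have h1 := h.2 j hj hjx
    rw [e2] at h1
    obtain ⟨r, hr⟩ : ∃ r, r = x.take q.length := ⟨_, rfl⟩
    obtain ⟨t, ht⟩ : ∃ t, t = x.drop q.length := ⟨_, rfl⟩
    have hx2 : x = r ++ t := by rw [hr, ht, List.take_append_drop]
    have hrl : r.length = q.length := by rw [hr, List.length_take]; omega
    have htl : t.length = p.length := by rw [ht, List.length_drop]; omega
    rw [e1]
    have h2 : r ++ t < q ++ p := hx2 ▸ h1
    rw [lt_append_iff r q t p hrl] at h2
    rw [hx2, List.append_assoc, lt_append_iff r q _ _ hrl]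
    rcases h2 with h2 | ⟨h2, h3⟩
    · exact Or.inl h2
    · exfalso
      have h4 := h.2 q.length (by omega) (by omega)
      have e3 : x.rotate q.length = t ++ q := by
        rw [hx2, ← hrl, List.rotate_append_length_eq, h2]
      rw [e3] at h4
      have h5 : t ++ q < p ++ q := (lt_append_iff t p q q htl).mpr (Or.inl h3)
      rw [← hx] at h5
      exact lt_asymm h4 h5
  · have : j = x.length := by omega
    rw [this, List.rotate_append_length_eq]
    obtain ⟨t, rfl⟩ := lyndon_head h h0
    simp only [List.cons_append, List.nil_append, List.cons_lt_cons_iff]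
    left; omega

def Con (k : ℕ) (c : Fin k → ℕ) (w : List ℕ) : Prop :=
  (∀ a ∈ w, a < k) ∧ ∀ i : Fin k, w.count i.val = c i

theorem Con_iff {k : ℕ} {c : Fin k → ℕ} {w0 : List ℕ} (h0 : Con k c w0) (w : List ℕ) :
    Con k c w ↔ w ∈ PW w0 := by
  rw [mem_PW]
  constructor
  · intro h
    rw [List.perm_iff_count]
    intro x
    by_cases hx : x < k
    · rw [h.2 ⟨x, hx⟩, h0.2 ⟨x, hx⟩]
    · rw [List.count_eq_zero_of_not_mem (fun hm => hx (h.1 x hm)),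
        List.count_eq_zero_of_not_mem (fun hm => hx (h0.1 x hm))]
  · intro h
    exact ⟨fun a ha => h0.1 a (h.subset ha), fun i => by rw [h.count_eq, h0.2 i]⟩

theorem exists_Con (k : ℕ) (c : Fin k → ℕ) : ∃ w, Con k c w := by
  refine ⟨(List.finRange k).flatMap (fun i => List.replicate (c i) i.val), ?_, ?_⟩
  · intro a ha
    simp at ha
    obtain ⟨i, h, rfl⟩ := ha
    exact i.2
  · intro i
    rw [List.count_flatMap]
    have : (List.count i.val ∘ fun j : Fin k => List.replicate (c j) j.val) = 
        fun j => if j = i then c i else 0 := by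
      funext j
      simp only [Function.comp, List.count_replicate]
      by_cases h : j = i
      · simp [h]
      · simp [h, Fin.val_inj]
    rw [this, ← List.sum_toFinset _ (List.nodup_finRange k)]
    simp

theorem Con_erase {k : ℕ} {c : Fin k → ℕ} {w0 : List ℕ} (h0 : Con k c w0) (b : Fin k) :
    Con k (Function.update c b (c b - 1)) (w0.erase b.val) := by
  refine ⟨fun a ha => h0.1 a (List.mem_of_mem_erase ha), fun i => ?_⟩
  by_cases h : i = b
  · subst h
    rw [List.count_erase_self, h0.2]; simp
  · rw [List.count_erase_of_ne (fun e => h (Fin.ext e)), h0.2]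
    simp [h]

open Classical in
theorem prim_tail_count (w0 : List ℕ) (k : ℕ) (hk : ∀ a ∈ w0, a < k) (hne : w0 ≠ []) :
    ((PW w0).filter fun w => Prim w.tail).card ≤ 
      ∑ b ∈ Finset.range k, ((PW (w0.erase b)).filter Prim).card := by
  have hsub : ((PW w0).filter fun w => Prim w.tail) ⊆ (Finset.range k).biUnion 
      (fun b => ((PW (w0.erase b)).filter Prim).image (List.cons b)) := by
    intro w hw
    rw [Finset.mem_filter, mem_PW] at hw
    rcases w with _ | ⟨b, u⟩
    · exact absurd hw.1.nil_eq.symm hne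
    · simp only [Finset.mem_biUnion, Finset.mem_image, Finset.mem_filter, mem_PW, Finset.mem_range]
      refine ⟨b, hk b (hw.1.subset (by simp)), u, ⟨?_, hw.2⟩, rfl⟩
      have := hw.1.erase b
      simpa using this
  refine (Finset.card_le_card hsub).trans (Finset.card_biUnion_le.trans ?_)
  exact Finset.sum_le_sum fun b _ => Finset.card_image_le

open Classical in
theorem stable_count (w0 : List ℕ) (k : ℕ) (h0 : 0 ∈ w0) (hmem : ∀ b < k, b ∈ w0) :
    ∑ b ∈ Finset.Ico 1 k, ((PW (w0.erase b)).filter IsLyndon).card ≤ 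
      ((PW w0).filter fun w => IsNecklace w ∧ IsLyndon w.dropLast).card := by
  have hc : ∀ b ∈ Finset.Ico 1 k, ((PW (w0.erase b)).filter IsLyndon).card = 
      (((PW (w0.erase b)).filter IsLyndon).image (fun x => x ++ [b])).card := by
    intro b _
    rw [Finset.card_image_of_injective]
    intro x y h
    exact List.append_cancel_right h
  rw [Finset.sum_congr rfl hc, ← Finset.card_biUnion]
  · apply Finset.card_le_card
    intro w hw
    simp only [Finset.mem_biUnion, Finset.mem_image, Finset.mem_filter, mem_PW, Finset.mem_Ico] at hw ⊢
    obtain ⟨b, hb, x, ⟨hx, hL⟩, rfl⟩ := hw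
    refine ⟨?_, ?_, ?_⟩
    · refine (List.perm_append_singleton b x).trans ?_
      exact (hx.cons b).trans (List.perm_cons_erase (hmem b hb.2)).symm
    · apply lyndon_snoc hL _ hb.1
      apply hx.symm.subset
      rw [List.mem_erase_of_ne (by omega)]
      exact h0
    · simpa using hL
  · intro b _ b' _ hbb
    rw [Function.onFun, Finset.disjoint_left]
    intro w h1 h2
    simp only [Finset.mem_image] at h1 h2
    obtain ⟨x, _, rfl⟩ := h1
    obtain ⟨y, _, h⟩ := h2
    apply hbb
    have := (List.append_inj' h rfl).2
    simpa using this.symm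


end UNB

open UNB

/-- The number of unstable necklaces with fixed content is at most
`L_k(n₀-1, n₁, …, n_{k-1})`. -/
theorem unstable_necklace_bound (k : ℕ) (hk : 2 ≤ k) (c : Fin k → ℕ) (hc : ∀ i, 1 ≤ c i) :
    {w : List ℕ | (∀ a ∈ w, a < k) ∧ (∀ i : Fin k, w.count i.val = c i) ∧
        IsNecklace w ∧ ¬ IsLyndon w.dropLast}.ncard ≤
      Lk k (Function.update c ⟨0, by omega⟩ (c ⟨0, by omega⟩ - 1)) := by
  classical
  obtain ⟨w0, hw0⟩ := exists_Con k c
  have hmem : ∀ b < k, b ∈ w0 := by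
    intro b hb
    have h1 := hw0.2 ⟨b, hb⟩
    have h2 := hc ⟨b, hb⟩
    apply List.count_pos_iff.mp
    simp only at h1
    omega
  obtain ⟨n, hn⟩ : ∃ n, w0.length = n := ⟨_, rfl⟩
  have hc0 : 1 ≤ w0.count 0 := List.count_pos_iff.mpr (hmem 0 (by omega))
  have hc1 : w0.count 0 < n := by
    rw [← hn]
    apply lt_of_le_of_ne List.count_le_length
    intro h
    rw [List.count_eq_length] at h
    exact absurd (h 1 (hmem 1 (by omega))) (by norm_num)
  have hU : {w : List ℕ | (∀ a ∈ w, a < k) ∧ (∀ i : Fin k, w.count i.val = c i) ∧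
        IsNecklace w ∧ ¬ IsLyndon w.dropLast} = 
      (((PW w0).filter fun w => IsNecklace w ∧ ¬ IsLyndon w.dropLast : Finset (List ℕ)) : Set (List ℕ)) := by
    ext w
    rw [Finset.mem_coe, Finset.mem_filter, ← Con_iff hw0]
    exact (and_assoc (a := ∀ a ∈ w, a < k) (b := ∀ i : Fin k, w.count i.val = c i)).symm
  have hL : Lk k (Function.update c ⟨0, by omega⟩ (c ⟨0, by omega⟩ - 1)) = 
      ((PW (w0.erase 0)).filter IsLyndon).card := by
    rw [Lk, ← Set.ncard_coe_finset]
    congr 1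
    ext w
    rw [Finset.mem_coe, Finset.mem_filter, ← Con_iff (Con_erase hw0 ⟨0, by omega⟩)]
    exact (and_assoc (a := ∀ a ∈ w, a < k)).symm
  rw [hU, hL, Set.ncard_coe_finset]
  have a1 := words_ineq w0 n hn hc0 hc1
  have a2 := necklace_count w0 n hn (by omega)
  have a3 := prim_tail_count w0 k hw0.1 (by rintro rfl; simp at hc0)
  have a4 := stable_count w0 k (hmem 0 (by omega)) hmem
  have a5 : ∑ b ∈ Finset.range k, ((PW (w0.erase b)).filter Prim).card ≤ 
      (n-1) * ∑ b ∈ Finset.range k, ((PW (w0.erase b)).filter IsLyndon).card := by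
    rw [Finset.mul_sum]
    apply Finset.sum_le_sum
    intro b hb
    apply lyndon_count
    · rw [List.length_erase_of_mem (hmem b (Finset.mem_range.mp hb)), hn]
    · omega
  have a6 : ((PW w0).filter fun w => Prim w.tail).card + ((PW w0).filter fun w => ¬ Prim w.tail).card = 
      (PW w0).card := Finset.card_filter_add_card_filter_not _
  have a7 : ((PW w0).filter fun w => IsNecklace w ∧ IsLyndon w.dropLast).card + 
      ((PW w0).filter fun w => IsNecklace w ∧ ¬ IsLyndon w.dropLast).card = 
      ((PW w0).filter IsNecklace).card := by
    rw [← Finset.filter_filter, ← Finset.filter_filter]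
    exact Finset.card_filter_add_card_filter_not _
  have a8 : ∑ b ∈ Finset.range k, ((PW (w0.erase b)).filter IsLyndon).card = 
      ((PW (w0.erase 0)).filter IsLyndon).card + 
      ∑ b ∈ Finset.Ico 1 k, ((PW (w0.erase b)).filter IsLyndon).card := by
    rw [Finset.range_eq_Ico, Finset.sum_eq_sum_Ico_succ_bot (by omega)]
  generalize ∑ b ∈ Finset.range k, ((PW (w0.erase b)).filter IsLyndon).card = LL at *
  generalize ∑ b ∈ Finset.range k, ((PW (w0.erase b)).filter Prim).card = PP at *
  generalize ∑ b ∈ Finset.Ico 1 k, ((PW (w0.erase b)).filter IsLyndon).card = L1 at *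
  generalize ((PW w0).filter IsNecklace).card = NN at *
  generalize ((PW w0).filter fun w => Prim w.tail).card = P at *
  generalize ((PW w0).filter fun w => ¬ Prim w.tail).card = T at *
  generalize (PW w0).card = W at *
  generalize ∑ w ∈ PW w0, JJ w = E at *
  have key : NN ≤ LL := by
    obtain ⟨m, rfl⟩ : ∃ m, n = m + 2 := ⟨n-2, by omega⟩
    have e : m + 2 - 1 = m + 1 := by omega
    rw [e] at a1 a5
    have hpos : 0 < (m+2) * (m+1) := by positivity
    apply Nat.le_of_mul_le_mul_left _ hpos
    have b1 : (m+1) * ((m+2) * NN) ≤ (m+1) * (W + E) := Nat.mul_le_mul_left _ a2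
    have b2 : (m+2) * P ≤ (m+2) * ((m+1) * LL) := Nat.mul_le_mul_left _ (a3.trans a5)
    have b3 : (m+2) * W = (m+2) * P + (m+2) * T := by rw [← a6]; ring
    nlinarith
  omega
end
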